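/- Let d ≥ 2, 0 ≤ c ≤ d − 1 and s ≥ 1 be integers, and let u = (u₀, u₁, …, u_s) ∈ [0,1]^{s+1}. Then the local density g_s(u) exists; that is: (i) for every η > 0 the limit L(u, η) := lim_{Q→∞} #{(q₀, …, q_s) ∈ D_s^Q(c,d) : |q_i/Q − u_i| < η for all 0 ≤ i ≤ s} / #D_s^Q(c,d) exists, and (ii) the limit g_s(u) := lim_{η→0} L(u, η)/(4η²) exists in [0, +∞]. -/

import Mathlib

open Filter

/-- The Farey fractions of order `Q` with denominator `≡ c (mod d)`. -/
def FareyFracCD (Q c d : ℕ) : Set ℚ := {x | 0 ≤ x ∧ x ≤ 1 ∧ x.den ≤ Q ∧ x.den % d = c}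

/-- `f 0 < f 1 < ⋯ < f s` are `s + 1` consecutive fractions of `F^Q(c, d)`. -/
def FareyCDConsecTuple (Q c d s : ℕ) (f : Fin (s + 1) → ℚ) : Prop :=
  (∀ i, f i ∈ FareyFracCD Q c d) ∧
    ∀ i : Fin s, f i.castSucc < f i.succ ∧
      ∀ z ∈ FareyFracCD Q c d, ¬ (f i.castSucc < z ∧ z < f i.succ)

/-- `D_s^Q(c, d)`: the set of `(s+1)`-tuples of denominators of `s + 1` consecutive
fractions of `F^Q(c, d)`. -/
def DsQ (Q c d s : ℕ) : Set (Fin (s + 1) → ℕ) :=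
  {q | ∃ f : Fin (s + 1) → ℚ, FareyCDConsecTuple Q c d s f ∧ ∀ i, q i = (f i).den}

open MeasureTheory

/-- Rescaling of an integer vector. -/
noncomputable def rescale (Q : ℕ) (z : ℤ × ℤ) : ℝ × ℝ := ((z.1 : ℝ) / Q, (z.2 : ℝ) / Q)

/-- The number of points of `A` whose rescaling lies in `Ω`. -/
noncomputable def latticeCount (A : Set (ℤ × ℤ)) (Ω : Set (ℝ × ℝ)) (Q : ℕ) : ℝ :=
  (Set.ncard {z | z ∈ A ∧ rescale Q z ∈ Ω} : ℝ)

lemma volume_floor_mem (T : Finset (ℤ × ℤ)) {R : ℝ} (hR : 0 < R) :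
    volume {x : ℝ × ℝ | ((⌊R * x.1⌋, ⌊R * x.2⌋) : ℤ × ℤ) ∈ T} =
      ENNReal.ofReal (T.card / R ^ 2) := by
  have hset : {x : ℝ × ℝ | ((⌊R * x.1⌋, ⌊R * x.2⌋) : ℤ × ℤ) ∈ T} =
      ⋃ t ∈ T, (Set.Ico ((t.1 : ℝ) / R) ((t.1 + 1 : ℝ) / R)) ×ˢ
        (Set.Ico ((t.2 : ℝ) / R) ((t.2 + 1 : ℝ) / R)) := by
    ext x
    simp only [Set.mem_ofPred_eq, Set.mem_iUnion, Set.mem_prod, Set.mem_Ico, exists_prop]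
    have key : ∀ (y : ℝ) (m : ℤ), (⌊R * y⌋ = m ↔ (m : ℝ) / R ≤ y ∧ y < (m + 1 : ℝ) / R) := by
      intro y m
      rw [Int.floor_eq_iff, div_le_iff₀ hR, lt_div_iff₀ hR, mul_comm R y]
    constructor
    · intro h
      exact ⟨_, h, (key _ _).1 rfl, (key _ _).1 rfl⟩
    · rintro ⟨t, ht, h1, h2⟩
      rw [(key _ _).2 h1, (key _ _).2 h2]
      exact ht
  rw [hset, measure_biUnion_finset]
  · have : ∀ t ∈ T, volume ((Set.Ico ((t.1 : ℝ) / R) ((t.1 + 1 : ℝ) / R)) ×ˢ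
        (Set.Ico ((t.2 : ℝ) / R) ((t.2 + 1 : ℝ) / R))) = ENNReal.ofReal (1 / R ^ 2) := by
      intro t _
      rw [Measure.volume_eq_prod, Measure.prod_prod, Real.volume_Ico, Real.volume_Ico,
        ← ENNReal.ofReal_mul]
      · congr 1
        field_simp
        ring
      · rw [← sub_div]
        have : (t.1 : ℝ) + 1 - t.1 = 1 := by ring
        rw [this]
        positivity
    rw [Finset.sum_congr rfl this, Finset.sum_const, nsmul_eq_mul, div_eq_mul_one_div (T.card : ℝ),
      ENNReal.ofReal_mul (by positivity), ENNReal.ofReal_natCast]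
  · intro t _ t' _ hne
    simp only [Function.onFun]
    rw [Set.disjoint_left]
    rintro x ⟨h1, h2⟩ ⟨h3, h4⟩
    apply hne
    have key : ∀ (y : ℝ) (m : ℤ), y ∈ Set.Ico ((m : ℝ) / R) ((m + 1 : ℝ) / R) → ⌊R * y⌋ = m := by
      intro y m h
      rw [Int.floor_eq_iff, mul_comm R y]
      exact ⟨(div_le_iff₀ hR).1 h.1, (lt_div_iff₀ hR).1 h.2⟩
    ext
    · exact (key _ _ h1).symm.trans (key _ _ h3)
    · exact (key _ _ h2).symm.trans (key _ _ h4)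
  · intro t _
    exact measurableSet_Ico.prod measurableSet_Ico

lemma finite_rescale_mem {Ω : Set (ℝ × ℝ)} (hb : Bornology.IsBounded Ω) {Q : ℕ} (hQ : 0 < Q) :
    {z : ℤ × ℤ | rescale Q z ∈ Ω}.Finite := by
  obtain ⟨r, hr⟩ := (Metric.isBounded_iff_subset_closedBall (0 : ℝ × ℝ)).1 hb
  have hQ' : (0 : ℝ) < Q := by exact_mod_cast hQ
  apply Set.Finite.subset (Set.finite_Icc ((-⌈r * Q⌉, -⌈r * Q⌉) : ℤ × ℤ) (⌈r * Q⌉, ⌈r * Q⌉))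
  intro z hz
  have h := hr hz
  rw [Metric.mem_closedBall, dist_zero_right, Prod.norm_def] at h
  have h1 := (le_max_left _ _).trans h
  have h2 := (le_max_right _ _).trans h
  simp only [rescale, Real.norm_eq_abs, abs_div, Nat.abs_cast] at h1 h2
  rw [div_le_iff₀ hQ'] at h1 h2
  have h3 := h1.trans (Int.le_ceil _)
  have h4 := h2.trans (Int.le_ceil _)
  rw [abs_le] at h3 h4
  refine ⟨⟨?_, ?_⟩, ?_, ?_⟩ <;> simp only
  · exact_mod_cast h3.1
  · exact_mod_cast h4.1
  · exact_mod_cast h3.2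
  · exact_mod_cast h4.2

lemma tendsto_shifted_floor (M r : ℤ) (hM : 0 < M) (x : ℝ) :
    Tendsto (fun Q : ℕ => ((M * ⌊(Q : ℝ) / M * x⌋ + r : ℤ) : ℝ) / Q) atTop (nhds x) := by
  have hM' : (0 : ℝ) < M := by exact_mod_cast hM
  rw [tendsto_iff_norm_sub_tendsto_zero]
  have hlim : Tendsto (fun Q : ℕ => ((M : ℝ) + |(r : ℝ)|) / Q) atTop (nhds 0) :=
    tendsto_const_div_atTop_nhds_zero_nat _
  refine squeeze_zero' (Eventually.of_forall fun _ => norm_nonneg _) ?_ hlim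
  filter_upwards [eventually_gt_atTop 0] with Q hQ
  have hQ' : (0 : ℝ) < Q := by exact_mod_cast hQ
  have e : ((M * ⌊(Q : ℝ) / M * x⌋ + r : ℤ) : ℝ) / Q - x =
      ((r : ℝ) - M * Int.fract ((Q : ℝ) / M * x)) / Q := by
    rw [Int.fract]
    push_cast
    field_simp
    ring
  rw [e, norm_div, Real.norm_eq_abs, Real.norm_eq_abs, abs_of_pos hQ']
  gcongr
  have h0 := Int.fract_nonneg ((Q : ℝ) / M * x)
  have h1 := (Int.fract_lt_one ((Q : ℝ) / M * x)).le
  calc |(r : ℝ) - M * Int.fract ((Q : ℝ) / M * x)|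
      ≤ |(r : ℝ)| + |M * Int.fract ((Q : ℝ) / M * x)| := abs_sub _ _
    _ ≤ |(r : ℝ)| + M := by
        gcongr
        rw [abs_of_nonneg (by positivity)]
        nlinarith
    _ = _ := by ring

lemma measureReal_interior_eq {Ω : Set (ℝ × ℝ)} (hf : volume (frontier Ω) = 0) :
    volume (interior Ω) = volume Ω := by
  apply le_antisymm (measure_mono interior_subset)
  calc volume Ω ≤ volume (interior Ω ∪ frontier Ω) := by
        apply measure_mono
        intro x hx
        by_cases h : x ∈ interior Ω
        · exact Or.inl h
        · exact Or.inr ⟨subset_closure hx, h⟩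
    _ ≤ _ := (measure_union_le _ _).trans (by rw [hf, add_zero])

/-- Counting points of a residue class in a dilated Jordan region. -/
lemma tendsto_count_residue {Ω : Set (ℝ × ℝ)} (hb : Bornology.IsBounded Ω)
    (hf : volume (frontier Ω) = 0) (M : ℤ) (hM : 0 < M) (r : ℤ × ℤ) :
    Tendsto (fun Q : ℕ => (Set.ncard {y : ℤ × ℤ | rescale Q (M * y.1 + r.1, M * y.2 + r.2) ∈ Ω} : ℝ)
      / (Q : ℝ) ^ 2) atTop (nhds (volume.real Ω / (M : ℝ) ^ 2)) := by
  have hM' : (0 : ℝ) < M := by exact_mod_cast hM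
  obtain ⟨ρ, hρ⟩ := (Metric.isBounded_iff_subset_closedBall (0 : ℝ × ℝ)).1 hb
  set g : ℕ → ℝ × ℝ → ℝ × ℝ := fun Q x =>
    rescale Q (M * ⌊(Q : ℝ) / M * x.1⌋ + r.1, M * ⌊(Q : ℝ) / M * x.2⌋ + r.2) with hg
  have hgt : ∀ x, Tendsto (fun Q => g Q x) atTop (nhds x) := fun x =>
    (tendsto_shifted_floor M r.1 hM x.1).prodMk_nhds (tendsto_shifted_floor M r.2 hM x.2)
  have hTf : ∀ Q : ℕ, 0 < Q →
      {y : ℤ × ℤ | rescale Q (M * y.1 + r.1, M * y.2 + r.2) ∈ Ω}.Finite := by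
    intro Q hQ
    refine Set.Finite.preimage (f := fun y : ℤ × ℤ => ((M * y.1 + r.1, M * y.2 + r.2) : ℤ × ℤ))
      (Function.Injective.injOn ?_) (finite_rescale_mem hb hQ)
    intro a b hab
    simp only [Prod.mk.injEq, add_left_inj, mul_eq_mul_left_iff] at hab
    ext
    · exact hab.1.resolve_right hM.ne'
    · exact hab.2.resolve_right hM.ne'
  have hvol : ∀ Q : ℕ, 0 < Q → volume {x | g Q x ∈ Ω} = ENNReal.ofReal
      ((Set.ncard {y : ℤ × ℤ | rescale Q (M * y.1 + r.1, M * y.2 + r.2) ∈ Ω} : ℝ)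
        / ((Q : ℝ) / M) ^ 2) := by
    intro Q hQ
    have hQ' : (0 : ℝ) < Q := by exact_mod_cast hQ
    rw [Set.ncard_eq_toFinset_card _ (hTf Q hQ), ← volume_floor_mem _ (by positivity)]
    congr 1
    ext x
    simp [hg]
  have hmeas : ∀ Q : ℕ, MeasurableSet {x | g Q x ∈ Ω} := by
    intro Q
    have h1 : Measurable (fun x : ℝ × ℝ => ((⌊(Q : ℝ) / M * x.1⌋, ⌊(Q : ℝ) / M * x.2⌋) : ℤ × ℤ)) := by
      fun_prop
    exact h1 (MeasurableSet.of_discrete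
      (s := {y : ℤ × ℤ | rescale Q (M * y.1 + r.1, M * y.2 + r.2) ∈ Ω}))
  have hsub : ∀ᶠ Q : ℕ in atTop, {x | g Q x ∈ Ω} ⊆ Metric.closedBall 0 (ρ + (M + |(r.1 : ℝ)| + |(r.2 : ℝ)|)) := by
    filter_upwards [eventually_gt_atTop 0] with Q hQ x hx
    have hQ1 : (1 : ℝ) ≤ Q := by exact_mod_cast hQ
    have hQ' : (0 : ℝ) < Q := by linarith
    have h := hρ hx
    rw [Metric.mem_closedBall, dist_zero_right, Prod.norm_def, max_le_iff] at h ⊢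
    have key : ∀ (x : ℝ) (r : ℤ), |((M * ⌊(Q : ℝ) / M * x⌋ + r : ℤ) : ℝ) / Q| ≤ ρ →
        |x| ≤ ρ + (M + |(r : ℝ)|) := by
      intro x r h
      have e : x = ((M * ⌊(Q : ℝ) / M * x⌋ + r : ℤ) : ℝ) / Q -
          ((r : ℝ) - M * Int.fract ((Q : ℝ) / M * x)) / Q := by
        rw [Int.fract]
        push_cast
        field_simp
        ring
      have h0 := Int.fract_nonneg ((Q : ℝ) / M * x)
      have h1 := (Int.fract_lt_one ((Q : ℝ) / M * x)).le
      have h2 : |((r : ℝ) - M * Int.fract ((Q : ℝ) / M * x)) / Q| ≤ M + |(r : ℝ)| := by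
        rw [abs_div, abs_of_pos hQ']
        apply (div_le_self (abs_nonneg _) hQ1).trans
        calc |(r : ℝ) - M * Int.fract ((Q : ℝ) / M * x)|
            ≤ |(r : ℝ)| + |M * Int.fract ((Q : ℝ) / M * x)| := abs_sub _ _
          _ ≤ |(r : ℝ)| + M := by
              gcongr
              rw [abs_of_nonneg (by positivity)]
              nlinarith
          _ = _ := by ring
      rw [e]
      exact (abs_sub _ _).trans (add_le_add h h2)
    have h1 := key _ _ h.1
    have h2 := key _ _ h.2
    constructor
    · rw [Real.norm_eq_abs]; linarith [abs_nonneg (r.2 : ℝ)]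
    · rw [Real.norm_eq_abs]; linarith [abs_nonneg (r.1 : ℝ)]
  have hconv : ∀ᵐ x : ℝ × ℝ, ∀ᶠ Q : ℕ in atTop, x ∈ {x | g Q x ∈ Ω} ↔ x ∈ interior Ω := by
    have : ∀ᵐ x : ℝ × ℝ, x ∉ frontier Ω := by
      rw [ae_iff]; simpa using hf
    filter_upwards [this] with x hx
    by_cases hxi : x ∈ interior Ω
    · have : ∀ᶠ Q in atTop, g Q x ∈ interior Ω := (hgt x).eventually (isOpen_interior.mem_nhds hxi)
      filter_upwards [this] with Q hQ
      exact ⟨fun _ => hxi, fun _ => interior_subset hQ⟩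
    · have hxc : x ∈ (closure Ω)ᶜ := fun h => hx ⟨h, hxi⟩
      have : ∀ᶠ Q in atTop, g Q x ∈ (closure Ω)ᶜ :=
        (hgt x).eventually (isClosed_closure.isOpen_compl.mem_nhds hxc)
      filter_upwards [this] with Q hQ
      exact ⟨fun h => absurd (subset_closure h) hQ, fun h => absurd h hxi⟩
  have hlim := tendsto_measure_of_ae_tendsto_indicator (μ := volume) atTop
    (isOpen_interior (s := Ω)).measurableSet hmeas
    Metric.isClosed_closedBall.measurableSet
    (measure_closedBall_lt_top).ne hsub hconv
  rw [measureReal_interior_eq hf] at hlim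
  have hfin : volume Ω ≠ ⊤ := hb.measure_lt_top.ne
  have hlim2 := (ENNReal.tendsto_toReal hfin).comp hlim
  have hlim3 := hlim2.div_const ((M : ℝ) ^ 2)
  refine hlim3.congr' ?_
  filter_upwards [eventually_gt_atTop 0] with Q hQ
  have hQ' : (0 : ℝ) < Q := by exact_mod_cast hQ
  simp only [Function.comp]
  rw [hvol Q hQ, ENNReal.toReal_ofReal (by positivity)]
  field_simp

lemma exists_tendsto_of_approx (f : ℕ → ℝ)
    (h : ∀ ε > 0, ∃ (g : ℕ → ℝ) (l : ℝ), Tendsto g atTop (nhds l) ∧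
      ∀ᶠ Q in atTop, |f Q - g Q| ≤ ε) : ∃ L, Tendsto f atTop (nhds L) := by
  apply cauchySeq_tendsto_of_complete
  rw [Metric.cauchySeq_iff']
  intro ε hε
  obtain ⟨g, l, hg, hfg⟩ := h (ε / 5) (by positivity)
  have h1 := (Metric.tendsto_nhds.1 hg) (ε / 5) (by positivity)
  obtain ⟨N, hN⟩ := eventually_atTop.1 (hfg.and h1)
  refine ⟨N, fun n hn => ?_⟩
  have a := hN n hn
  have b := hN N le_rfl
  rw [Real.dist_eq] at *
  have a1 := abs_le.1 a.1
  have a2 := abs_lt.1 a.2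
  have b1 := abs_le.1 b.1
  have b2 := abs_lt.1 b.2
  rw [abs_lt]
  constructor <;> linarith

lemma ncard_biUnion_finset {ι α : Type*} (S : Finset ι) {s : ι → Set α}
    (hd : (S : Set ι).PairwiseDisjoint s) (hs : ∀ i, (s i).Finite) :
    (⋃ i ∈ S, s i).ncard = ∑ i ∈ S, (s i).ncard := by
  have h := S.finite_toSet.ncard_biUnion (fun i _ => hs i) hd
  rw [finsum_mem_coe_finset] at h
  simpa using h

/-- `A` has density `δ` in every Jordan region. -/
def HasDens (A : Set (ℤ × ℤ)) (δ : ℝ) : Prop :=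
  ∀ Ω : Set (ℝ × ℝ), Bornology.IsBounded Ω → volume (frontier Ω) = 0 →
    Tendsto (fun Q : ℕ => latticeCount A Ω Q / (Q : ℝ) ^ 2) atTop (nhds (δ * volume.real Ω))

/-- Sets that agree with a periodic set up to small density. -/
def AlmostPeriodic (A : Set (ℤ × ℤ)) : Prop :=
  ∀ ε : ℝ, 0 < ε → ∃ (M : ℤ) (A' : Set (ℤ × ℤ)), 0 < M ∧ (∀ z v, z + M • v ∈ A' ↔ z ∈ A') ∧
    ∀ᶠ Q : ℕ in atTop, (Set.ncard {z : ℤ × ℤ | (|z.1| ≤ Q ∧ |z.2| ≤ Q) ∧ ¬ (z ∈ A ↔ z ∈ A')} : ℝ)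
      ≤ ε * (Q : ℝ) ^ 2

lemma finite_int_box (Q : ℤ) : {z : ℤ × ℤ | |z.1| ≤ Q ∧ |z.2| ≤ Q}.Finite := by
  apply Set.Finite.subset (Set.finite_Icc ((-Q, -Q) : ℤ × ℤ) (Q, Q))
  rintro z ⟨h1, h2⟩
  rw [abs_le] at h1 h2
  exact ⟨⟨h1.1, h2.1⟩, ⟨h1.2, h2.2⟩⟩

lemma hasDens_of_periodic {A : Set (ℤ × ℤ)} {M : ℤ} (hM : 0 < M)
    (hA : ∀ z v, z + M • v ∈ A ↔ z ∈ A) : ∃ δ, HasDens A δ := by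
  classical
  set S : Finset (ℤ × ℤ) := (Finset.Ico 0 M ×ˢ Finset.Ico 0 M).filter (· ∈ A) with hS
  refine ⟨∑ r ∈ S, 1 / (M : ℝ) ^ 2, fun Ω hb hf => ?_⟩
  have h1 : Tendsto (fun Q : ℕ => ∑ r ∈ S,
      (Set.ncard {y : ℤ × ℤ | rescale Q (M * y.1 + r.1, M * y.2 + r.2) ∈ Ω} : ℝ) / (Q : ℝ) ^ 2)
      atTop (nhds (∑ r ∈ S, volume.real Ω / (M : ℝ) ^ 2)) :=
    tendsto_finsetSum _ fun r _ => tendsto_count_residue hb hf M hM r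
  have h2 : (∑ r ∈ S, 1 / (M : ℝ) ^ 2) * volume.real Ω = ∑ r ∈ S, volume.real Ω / (M : ℝ) ^ 2 := by
    rw [Finset.sum_mul]
    exact Finset.sum_congr rfl fun _ _ => by ring
  rw [h2]
  refine h1.congr' ?_
  filter_upwards [eventually_gt_atTop 0] with Q hQ
  rw [← Finset.sum_div]
  congr 1
  have hset : {z | z ∈ A ∧ rescale Q z ∈ Ω} = ⋃ r ∈ S,
      (fun y : ℤ × ℤ => ((M * y.1 + r.1, M * y.2 + r.2) : ℤ × ℤ)) ''
        {y : ℤ × ℤ | rescale Q (M * y.1 + r.1, M * y.2 + r.2) ∈ Ω} := by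
    ext z
    simp only [Set.mem_iUnion, Set.mem_image, exists_prop]
    constructor
    · rintro ⟨hz, hzΩ⟩
      have e : ((M * (z.1 / M) + z.1 % M, M * (z.2 / M) + z.2 % M) : ℤ × ℤ) = z := by
        ext <;> exact Int.mul_ediv_add_emod _ _
      refine ⟨(z.1 % M, z.2 % M), ?_, (z.1 / M, z.2 / M), ?_, e⟩
      · simp only [hS, Finset.mem_filter, Finset.mem_product, Finset.mem_Ico]
        refine ⟨⟨⟨Int.emod_nonneg _ hM.ne', Int.emod_lt_of_pos _ hM⟩,
          ⟨Int.emod_nonneg _ hM.ne', Int.emod_lt_of_pos _ hM⟩⟩, ?_⟩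
        rw [← hA _ (z.1 / M, z.2 / M)]
        have e2 : ((z.1 % M, z.2 % M) : ℤ × ℤ) + M • ((z.1 / M, z.2 / M) : ℤ × ℤ) = z := by
          ext <;> simp [Int.emod_add_mul_ediv]
        rw [e2]
        exact hz
      · show rescale Q _ ∈ Ω
        rw [e]; exact hzΩ
    · rintro ⟨r, hr, y, hy, rfl⟩
      refine ⟨?_, hy⟩
      have := (hA r y).2 (Finset.mem_filter.1 hr).2
      convert this using 1
      ext <;> simp <;> ring
  rw [latticeCount, hset]
  have hinj : ∀ r : ℤ × ℤ, Function.Injective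
      (fun y : ℤ × ℤ => ((M * y.1 + r.1, M * y.2 + r.2) : ℤ × ℤ)) := by
    intro r a b hab
    simp only [Prod.mk.injEq, add_left_inj, mul_eq_mul_left_iff] at hab
    ext
    · exact hab.1.resolve_right hM.ne'
    · exact hab.2.resolve_right hM.ne'
  have hTf : ∀ r : ℤ × ℤ,
      {y : ℤ × ℤ | rescale Q (M * y.1 + r.1, M * y.2 + r.2) ∈ Ω}.Finite := fun r =>
    Set.Finite.preimage (f := fun y : ℤ × ℤ => ((M * y.1 + r.1, M * y.2 + r.2) : ℤ × ℤ))
      (hinj r).injOn (finite_rescale_mem hb hQ)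
  have hd : (S : Set (ℤ × ℤ)).PairwiseDisjoint (fun r =>
      (fun y : ℤ × ℤ => ((M * y.1 + r.1, M * y.2 + r.2) : ℤ × ℤ)) ''
        {y : ℤ × ℤ | rescale Q (M * y.1 + r.1, M * y.2 + r.2) ∈ Ω}) := by
    intro r hr r' hr' hne
    simp only [Function.onFun]
    rw [Set.disjoint_left]
    rintro _ ⟨y, _, rfl⟩ ⟨y', _, h⟩
    apply hne
    simp only [hS, Finset.coe_filter, Set.mem_ofPred_eq, Finset.mem_product, Finset.mem_Ico] at hr hr'
    simp only [Prod.mk.injEq] at h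
    have key : ∀ a b x x' : ℤ, 0 ≤ a → a < M → 0 ≤ b → b < M → M * x' + b = M * x + a → a = b := by
      intro a b x x' h1 h2 h3 h4 h5
      have h6 : (M * x' + b) % M = b := by
        rw [add_comm, Int.add_mul_emod_self_left, Int.emod_eq_of_lt h3 h4]
      have h7 : (M * x + a) % M = a := by
        rw [add_comm, Int.add_mul_emod_self_left, Int.emod_eq_of_lt h1 h2]
      rw [← h6, ← h7, h5]
    ext
    · exact key _ _ _ _ hr.1.1.1 hr.1.1.2 hr'.1.1.1 hr'.1.1.2 h.1
    · exact key _ _ _ _ hr.1.2.1 hr.1.2.2 hr'.1.2.1 hr'.1.2.2 h.2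
  rw [ncard_biUnion_finset S hd fun r => (hTf r).image _]
  push_cast
  exact Finset.sum_congr rfl fun r _ => by rw [Set.ncard_image_of_injective _ (hinj r)]

lemma abs_ncard_sub_ncard_le {α : Type*} {S T U : Set α} (hS : S.Finite) (hT : T.Finite)
    (hU : U.Finite) (h1 : S \ T ⊆ U) (h2 : T \ S ⊆ U) :
    |(S.ncard : ℝ) - T.ncard| ≤ U.ncard := by
  have a : S.ncard ≤ T.ncard + U.ncard :=
    (Set.ncard_le_ncard (fun x hx => by
      by_cases h : x ∈ T
      · exact Or.inl h
      · exact Or.inr (h1 ⟨hx, h⟩)) (hT.union hU)).trans (Set.ncard_union_le _ _)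
  have b : T.ncard ≤ S.ncard + U.ncard :=
    (Set.ncard_le_ncard (fun x hx => by
      by_cases h : x ∈ S
      · exact Or.inl h
      · exact Or.inr (h2 ⟨hx, h⟩)) (hS.union hU)).trans (Set.ncard_union_le _ _)
  have a' : (S.ncard : ℝ) ≤ T.ncard + U.ncard := by exact_mod_cast a
  have b' : (T.ncard : ℝ) ≤ S.ncard + U.ncard := by exact_mod_cast b
  rw [abs_le]
  constructor <;> linarith

lemma exists_nat_bound {Ω : Set (ℝ × ℝ)} (hb : Bornology.IsBounded Ω) :
    ∃ ρ : ℕ, 0 < ρ ∧ ∀ (Q : ℕ) (z : ℤ × ℤ), 0 < Q → rescale Q z ∈ Ω →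
      |z.1| ≤ (ρ * Q : ℕ) ∧ |z.2| ≤ (ρ * Q : ℕ) := by
  obtain ⟨r, hr⟩ := (Metric.isBounded_iff_subset_closedBall (0 : ℝ × ℝ)).1 hb
  refine ⟨⌈r⌉₊ + 1, Nat.succ_pos _, fun Q z hQ hz => ?_⟩
  have hQ' : (0 : ℝ) < Q := by exact_mod_cast hQ
  have h := hr hz
  rw [Metric.mem_closedBall, dist_zero_right, Prod.norm_def, max_le_iff] at h
  simp only [rescale, Real.norm_eq_abs, abs_div, Nat.abs_cast] at h
  rw [div_le_iff₀ hQ', div_le_iff₀ hQ'] at h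
  have h3 : r * Q ≤ ((⌈r⌉₊ + 1 : ℕ) : ℝ) * Q := by
    gcongr
    push_cast
    linarith [Nat.le_ceil r]
  have h4 := h.1.trans h3
  have h5 := h.2.trans h3
  constructor
  · exact_mod_cast h4
  · exact_mod_cast h5

lemma AlmostPeriodic.approx {A : Set (ℤ × ℤ)} (hA : AlmostPeriodic A) {ε : ℝ} (hε : 0 < ε) :
    ∃ (A' : Set (ℤ × ℤ)) (δ : ℝ), HasDens A' δ ∧ ∀ ρ : ℕ, 0 < ρ → ∀ Ω : Set (ℝ × ℝ),
      (∀ (Q : ℕ) (z : ℤ × ℤ), 0 < Q → rescale Q z ∈ Ω →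
        |z.1| ≤ (ρ * Q : ℕ) ∧ |z.2| ≤ (ρ * Q : ℕ)) →
      ∀ᶠ Q : ℕ in atTop, |latticeCount A Ω Q / (Q : ℝ) ^ 2 - latticeCount A' Ω Q / (Q : ℝ) ^ 2|
        ≤ ε * (ρ : ℝ) ^ 2 := by
  obtain ⟨M, A', hM, hper, hev⟩ := hA ε hε
  obtain ⟨δ, hδ⟩ := hasDens_of_periodic hM hper
  refine ⟨A', δ, hδ, fun ρ hρ0 Ω hρ => ?_⟩
  have hmul : Tendsto (fun Q : ℕ => ρ * Q) atTop atTop :=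
    tendsto_id.const_mul_atTop' hρ0
  filter_upwards [hmul.eventually hev, eventually_gt_atTop 0] with Q hQ hQ0
  have hQ' : (0 : ℝ) < Q := by exact_mod_cast hQ0
  rw [← sub_div, abs_div, abs_of_pos (by positivity : (0 : ℝ) < (Q : ℝ) ^ 2),
    div_le_iff₀ (by positivity)]
  have hfb := finite_int_box (ρ * Q : ℕ)
  have hf : ∀ B : Set (ℤ × ℤ), {z | z ∈ B ∧ rescale Q z ∈ Ω}.Finite := fun B =>
    hfb.subset fun z hz => hρ Q z hQ0 hz.2
  refine (abs_ncard_sub_ncard_le (hf A) (hf A')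
    (hfb.subset (fun z (hz : _ ∧ ¬ (z ∈ A ↔ z ∈ A')) => hz.1)) ?_ ?_).trans (hQ.trans_eq ?_)
  · rintro z ⟨hz, hz'⟩
    exact ⟨hρ Q z hQ0 hz.2, fun h => hz' ⟨h.1 hz.1, hz.2⟩⟩
  · rintro z ⟨hz, hz'⟩
    exact ⟨hρ Q z hQ0 hz.2, fun h => hz' ⟨h.2 hz.1, hz.2⟩⟩
  · push_cast
    ring

/-- The half-open unit square. -/
def unitSquare : Set (ℝ × ℝ) := Set.Ico 0 1 ×ˢ Set.Ico 0 1

lemma isBounded_unitSquare : Bornology.IsBounded unitSquare :=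
  (Metric.isBounded_Ico _ _).prod (Metric.isBounded_Ico _ _)

lemma volume_frontier_unitSquare : volume (frontier unitSquare) = 0 :=
  ((convex_Ico 0 1).prod (convex_Ico 0 1)).addHaar_frontier volume

lemma volume_unitSquare : volume.real unitSquare = 1 := by
  simp [unitSquare, Measure.volume_eq_prod, measureReal_def, Measure.prod_prod]

lemma AlmostPeriodic.exists_hasDens {A : Set (ℤ × ℤ)} (hA : AlmostPeriodic A) :
    ∃ δ, HasDens A δ := by
  have hlim : ∀ Ω : Set (ℝ × ℝ), Bornology.IsBounded Ω → volume (frontier Ω) = 0 →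
      ∃ L, Tendsto (fun Q : ℕ => latticeCount A Ω Q / (Q : ℝ) ^ 2) atTop (nhds L) := by
    intro Ω hb hf
    obtain ⟨ρ, hρ0, hρ⟩ := exists_nat_bound hb
    have hρ' : (0 : ℝ) < ρ := by exact_mod_cast hρ0
    apply exists_tendsto_of_approx
    intro ε hε
    obtain ⟨A', δ, hδ, happ⟩ := hA.approx (show 0 < ε / (ρ : ℝ) ^ 2 by positivity)
    refine ⟨_, _, hδ Ω hb hf, ?_⟩
    filter_upwards [happ ρ hρ0 Ω hρ] with Q hQ
    rwa [div_mul_cancel₀ _ (by positivity)] at hQ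
  obtain ⟨δ, hδ⟩ := hlim unitSquare isBounded_unitSquare volume_frontier_unitSquare
  refine ⟨δ, fun Ω hb hf => ?_⟩
  obtain ⟨L, hL⟩ := hlim Ω hb hf
  suffices h : L = δ * volume.real Ω by rwa [← h]
  obtain ⟨ρ, hρ0, hρ⟩ := exists_nat_bound hb
  obtain ⟨ρ₁, hρ₁0, hρ₁⟩ := exists_nat_bound isBounded_unitSquare
  apply eq_of_forall_dist_le
  intro ε hε
  set K : ℝ := (ρ : ℝ) ^ 2 + (ρ₁ : ℝ) ^ 2 * volume.real Ω + 1 with hK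
  have hV : 0 ≤ volume.real Ω := measureReal_nonneg
  have hK0 : 0 < K := by positivity
  obtain ⟨A', δ', hδ', happ⟩ := hA.approx (show 0 < ε / K by positivity)
  have h1 : |L - δ' * volume.real Ω| ≤ ε / K * (ρ : ℝ) ^ 2 :=
    le_of_tendsto ((hL.sub (hδ' Ω hb hf)).abs) (happ ρ hρ0 Ω hρ)
  have h2 : |δ - δ'| ≤ ε / K * (ρ₁ : ℝ) ^ 2 := by
    have := le_of_tendsto ((hδ.sub (hδ' _ isBounded_unitSquare volume_frontier_unitSquare)).abs)
      (happ ρ₁ hρ₁0 _ hρ₁)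
    rwa [volume_unitSquare, mul_one] at this
  rw [Real.dist_eq]
  calc |L - δ * volume.real Ω| = |(L - δ' * volume.real Ω) - (δ - δ') * volume.real Ω| := by
        congr 1; ring
    _ ≤ |L - δ' * volume.real Ω| + |(δ - δ') * volume.real Ω| := abs_sub _ _
    _ ≤ ε / K * (ρ : ℝ) ^ 2 + ε / K * (ρ₁ : ℝ) ^ 2 * volume.real Ω := by
        rw [abs_mul, abs_of_nonneg hV]
        gcongr
    _ = ε / K * (K - 1) := by rw [hK]; ring
    _ ≤ ε / K * K := by gcongr; linarith
    _ = ε := by field_simp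

/-- Boolean combinations of almost periodic sets are almost periodic. -/
lemma AlmostPeriodic.comb {ι : Type*} [Fintype ι] {A : ι → Set (ℤ × ℤ)}
    (hA : ∀ i, AlmostPeriodic (A i)) (Ψ : (ι → Prop) → Prop) :
    AlmostPeriodic {z | Ψ fun i => z ∈ A i} := by
  intro ε hε
  have hc : (0 : ℝ) < Fintype.card ι + 1 := by positivity
  choose M A' hM hper hev using fun i => hA i (ε / (Fintype.card ι + 1)) (by positivity)
  refine ⟨∏ i, M i, {z | Ψ fun i => z ∈ A' i}, Finset.prod_pos fun i _ => hM i, ?_, ?_⟩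
  · intro z v
    have : ∀ i, (z + (∏ i, M i) • v ∈ A' i) = (z ∈ A' i) := by
      intro i
      obtain ⟨k, hk⟩ := Finset.dvd_prod_of_mem M (Finset.mem_univ i)
      rw [hk, mul_smul]
      exact propext (hper i z _)
    simp only [Set.mem_ofPred_eq, this]
  · filter_upwards [eventually_all.2 hev] with Q hQ
    have hsub : {z : ℤ × ℤ | (|z.1| ≤ Q ∧ |z.2| ≤ Q) ∧
        ¬ (z ∈ {z | Ψ fun i => z ∈ A i} ↔ z ∈ {z | Ψ fun i => z ∈ A' i})} ⊆
        ⋃ i ∈ (Finset.univ : Finset ι),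
          {z : ℤ × ℤ | (|z.1| ≤ Q ∧ |z.2| ≤ Q) ∧ ¬ (z ∈ A i ↔ z ∈ A' i)} := by
      rintro z ⟨hz, hne⟩
      by_contra hcon
      simp only [Finset.mem_univ, Set.iUnion_true, Set.mem_iUnion, not_exists,
        Set.mem_ofPred_eq, not_and, not_not] at hcon
      apply hne
      have : (fun i => z ∈ A i) = fun i => z ∈ A' i := funext fun i => propext (hcon i hz)
      simp only [Set.mem_ofPred_eq, this]
    have hfin : (⋃ i ∈ (Finset.univ : Finset ι),
          {z : ℤ × ℤ | (|z.1| ≤ Q ∧ |z.2| ≤ Q) ∧ ¬ (z ∈ A i ↔ z ∈ A' i)}).Finite :=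
      (Finset.univ : Finset ι).finite_toSet.biUnion fun i _ =>
        (finite_int_box Q).subset fun z hz => hz.1
    have h1 := (Set.ncard_le_ncard hsub hfin).trans (Finset.set_ncard_biUnion_le _ _)
    calc _ ≤ ((∑ i, Set.ncard
            {z : ℤ × ℤ | (|z.1| ≤ Q ∧ |z.2| ≤ Q) ∧ ¬ (z ∈ A i ↔ z ∈ A' i)} : ℕ) : ℝ) := by
          exact_mod_cast h1
      _ ≤ ∑ i : ι, ε / (Fintype.card ι + 1) * (Q : ℝ) ^ 2 := by
          push_cast
          exact Finset.sum_le_sum fun i _ => hQ i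
      _ = ε * (Fintype.card ι / (Fintype.card ι + 1)) * (Q : ℝ) ^ 2 := by
          rw [Finset.sum_const, nsmul_eq_mul, Finset.card_univ]; ring
      _ ≤ ε * 1 * (Q : ℝ) ^ 2 := by
          gcongr
          rw [div_le_one hc]
          linarith
      _ = _ := by ring

/-- The density of an almost periodic set. -/
noncomputable def dens (A : Set (ℤ × ℤ)) : ℝ := open Classical in
  if h : ∃ δ, HasDens A δ then h.choose else 0

lemma AlmostPeriodic.hasDens {A : Set (ℤ × ℤ)} (hA : AlmostPeriodic A) : HasDens A (dens A) := by
  rw [dens, dif_pos hA.exists_hasDens]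
  exact hA.exists_hasDens.choose_spec

lemma latticeCount_mono {A B : Set (ℤ × ℤ)} {Ω : Set (ℝ × ℝ)} (hb : Bornology.IsBounded Ω)
    (h : A ⊆ B) {Q : ℕ} (hQ : 0 < Q) : latticeCount A Ω Q ≤ latticeCount B Ω Q := by
  rw [latticeCount, latticeCount]
  have := Set.ncard_le_ncard (s := {z | z ∈ A ∧ rescale Q z ∈ Ω})
    (t := {z | z ∈ B ∧ rescale Q z ∈ Ω}) (fun z hz => ⟨h hz.1, hz.2⟩)
    ((finite_rescale_mem hb hQ).subset fun z hz => hz.2)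
  exact_mod_cast this

lemma AlmostPeriodic.dens_mono {A B : Set (ℤ × ℤ)} (hA : AlmostPeriodic A) (hB : AlmostPeriodic B)
    (h : A ⊆ B) : dens A ≤ dens B := by
  have h1 := hA.hasDens _ isBounded_unitSquare volume_frontier_unitSquare
  have h2 := hB.hasDens _ isBounded_unitSquare volume_frontier_unitSquare
  rw [volume_unitSquare, mul_one] at h1 h2
  refine le_of_tendsto_of_tendsto h1 h2 ?_
  filter_upwards [eventually_gt_atTop 0] with Q hQ
  have := latticeCount_mono isBounded_unitSquare h hQ
  gcongr

lemma AlmostPeriodic.dens_nonneg {A : Set (ℤ × ℤ)} (hA : AlmostPeriodic A) : 0 ≤ dens A := by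
  have h1 := hA.hasDens _ isBounded_unitSquare volume_frontier_unitSquare
  rw [volume_unitSquare, mul_one] at h1
  exact ge_of_tendsto' h1 fun Q => by unfold latticeCount; positivity

/-- The points whose membership pattern in the family `Ω` is exactly `J`. -/
def patternCell {ι : Type*} (Ω : ι → Set (ℝ × ℝ)) (J : Set ι) : Set (ℝ × ℝ) :=
  {x | ∀ i, x ∈ Ω i ↔ i ∈ J}

lemma volume_frontier_inter {S T : Set (ℝ × ℝ)} (hS : volume (frontier S) = 0)
    (hT : volume (frontier T) = 0) : volume (frontier (S ∩ T)) = 0 := by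
  refine measure_mono_null ((frontier_inter_subset S T).trans ?_) (measure_union_null hS hT)
  exact Set.union_subset_union Set.inter_subset_left Set.inter_subset_right

lemma volume_frontier_patternCell {ι : Type*} [Finite ι] {Ω : ι → Set (ℝ × ℝ)}
    (hΩ : ∀ i, volume (frontier (Ω i)) = 0) (J : Set ι) :
    volume (frontier (patternCell Ω J)) = 0 := by
  classical
  have : Fintype ι := Fintype.ofFinite ι
  have h : ∀ S : Finset ι, volume (frontier {x | ∀ i ∈ S, x ∈ Ω i ↔ i ∈ J}) = 0 := by
    intro S
    induction S using Finset.induction_on with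
    | empty => simp
    | insert a S _ ih =>
      have e : {x | ∀ i ∈ insert a S, x ∈ Ω i ↔ i ∈ J} =
          {x | x ∈ Ω a ↔ a ∈ J} ∩ {x | ∀ i ∈ S, x ∈ Ω i ↔ i ∈ J} := by
        ext x; simp
      rw [e]
      refine volume_frontier_inter ?_ ih
      by_cases ha : a ∈ J
      · simpa [ha] using hΩ a
      · have : {x | x ∈ Ω a ↔ a ∈ J} = (Ω a)ᶜ := by ext; simp [ha]
        rw [this, frontier_compl]
        exact hΩ a
  simpa [patternCell] using h Finset.univ

open Classical in
/-- Counting lattice points subject to arithmetic and geometric conditions. -/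
lemma tendsto_count_comb {ι : Type*} [Fintype ι] {A : ι → Set (ℤ × ℤ)}
    (hA : ∀ i, AlmostPeriodic (A i)) {Ω : ι → Set (ℝ × ℝ)}
    (hΩ : ∀ i, volume (frontier (Ω i)) = 0) {B : Set (ℝ × ℝ)} (hb : Bornology.IsBounded B)
    (hB : volume (frontier B) = 0) (Ψ : (ι → Prop) → (ι → Prop) → Prop) :
    Tendsto (fun Q : ℕ => (Set.ncard {z : ℤ × ℤ | rescale Q z ∈ B ∧
        Ψ (fun i => z ∈ A i) (fun i => rescale Q z ∈ Ω i)} : ℝ) / (Q : ℝ) ^ 2) atTop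
      (nhds (∑ J : Set ι, dens {z | Ψ (fun i => z ∈ A i) (fun i => i ∈ J)} *
        volume.real (B ∩ patternCell Ω J))) := by
  have h1 : Tendsto (fun Q : ℕ => ∑ J : Set ι, latticeCount
      {z | Ψ (fun i => z ∈ A i) (fun i => i ∈ J)} (B ∩ patternCell Ω J) Q / (Q : ℝ) ^ 2) atTop
      (nhds (∑ J : Set ι, dens {z | Ψ (fun i => z ∈ A i) (fun i => i ∈ J)} *
        volume.real (B ∩ patternCell Ω J))) := by
    refine tendsto_finsetSum _ fun J _ => ?_
    exact (AlmostPeriodic.comb hA fun p => Ψ p fun i => i ∈ J).hasDens _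
      (hb.subset Set.inter_subset_left)
      (volume_frontier_inter hB (volume_frontier_patternCell hΩ J))
  refine h1.congr' ?_
  filter_upwards [eventually_gt_atTop 0] with Q hQ
  rw [← Finset.sum_div]
  congr 1
  have e : {z : ℤ × ℤ | rescale Q z ∈ B ∧ Ψ (fun i => z ∈ A i) (fun i => rescale Q z ∈ Ω i)} =
      ⋃ J ∈ (Finset.univ : Finset (Set ι)), {z | z ∈ {z | Ψ (fun i => z ∈ A i) (fun i => i ∈ J)} ∧
        rescale Q z ∈ B ∩ patternCell Ω J} := by
    ext z
    simp only [Finset.mem_univ, Set.iUnion_true, Set.mem_iUnion, Set.mem_ofPred_eq,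
      Set.mem_inter_iff, patternCell]
    constructor
    · rintro ⟨hz, hΨ⟩
      exact ⟨{i | rescale Q z ∈ Ω i}, hΨ, hz, fun i => Iff.rfl⟩
    · rintro ⟨J, hΨ, hz, hJ⟩
      refine ⟨hz, ?_⟩
      have : (fun i => rescale Q z ∈ Ω i) = fun i => i ∈ J := funext fun i => propext (hJ i)
      rwa [this]
  rw [e, ncard_biUnion_finset]
  · simp [latticeCount]
  · intro J _ J' _ hne
    simp only [Function.onFun]
    rw [Set.disjoint_left]
    rintro z ⟨_, _, h⟩ ⟨_, _, h'⟩
    apply hne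
    ext i
    exact (h i).symm.trans (h' i)
  · intro J
    exact (finite_rescale_mem hb hQ).subset fun z hz => hz.2.1

/-- The determinant of two integer vectors. -/
def dt (v w : ℤ × ℤ) : ℤ := v.1 * w.2 - v.2 * w.1

/-- The value of the linear form `V` at `z`. -/
def ev (V z : ℤ × ℤ) : ℤ := V.1 * z.1 + V.2 * z.2

/-- Primitive vectors in a given residue class. -/
def primClass (d : ℕ) (ρ : ZMod d × ZMod d) : Set (ℤ × ℤ) :=
  {z | IsCoprime z.1 z.2 ∧ (z.1 : ZMod d) = ρ.1 ∧ (z.2 : ZMod d) = ρ.2}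

/-- The values of two linear forms at the primitive vectors in a residue class. -/
def pairImage (d : ℕ) (ρ : ZMod d × ZMod d) (a b : ℤ × ℤ) : Set (ℤ × ℤ) :=
  {y | ∃ z ∈ primClass d ρ, y = (ev a z, ev b z)}

lemma card_multiples_le (a b : ℤ × ℤ) (R n : ℕ) (hn : 0 < n) (hnR : n ≤ R) :
    (((Finset.Icc (-((R / n : ℕ) : ℤ)) (R / n : ℕ) ×ˢ Finset.Icc (-((R / n : ℕ) : ℤ)) (R / n : ℕ)).image
      fun z : ℤ × ℤ => (ev a (n * z.1, n * z.2), ev b (n * z.1, n * z.2))).card : ℝ)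
      ≤ 9 * (R : ℝ) ^ 2 * ((n : ℝ) ^ 2)⁻¹ := by
  have h1 := Finset.card_image_le (s := Finset.Icc (-((R / n : ℕ) : ℤ)) (R / n : ℕ) ×ˢ
    Finset.Icc (-((R / n : ℕ) : ℤ)) (R / n : ℕ))
    (f := fun z : ℤ × ℤ => (ev a (n * z.1, n * z.2), ev b (n * z.1, n * z.2)))
  have h2 : (Finset.Icc (-((R / n : ℕ) : ℤ)) (R / n : ℕ)).card = 2 * (R / n) + 1 := by
    rw [Int.card_Icc]; omega
  rw [Finset.card_product, h2] at h1
  have h3 : 1 ≤ R / n := Nat.div_pos hnR hn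
  have h4 : (2 * (R / n) + 1) * (2 * (R / n) + 1) ≤ 9 * (R / n) ^ 2 := by nlinarith
  have h5 : ((R / n : ℕ) : ℝ) ≤ R / n := Nat.cast_div_le
  have hn' : (0 : ℝ) < n := by exact_mod_cast hn
  calc _ ≤ ((9 * (R / n) ^ 2 : ℕ) : ℝ) := by exact_mod_cast h1.trans h4
    _ = 9 * ((R / n : ℕ) : ℝ) ^ 2 := by push_cast; ring
    _ ≤ 9 * ((R : ℝ) / n) ^ 2 := by gcongr
    _ = _ := by field_simp

lemma exists_prime_of_not_isCoprime {x y : ℤ} (h : ¬ IsCoprime x y) :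
    ∃ p : ℕ, p.Prime ∧ (p : ℤ) ∣ x ∧ (p : ℤ) ∣ y := by
  rw [Int.isCoprime_iff_gcd_eq_one] at h
  obtain ⟨p, hp, hpd⟩ := Nat.exists_prime_and_dvd h
  exact ⟨p, hp, (Int.natCast_dvd_natCast.2 hpd).trans (Int.gcd_dvd_left ..),
    (Int.natCast_dvd_natCast.2 hpd).trans (Int.gcd_dvd_right ..)⟩

/-- Vectors that are not divisible by any small prime. -/
def siftClass (d P : ℕ) (ρ : ZMod d × ZMod d) : Set (ℤ × ℤ) :=
  {z | (∀ p : ℕ, p.Prime → p ≤ P → ¬ ((p : ℤ) ∣ z.1 ∧ (p : ℤ) ∣ z.2)) ∧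
    (z.1 : ZMod d) = ρ.1 ∧ (z.2 : ZMod d) = ρ.2}

lemma primClass_subset_siftClass (d P : ℕ) (ρ : ZMod d × ZMod d) :
    primClass d ρ ⊆ siftClass d P ρ := by
  rintro z ⟨h1, h2⟩
  refine ⟨fun p hp _ hd => ?_, h2⟩
  have := h1.isUnit_of_dvd' hd.1 hd.2
  rw [Int.isUnit_iff_natAbs_eq] at this
  simp only [Int.natAbs_natCast] at this
  exact hp.one_lt.ne' this

lemma siftClass_add {d P : ℕ} {ρ : ZMod d × ZMod d} {k : ℤ} (hk : ((d * P.factorial : ℕ) : ℤ) ∣ k)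
    {z : ℤ × ℤ} (w : ℤ × ℤ) (hz : z ∈ siftClass d P ρ) : z + k • w ∈ siftClass d P ρ := by
  obtain ⟨h1, h2, h3⟩ := hz
  have hd : ((k : ℤ) : ZMod d) = 0 := by
    rw [ZMod.intCast_zmod_eq_zero_iff_dvd]
    exact (Int.natCast_dvd_natCast.2 (dvd_mul_right ..)).trans hk
  refine ⟨fun p hp hpP hpd => h1 p hp hpP ?_, ?_, ?_⟩
  · have hpk : (p : ℤ) ∣ k := (Int.natCast_dvd_natCast.2
      ((hp.dvd_factorial.2 hpP).trans (dvd_mul_left ..))).trans hk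
    simp only [Prod.fst_add, Prod.snd_add, Prod.smul_fst, Prod.smul_snd, smul_eq_mul] at hpd
    exact ⟨(Int.dvd_add_left (hpk.mul_right _)).1 hpd.1,
      (Int.dvd_add_left (hpk.mul_right _)).1 hpd.2⟩
  · simp [hd, h2]
  · simp [hd, h3]

lemma almostPeriodic_pairImage {d : ℕ} (hd : 0 < d) (ρ : ZMod d × ZMod d) {a b : ℤ × ℤ}
    (hD : dt a b ≠ 0) : AlmostPeriodic (pairImage d ρ a b) := by
  intro ε hε
  set C : ℕ := a.1.natAbs + a.2.natAbs + b.1.natAbs + b.2.natAbs with hC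
  obtain ⟨P, hP⟩ := exists_nat_gt (9 * (C : ℝ) ^ 2 / ε + 2)
  have hP2 : 2 ≤ P := by
    have : (2 : ℝ) ≤ P := le_trans (by have : 0 ≤ 9 * (C : ℝ) ^ 2 / ε := by positivity
                                       linarith) hP.le
    exact_mod_cast this
  set D := dt a b with hDdef
  have hsolve : ∀ z : ℤ × ℤ, b.2 * ev a z - a.2 * ev b z = D * z.1 ∧
      a.1 * ev b z - b.1 * ev a z = D * z.2 := by
    intro z
    simp only [hDdef, dt, ev]
    constructor <;> ring
  refine ⟨D ^ 2 * (d * P.factorial : ℕ), {y | ∃ z ∈ siftClass d P ρ, y = (ev a z, ev b z)},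
    ?_, ?_, ?_⟩
  · have : 0 < d * P.factorial := Nat.mul_pos hd (Nat.factorial_pos _)
    have h3 : 0 < D ^ 2 := by positivity
    have : (0 : ℤ) < (d * P.factorial : ℕ) := by exact_mod_cast this
    exact mul_pos h3 this
  · have key : ∀ (y v : ℤ × ℤ) (k : ℤ), ((d * P.factorial : ℕ) : ℤ) ∣ k →
        (∃ z ∈ siftClass d P ρ, y = (ev a z, ev b z)) →
        ∃ z ∈ siftClass d P ρ, y + (D ^ 2 * k) • v = (ev a z, ev b z) := by
      rintro y v k hk ⟨z, hz, rfl⟩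
      refine ⟨z + (D * k) • (b.2 * v.1 - a.2 * v.2, a.1 * v.2 - b.1 * v.1),
        siftClass_add (hk.mul_left _) _ hz, ?_⟩
      ext <;> simp [ev, hDdef, dt] <;> ring
    intro y v
    constructor
    · intro h
      have := key _ v (-(d * P.factorial : ℕ)) (by simp) h
      simpa [add_assoc, ← add_smul] using this
    · intro h
      exact key _ v _ (dvd_refl _) h
  · refine Eventually.of_forall fun Q => ?_
    set R : ℕ := C * Q with hR
    have hsub : {y : ℤ × ℤ | (|y.1| ≤ Q ∧ |y.2| ≤ Q) ∧ ¬ (y ∈ pairImage d ρ a b ↔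
        y ∈ {y | ∃ z ∈ siftClass d P ρ, y = (ev a z, ev b z)})} ⊆
        ((Finset.Ioc P R).biUnion fun n => (Finset.Icc (-((R / n : ℕ) : ℤ)) (R / n : ℕ) ×ˢ
          Finset.Icc (-((R / n : ℕ) : ℤ)) (R / n : ℕ)).image
          fun z : ℤ × ℤ => (ev a (n * z.1, n * z.2), ev b (n * z.1, n * z.2)) : Finset (ℤ × ℤ)) := by
      rintro y ⟨⟨hy1, hy2⟩, hne⟩
      have hne2 : y ∉ pairImage d ρ a b ∧ ∃ z ∈ siftClass d P ρ, y = (ev a z, ev b z) := by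
        by_contra hcon
        apply hne
        constructor
        · rintro ⟨z, hz, rfl⟩
          exact ⟨z, primClass_subset_siftClass _ _ _ hz, rfl⟩
        · intro h2
          by_contra h3
          exact hcon ⟨h3, h2⟩
      obtain ⟨hn, z, ⟨hz1, hz2⟩, rfl⟩ := hne2
      have hcop : ¬ IsCoprime z.1 z.2 := fun h => hn ⟨z, ⟨h, hz2⟩, rfl⟩
      obtain ⟨p, hp, hp1, hp2⟩ := exists_prime_of_not_isCoprime hcop
      have hpP : P < p := by
        by_contra hcon
        exact hz1 p hp (not_lt.1 hcon) ⟨hp1, hp2⟩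
      have hbd : ∀ x A1 A2 B1 B2 : ℤ, A1 * B1 - A2 * B2 = D * x → |B1| ≤ Q → |B2| ≤ Q →
          |A1| + |A2| ≤ C → |x| ≤ R := by
        intro x A1 A2 B1 B2 h h1 h2 h3
        have hD1 : 1 ≤ |D| := Int.one_le_abs hD
        have e1 : |D| * |x| ≤ |A1| * |B1| + |A2| * |B2| := by
          rw [← abs_mul, ← h, ← abs_mul, ← abs_mul]
          exact abs_sub _ _
        have e2 : |A1| * |B1| ≤ |A1| * Q := by gcongr
        have e3 : |A2| * |B2| ≤ |A2| * Q := by gcongr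
        have e4 : (|A1| + |A2|) * Q ≤ C * Q := by gcongr
        have e5 : |x| ≤ |D| * |x| := le_mul_of_one_le_left (abs_nonneg _) hD1
        rw [hR]; push_cast
        linarith
      obtain ⟨s1, s2⟩ := hsolve z
      have b1 : |z.1| ≤ R := hbd _ _ _ _ _ s1 hy1 hy2 (by rw [hC]; push_cast; have := abs_nonneg a.1; have := abs_nonneg b.1; linarith)
      have b2 : |z.2| ≤ R := hbd _ _ _ _ _ s2 hy2 hy1 (by rw [hC]; push_cast; have := abs_nonneg a.2; have := abs_nonneg b.2; linarith)
      obtain ⟨t1, ht1⟩ := hp1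
      obtain ⟨t2, ht2⟩ := hp2
      have hp0 : (0 : ℤ) < p := by exact_mod_cast hp.pos
      have ht : ∀ t : ℤ, |(p : ℤ) * t| ≤ R → |t| ≤ ((R / p : ℕ) : ℤ) := by
        intro t ht
        rw [abs_mul, abs_of_pos hp0] at ht
        rw [Int.natCast_div, Int.le_ediv_iff_mul_le hp0, mul_comm]
        exact ht
      rw [ht1] at b1
      rw [ht2] at b2
      have c1 := ht _ b1
      have c2 := ht _ b2
      have hpR : p ≤ R := by
        by_contra hcon
        rw [Nat.div_eq_of_lt (not_le.1 hcon)] at c1 c2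
        have d1 : t1 = 0 := by simpa using c1
        have d2 : t2 = 0 := by simpa using c2
        refine hz1 2 Nat.prime_two hP2 ?_
        rw [ht1, ht2, d1, d2]; simp
      simp only [Finset.coe_biUnion, Set.mem_iUnion, Finset.coe_image]
      refine ⟨p, by simpa using ⟨hpP, hpR⟩, (t1, t2), ?_, ?_⟩
      · rw [Finset.mem_coe, Finset.mem_product, Finset.mem_Icc, Finset.mem_Icc]
        exact ⟨abs_le.1 c1, abs_le.1 c2⟩
      · simp only [← ht1, ← ht2]
    have hcard := Set.ncard_le_ncard hsub (Finset.finite_toSet _)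
    rw [Set.ncard_coe_finset] at hcard
    by_cases hPR : P ≤ R
    · have hP0 : (0 : ℝ) < P := by exact_mod_cast (by omega : 0 < P)
      calc _ ≤ _ := Nat.cast_le.2 (hcard.trans Finset.card_biUnion_le)
        _ ≤ ∑ n ∈ Finset.Ioc P R, 9 * (R : ℝ) ^ 2 * ((n : ℝ) ^ 2)⁻¹ := by
          rw [Nat.cast_sum]
          refine Finset.sum_le_sum fun n hn => ?_
          rw [Finset.mem_Ioc] at hn
          exact card_multiples_le a b R n (by omega) hn.2
        _ ≤ 9 * (R : ℝ) ^ 2 * (P : ℝ)⁻¹ := by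
          rw [← Finset.mul_sum]
          gcongr
          refine (sum_Ioc_inv_sq_le_sub (by omega) hPR).trans ?_
          have : (0 : ℝ) ≤ (R : ℝ)⁻¹ := by positivity
          linarith
        _ = (9 * (C : ℝ) ^ 2 / P) * (Q : ℝ) ^ 2 := by rw [hR]; push_cast; field_simp
        _ ≤ _ := by
          gcongr
          rw [div_le_iff₀ hP0]
          have : 9 * (C : ℝ) ^ 2 / ε < P := by linarith
          rw [div_lt_iff₀ hε] at this
          linarith
    · rw [Finset.Ioc_eq_empty (by omega), Finset.biUnion_empty, Finset.card_empty] at hcard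
      have : (_ : ℝ) = 0 := Nat.cast_eq_zero.2 (Nat.le_zero.1 hcard)
      rw [this]
      positivity

lemma almostPeriodic_univ : AlmostPeriodic Set.univ := by
  intro ε hε
  refine ⟨1, Set.univ, one_pos, fun _ _ => by simp, Eventually.of_forall fun Q => ?_⟩
  simp; positivity

lemma ncard_line_le {α β : ℤ} (h : α ≠ 0 ∨ β ≠ 0) (Q : ℕ) :
    {y : ℤ × ℤ | (|y.1| ≤ Q ∧ |y.2| ≤ Q) ∧ α * y.1 + β * y.2 = 0}.ncard ≤ 2 * Q + 1 := by
  have hc : (Set.Icc (-(Q : ℤ)) Q).ncard = 2 * Q + 1 := by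
    rw [← Finset.coe_Icc, Set.ncard_coe_finset, Int.card_Icc]; omega
  rw [← hc]
  rcases h with h | h
  · refine Set.ncard_le_ncard_of_injOn (fun y => y.2) (fun y hy => ?_) ?_ (Set.finite_Icc _ _)
    · exact abs_le.1 hy.1.2
    · rintro ⟨x, y⟩ ⟨_, h1⟩ ⟨x', y'⟩ ⟨_, h2⟩ (rfl : y = y')
      simp only at h1 h2
      have : α * (x - x') = 0 := by linarith
      rcases mul_eq_zero.1 this with h' | h'
      · exact absurd h' h
      · rw [sub_eq_zero.1 h']
  · refine Set.ncard_le_ncard_of_injOn (fun y => y.1) (fun y hy => ?_) ?_ (Set.finite_Icc _ _)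
    · exact abs_le.1 hy.1.1
    · rintro ⟨x, y⟩ ⟨_, h1⟩ ⟨x', y'⟩ ⟨_, h2⟩ (rfl : x = x')
      simp only at h1 h2
      have : β * (y - y') = 0 := by linarith
      rcases mul_eq_zero.1 this with h' | h'
      · exact absurd h' h
      · rw [sub_eq_zero.1 h']

lemma eventually_linear_le_sq {ε : ℝ} (hε : 0 < ε) (K : ℝ) :
    ∀ᶠ Q : ℕ in atTop, K * ((Q : ℝ) + 1) ≤ ε * (Q : ℝ) ^ 2 := by
  obtain ⟨N, hN⟩ := exists_nat_gt (2 * |K| / ε + 1)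
  filter_upwards [eventually_ge_atTop N] with Q hQ
  have h1 : (N : ℝ) ≤ Q := by exact_mod_cast hQ
  have h2 : 2 * |K| / ε + 1 < Q := by linarith
  have h3 : 0 ≤ 2 * |K| / ε := by positivity
  have h4 : 2 * |K| ≤ ε * Q := by
    have : 2 * |K| / ε ≤ Q := by linarith
    rw [div_le_iff₀ hε] at this
    linarith
  have h5 : K ≤ |K| := le_abs_self _
  have h6 : (1 : ℝ) ≤ Q := by linarith
  nlinarith [abs_nonneg K, mul_le_mul_of_nonneg_right h4 (by linarith : (0 : ℝ) ≤ Q)]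

lemma almostPeriodic_lines {ι : Type*} (α β : ι → ℤ) :
    AlmostPeriodic {y : ℤ × ℤ | ∀ j, α j * y.1 + β j * y.2 = 0} := by
  by_cases h : ∀ j, α j = 0 ∧ β j = 0
  · have : {y : ℤ × ℤ | ∀ j, α j * y.1 + β j * y.2 = 0} = Set.univ := by
      ext y; simp [h]
    rw [this]
    exact almostPeriodic_univ
  · push Not at h
    obtain ⟨j, hj⟩ := h
    have hj' : α j ≠ 0 ∨ β j ≠ 0 := by tauto
    intro ε hε
    refine ⟨1, ∅, one_pos, fun _ _ => by simp, ?_⟩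
    filter_upwards [eventually_linear_le_sq hε 2] with Q hQ
    refine le_trans ?_ hQ
    have h1 := ncard_line_le hj' Q
    have h2 : {z : ℤ × ℤ | (|z.1| ≤ Q ∧ |z.2| ≤ Q) ∧
        ¬(z ∈ {y : ℤ × ℤ | ∀ j, α j * y.1 + β j * y.2 = 0} ↔ z ∈ (∅ : Set (ℤ × ℤ)))}.ncard ≤
        2 * Q + 1 := by
      refine le_trans (Set.ncard_le_ncard ?_ ?_) h1
      · rintro y ⟨hy, hy2⟩
        refine ⟨hy, ?_⟩
        simp only [Set.mem_ofPred_eq, Set.mem_empty_iff_false, iff_false, not_not] at hy2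
        exact hy2 j
      · exact (finite_int_box Q).subset fun y hy => hy.1
    have : ((2 * Q + 1 : ℕ) : ℝ) ≤ 2 * ((Q : ℝ) + 1) := by push_cast; linarith
    exact le_trans (by exact_mod_cast h2) this

lemma ev_mul_dt (z u v w : ℤ × ℤ) : ev v z * dt u w = ev u z * dt v w + ev w z * dt u v := by
  simp only [ev, dt]; ring

lemma dt_self (v : ℤ × ℤ) : dt v v = 0 := by simp only [dt]; ring

lemma dt_swap (v w : ℤ × ℤ) : dt w v = - dt v w := by simp only [dt]; ring

lemma dt_trans {z u v w : ℤ × ℤ} (hu : 0 < ev u z) (hv : 0 < ev v z) (hw : 0 < ev w z)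
    (h1 : 0 < dt u v) (h2 : 0 < dt v w) : 0 < dt u w := by
  have h := ev_mul_dt z u v w
  have : 0 < ev v z * dt u w := by rw [h]; positivity
  exact pos_of_mul_pos_right this hv.le

lemma dt_trans_le {z u v w : ℤ × ℤ} (hu : 0 < ev u z) (hv : 0 < ev v z) (hw : 0 < ev w z)
    (h1 : 0 ≤ dt u v) (h2 : 0 < dt v w) : 0 < dt u w := by
  have h := ev_mul_dt z u v w
  have : 0 < ev v z * dt u w := by rw [h]; positivity
  exact pos_of_mul_pos_right this hv.le

lemma dt_trans_le' {z u v w : ℤ × ℤ} (hu : 0 < ev u z) (hv : 0 < ev v z) (hw : 0 < ev w z)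
    (h1 : 0 < dt u v) (h2 : 0 ≤ dt v w) : 0 < dt u w := by
  have h := ev_mul_dt z u v w
  have : 0 < ev v z * dt u w := by rw [h]; positivity
  exact pos_of_mul_pos_right this hv.le

lemma eq_of_dt_eq_zero {z v w : ℤ × ℤ} (hv : IsCoprime v.1 v.2) (hw : IsCoprime w.1 w.2)
    (hvz : 0 < ev v z) (hwz : 0 < ev w z) (h : dt v w = 0) : v = w := by
  obtain ⟨a, b, hab⟩ := hv
  obtain ⟨a', b', hab'⟩ := hw
  simp only [dt] at h
  -- `w = k v` with `k = a w₁ + b w₂`, and `k` is a unit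
  have e1 : w.1 = (a * w.1 + b * w.2) * v.1 := by linear_combination (-w.1) * hab - b * h
  have e2 : w.2 = (a * w.1 + b * w.2) * v.2 := by linear_combination (-w.2) * hab + a * h
  have e3 : ev w z = (a * w.1 + b * w.2) * ev v z := by
    simp only [ev]; linear_combination z.1 * e1 + z.2 * e2
  have hk : 0 < a * w.1 + b * w.2 := by
    rw [e3] at hwz; exact pos_of_mul_pos_left hwz hvz.le
  have e4 : (a * w.1 + b * w.2) * (a' * v.1 + b' * v.2) = 1 := by
    linear_combination hab' - a' * e1 - b' * e2
  have hk1 : a * w.1 + b * w.2 = 1 := by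
    rcases Int.isUnit_iff.1 (IsUnit.of_mul_eq_one _ e4) with h | h
    · exact h
    · omega
  rw [hk1] at e1 e2
  ext <;> linarith

/-- `W` represents a fraction of denominator `ev W z` at most `Q` and congruent to `c`. -/
def Cls (d c : ℕ) (Q : ℤ) (z W : ℤ × ℤ) : Prop :=
  IsCoprime W.1 W.2 ∧ 0 < ev W z ∧ ev W z ≤ Q ∧ (d : ℤ) ∣ ev W z - c

/-- Consecutive vectors of the class. -/
def Cons (d c : ℕ) {s : ℕ} (Q : ℤ) (z : ℤ × ℤ) (V : Fin (s + 1) → ℤ × ℤ) : Prop :=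
  (∀ i, Cls d c Q z (V i)) ∧ ∀ i : Fin s, 0 < dt (V i.castSucc) (V i.succ) ∧
    ∀ W, Cls d c Q z W → ¬ (0 < dt (V i.castSucc) W ∧ 0 < dt W (V i.succ))

/-- Tuples of denominators of consecutive fractions, in homogeneous coordinates. -/
def Dt (d c s : ℕ) (Q : ℤ) : Set (Fin (s + 1) → ℤ) :=
  {q | ∃ (z : ℤ × ℤ) (V : Fin (s + 1) → ℤ × ℤ), IsCoprime z.1 z.2 ∧ Cons d c Q z V ∧
    ∀ i, q i = ev (V i) z}

section

variable {d c s : ℕ} {Q : ℤ} {z : ℤ × ℤ} {V V' : Fin (s + 1) → ℤ × ℤ}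

lemma Cons.pos (h : Cons d c Q z V) (i) : 0 < ev (V i) z := (h.1 i).2.1

lemma Cons.dt_pos (h : Cons d c Q z V) {i j : Fin (s + 1)} (hij : i < j) : 0 < dt (V i) (V j) := by
  obtain ⟨i, hi⟩ := i
  obtain ⟨j, hj⟩ := j
  simp only [Fin.mk_lt_mk] at hij
  induction j, hij using Nat.le_induction with
  | base => exact (h.2 ⟨i, by omega⟩).1
  | succ j hij ih =>
    exact dt_trans (h.pos _) (h.pos ⟨j, by omega⟩) (h.pos _) (ih (by omega)) (h.2 ⟨j, by omega⟩).1

lemma Cons.succ_eq (h : Cons d c Q z V) (h' : Cons d c Q z V') {i : Fin s}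
    (he : V i.castSucc = V' i.castSucc) : V i.succ = V' i.succ := by
  by_contra hne
  rcases lt_trichotomy (dt (V i.succ) (V' i.succ)) 0 with hlt | heq | hgt
  · rw [dt_swap] at hlt
    exact (h.2 i).2 _ (h'.1 i.succ) ⟨by rw [he]; exact (h'.2 i).1, by linarith⟩
  · exact hne (eq_of_dt_eq_zero (h.1 _).1 (h'.1 _).1 (h.pos _) (h'.pos _) heq)
  · exact (h'.2 i).2 _ (h.1 i.succ) ⟨by rw [← he]; exact (h.2 i).1, hgt⟩

lemma Cons.castSucc_eq (h : Cons d c Q z V) (h' : Cons d c Q z V') {i : Fin s}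
    (he : V i.succ = V' i.succ) : V i.castSucc = V' i.castSucc := by
  by_contra hne
  rcases lt_trichotomy (dt (V i.castSucc) (V' i.castSucc)) 0 with hlt | heq | hgt
  · rw [dt_swap] at hlt
    exact (h'.2 i).2 _ (h.1 i.castSucc) ⟨by linarith, by rw [← he]; exact (h.2 i).1⟩
  · exact hne (eq_of_dt_eq_zero (h.1 _).1 (h'.1 _).1 (h.pos _) (h'.pos _) heq)
  · exact (h.2 i).2 _ (h'.1 i.castSucc) ⟨hgt, by rw [he]; exact (h'.2 i).1⟩

lemma Cons.ext_of_eq (h : Cons d c Q z V) (h' : Cons d c Q z V') {i : Fin (s + 1)}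
    (he : V i = V' i) : V = V' := by
  obtain ⟨i, hi⟩ := i
  have up : ∀ j, i ≤ j → ∀ hj : j < s + 1, V ⟨j, hj⟩ = V' ⟨j, hj⟩ := by
    intro j hij
    induction j, hij using Nat.le_induction with
    | base => intro _; exact he
    | succ j hij ih =>
      intro hj
      exact h.succ_eq h' (i := ⟨j, by omega⟩) (ih (by omega))
  have down : ∀ k, k ≤ i → V ⟨i - k, by omega⟩ = V' ⟨i - k, by omega⟩ := by
    intro k
    induction k with
    | zero => intro _; exact he
    | succ k ih =>
      intro hk
      refine h.castSucc_eq h' (i := ⟨i - (k + 1), by omega⟩) ?_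
      have := ih (by omega)
      have e : i - (k + 1) + 1 = i - k := by omega
      simpa only [Fin.succ_mk, e] using this
  funext ⟨j, hj⟩
  rcases le_total i j with hij | hij
  · exact up j hij hj
  · have := down (i - j) (by omega)
    have e : i - (i - j) = j := by omega
    simpa only [e] using this

lemma Cons.ext_of_straddle (h : Cons d c Q z V) (h' : Cons d c Q z V') {i : Fin s} {w : ℤ × ℤ}
    (hw : 0 < ev w z) (h1 : 0 ≤ dt (V i.castSucc) w) (h2 : 0 < dt w (V i.succ))
    (h1' : 0 ≤ dt (V' i.castSucc) w) (h2' : 0 < dt w (V' i.succ)) : V = V' := by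
  have key : ∀ {U U' : Fin (s + 1) → ℤ × ℤ}, Cons d c Q z U → Cons d c Q z U' →
      0 < dt w (U i.succ) → 0 ≤ dt (U' i.castSucc) w → ¬ 0 < dt (U i.castSucc) (U' i.castSucc) := by
    intro U U' hU hU' a b hlt
    exact (hU.2 i).2 _ (hU'.1 _) ⟨hlt, dt_trans_le (hU'.pos _) hw (hU.pos _) b a⟩
  refine h.ext_of_eq h' (i := i.castSucc) (eq_of_dt_eq_zero (h.1 _).1 (h'.1 _).1 (h.pos _)
    (h'.pos _) (le_antisymm (not_lt.1 (key h h' h2 h1')) ?_))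
  have := key h' h h2' h1
  rw [dt_swap] at this
  linarith

end

/-- A unimodular change of coordinates, with its contragredient action on points. -/
structure IsGauge (g : ℤ × ℤ → ℤ × ℤ) (z z' : ℤ × ℤ) : Prop where
  ev_eq : ∀ W, ev (g W) z' = ev W z
  dt_eq : ∀ V W, dt (g V) (g W) = dt V W
  cop : ∀ W, IsCoprime (g W).1 (g W).2 ↔ IsCoprime W.1 W.2
  surj : Function.Surjective g
  cop_pt : IsCoprime z'.1 z'.2 ↔ IsCoprime z.1 z.2
  add : ∀ V W, g (V + W) = g V + g W
  smul : ∀ (k : ℤ) V, g (k • V) = k • g V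

lemma isCoprime_mul_mat {A B C D x y : ℤ} (h : A * D - B * C = 1) (hxy : IsCoprime x y) :
    IsCoprime (A * x + B * y) (C * x + D * y) := by
  obtain ⟨a, b, hab⟩ := hxy
  exact ⟨a * D - b * C, b * A - a * B, by linear_combination hab + (a * x + b * y) * h⟩

lemma isGauge_mat {A B C D : ℤ} (h : A * D - B * C = 1) (z : ℤ × ℤ) :
    IsGauge (fun W => (A * W.1 + B * W.2, C * W.1 + D * W.2)) z
      (D * z.1 - C * z.2, -B * z.1 + A * z.2) where
  ev_eq W := by simp only [ev]; linear_combination (W.1 * z.1 + W.2 * z.2) * h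
  dt_eq V W := by simp only [dt]; linear_combination (V.1 * W.2 - V.2 * W.1) * h
  cop W := by
    refine ⟨fun hW => ?_, isCoprime_mul_mat h⟩
    have := isCoprime_mul_mat (A := D) (B := -B) (C := -C) (D := A) (by linear_combination h) hW
    convert this using 1
    · linear_combination (-W.1) * h
    · linear_combination (-W.2) * h
  surj W := ⟨(D * W.1 - B * W.2, -C * W.1 + A * W.2), by
    ext
    · linear_combination W.1 * h
    · linear_combination W.2 * h⟩
  cop_pt := by
    refine ⟨fun hz => ?_, fun hz => ?_⟩
    · have := isCoprime_mul_mat (A := A) (B := C) (C := B) (D := D) (by linear_combination h) hz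
      convert this using 1
      · linear_combination (-z.1) * h
      · linear_combination (-z.2) * h
    · have := isCoprime_mul_mat (A := D) (B := -C) (C := -B) (D := A) (by linear_combination h) hz
      convert this using 1
      simp only; ring
  add V W := by ext <;> simp <;> ring
  smul k V := by ext <;> simp <;> ring

lemma IsGauge.comp {g g' : ℤ × ℤ → ℤ × ℤ} {z z' z'' : ℤ × ℤ} (h : IsGauge g z z')
    (h' : IsGauge g' z' z'') : IsGauge (g' ∘ g) z z'' where
  ev_eq W := (h'.ev_eq _).trans (h.ev_eq W)
  dt_eq V W := (h'.dt_eq _ _).trans (h.dt_eq V W)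
  cop W := (h'.cop _).trans (h.cop W)
  surj := h'.surj.comp h.surj
  cop_pt := h'.cop_pt.trans h.cop_pt
  add V W := by simp [h.add, h'.add]
  smul k V := by rw [Function.comp, Function.comp, h.smul, h'.smul]

lemma IsGauge.cls {g : ℤ × ℤ → ℤ × ℤ} {z z' : ℤ × ℤ} (h : IsGauge g z z') {d c : ℕ} {Q : ℤ}
    (W : ℤ × ℤ) : Cls d c Q z' (g W) ↔ Cls d c Q z W := by
  rw [Cls, Cls, h.cop, h.ev_eq]

lemma IsGauge.cons {g : ℤ × ℤ → ℤ × ℤ} {z z' : ℤ × ℤ} (h : IsGauge g z z') {d c s : ℕ} {Q : ℤ}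
    {V : Fin (s + 1) → ℤ × ℤ} (hV : Cons d c Q z V) : Cons d c Q z' (fun i => g (V i)) := by
  refine ⟨fun i => (h.cls _).2 (hV.1 i), fun i => ⟨by rw [h.dt_eq]; exact (hV.2 i).1, ?_⟩⟩
  intro W hW
  obtain ⟨W, rfl⟩ := h.surj W
  rw [h.dt_eq, h.dt_eq]
  exact (hV.2 i).2 W ((h.cls W).1 hW)

/-- Coordinates in which a given primitive vector is `(0, 1)`. -/
lemma exists_gauge_center {w z : ℤ × ℤ} (hw : IsCoprime w.1 w.2) (hn : 0 < ev w z) :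
    ∃ g z', IsGauge g z z' ∧ g w = (0, 1) ∧ 0 ≤ z'.1 ∧ z'.1 < z'.2 ∧ z'.2 = ev w z := by
  obtain ⟨a, b, hab⟩ := hw
  have h1 := isGauge_mat (A := w.2) (B := -w.1) (C := a) (D := b) (by linear_combination hab) z
  set m := b * z.1 - a * z.2 with hm
  set n := ev w z with hndef
  have h2 := isGauge_mat (A := 1) (B := 0) (C := m / n) (D := 1) (by ring)
    (b * z.1 - a * z.2, -(-w.1) * z.1 + w.2 * z.2)
  refine ⟨_, _, h1.comp h2, ?_, ?_, ?_, ?_⟩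
  · simp only [Function.comp]
    ext
    · simp only; ring
    · simp only; linear_combination hab
  · have e : -(-w.1) * z.1 + w.2 * z.2 = n := by simp only [hndef, ev]; ring
    have := Int.emod_nonneg m hn.ne'
    rw [Int.emod_def] at this
    simp only [e, ← hm]; linarith
  · have e : -(-w.1) * z.1 + w.2 * z.2 = n := by simp only [hndef, ev]; ring
    have := Int.emod_lt_of_pos m hn
    rw [Int.emod_def] at this
    simp only [e, ← hm]; linarith
  · simp only [hndef, ev]; ring

/-- Coordinates in which a given primitive point is `(1, 0)`. -/
lemma exists_gauge_point {z : ℤ × ℤ} (hz : IsCoprime z.1 z.2) : ∃ g, IsGauge g z (1, 0) := by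
  obtain ⟨a, b, hab⟩ := hz
  have h1 := isGauge_mat (A := z.1) (B := z.2) (C := -b) (D := a) (by linear_combination hab) z
  have e : ((1 : ℤ), (0 : ℤ)) = (a * z.1 - -b * z.2, -z.2 * z.1 + z.1 * z.2) := by
    ext
    · simp only; linear_combination -hab
    · simp only; ring
  exact ⟨_, e ▸ h1⟩

/-- The vector `(denominator, numerator)` of a rational number. -/
def ratVec (x : ℚ) : ℤ × ℤ := (x.den, x.num)

lemma ev_one_zero (W : ℤ × ℤ) : ev W (1, 0) = W.1 := by simp [ev]

lemma dt_ratVec_pos {x y : ℚ} : 0 < dt (ratVec x) (ratVec y) ↔ x < y := by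
  rw [Rat.lt_iff, dt, ratVec, ratVec]
  simp only
  constructor <;> intro h <;> linarith

lemma exists_ratVec {W : ℤ × ℤ} (h : IsCoprime W.1 W.2) (h0 : 0 < W.1) : ∃ x, ratVec x = W := by
  refine ⟨⟨W.2, W.1.toNat, by omega, ?_⟩, ?_⟩
  · rw [Int.isCoprime_iff_gcd_eq_one, Int.gcd_comm] at h
    have : W.1.toNat = W.1.natAbs := by omega
    rw [this]; exact h
  · ext
    · simp [ratVec]; omega
    · simp [ratVec]

lemma isCoprime_ratVec (x : ℚ) : IsCoprime (ratVec x).1 (ratVec x).2 := by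
  rw [Int.isCoprime_iff_gcd_eq_one, Int.gcd_comm]
  exact x.reduced

lemma dvd_sub_iff_mod {d c n : ℕ} (hc : c < d) : (d : ℤ) ∣ (n : ℤ) - c ↔ n % d = c := by
  rw [← Nat.modEq_iff_dvd, Nat.ModEq, Nat.mod_eq_of_lt hc]
  exact eq_comm

lemma cls_ratVec {d c : ℕ} (hc : c < d) {Q : ℕ} {x : ℚ} :
    Cls d c Q (1, 0) (ratVec x) ↔ x.den ≤ Q ∧ x.den % d = c := by
  rw [Cls, ev_one_zero, ratVec]
  simp only [dvd_sub_iff_mod hc, Nat.cast_le]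
  exact ⟨fun h => h.2.2, fun h => ⟨isCoprime_ratVec x, by exact_mod_cast x.pos, h⟩⟩

lemma dsQ_subset {d c s Q : ℕ} (hc : c < d) {q : Fin (s + 1) → ℕ} (hq : q ∈ DsQ Q c d s) :
    (fun i => (q i : ℤ)) ∈ Dt d c s Q := by
  obtain ⟨f, ⟨hf1, hf2⟩, hq⟩ := hq
  refine ⟨(1, 0), fun i => ratVec (f i), isCoprime_one_left, ⟨fun i => (cls_ratVec hc).2 (hf1 i).2.2,
    fun i => ⟨dt_ratVec_pos.2 (hf2 i).1, ?_⟩⟩, ?_⟩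
  · intro W hW
    obtain ⟨x, rfl⟩ := exists_ratVec hW.1 (by rw [← ev_one_zero]; exact hW.2.1)
    rw [dt_ratVec_pos, dt_ratVec_pos]
    rintro ⟨h1, h2⟩
    exact (hf2 i).2 x ⟨(hf1 i.castSucc).1.trans h1.le, h2.le.trans (hf1 i.succ).2.1,
      (cls_ratVec hc).1 hW⟩ ⟨h1, h2⟩
  · intro i
    rw [ev_one_zero]; simp only [hq]; rfl

/-- Tuples whose fractions jump over `1`. -/
def wrapTuples (d c s Q : ℕ) (i : Fin s) : Set (Fin (s + 1) → ℤ) :=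
  {q | ∃ V : Fin (s + 1) → ℤ × ℤ, Cons d c Q (1, 0) V ∧ 0 ≤ dt (V i.castSucc) (1, 1) ∧
    0 < dt (1, 1) (V i.succ) ∧ ∀ i, q i = ev (V i) (1, 0)}

lemma wrapTuples_subsingleton (d c s Q : ℕ) (i : Fin s) : (wrapTuples d c s Q i).Subsingleton := by
  rintro q ⟨V, hV, h1, h2, hq⟩ q' ⟨V', hV', h1', h2', hq'⟩
  have : V = V' := hV.ext_of_straddle hV' (by simp [ev]) h1 h2 h1' h2'
  subst this
  funext i
  rw [hq, hq']

lemma exists_last_of_not {s : ℕ} {P : Fin (s + 1) → Prop} (h0 : P 0) (hs : ¬ ∀ i, P i) :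
    ∃ i : Fin s, P i.castSucc ∧ ¬ P i.succ := by
  by_contra hcon
  push Not at hcon
  exact hs fun i => Fin.induction h0 hcon i

lemma mem_dsQ_or_wrap {d c s Q : ℕ} (hc : c < d) {q : Fin (s + 1) → ℤ} (hq : q ∈ Dt d c s Q) :
    (∃ q' ∈ DsQ Q c d s, q = fun i => (q' i : ℤ)) ∨ ∃ i, q ∈ wrapTuples d c s Q i := by
  obtain ⟨z, V, hz, hV, hq⟩ := hq
  obtain ⟨g, hg⟩ := exists_gauge_point hz
  set U : Fin (s + 1) → ℤ × ℤ := fun i => g (V i) with hU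
  have hUc := hg.cons hV
  have hU1 : ∀ i, 0 < (U i).1 := fun i => by rw [← ev_one_zero]; exact hUc.pos i
  have h2 := isGauge_mat (A := 1) (B := 0) (C := -((U 0).2 / (U 0).1)) (D := 1) (by ring) (1, 0)
  have e2 : ((1 * 1 - -((U 0).2 / (U 0).1) * 0, -0 * 1 + 1 * 0) : ℤ × ℤ) = (1, 0) := by simp
  simp only [e2] at h2
  have hg' := hg.comp h2
  have hTc := hg'.cons hV
  set T : Fin (s + 1) → ℤ × ℤ := fun i => _ with hT
  have hq' : ∀ i, q i = ev (T i) (1, 0) := fun i => by rw [hq i]; exact (hg'.ev_eq _).symm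
  have hTU : ∀ i, T i = ((U i).1, (U i).2 - (U 0).2 / (U 0).1 * (U i).1) := fun i => by
    simp only [hT, Function.comp, hU]; ext <;> simp; ring
  by_cases hall : ∀ i, 0 ≤ dt (T i) (1, 1)
  · left
    choose f hf using fun i => exists_ratVec (hTc.1 i).1 (by rw [← ev_one_zero]; exact hTc.pos i)
    have hle1 : ∀ i, f i ≤ 1 := by
      intro i
      by_contra hcon
      have h := dt_ratVec_pos.2 (not_le.1 hcon)
      rw [hf] at h
      have e : ratVec 1 = (1, 1) := by simp [ratVec]
      rw [e, dt_swap] at h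
      linarith [hall i]
    have hge0 : ∀ i, 0 ≤ f i := by
      have h0 : 0 ≤ f 0 := by
        have : 0 ≤ (T 0).2 := by
          rw [hTU]
          have := Int.emod_nonneg (U 0).2 (hU1 0).ne'
          rw [Int.emod_def] at this
          simp only; linarith
        rw [← hf, ratVec] at this
        exact Rat.num_nonneg.1 this
      intro i
      rcases (Fin.zero_le i).eq_or_lt with rfl | hlt
      · exact h0
      · refine h0.trans (dt_ratVec_pos.1 ?_).le
        rw [hf, hf]
        exact hTc.dt_pos hlt
    refine ⟨fun i => (f i).den, ⟨f, ⟨fun i => ⟨hge0 i, hle1 i, (cls_ratVec hc).1 ?_⟩, fun i => ⟨?_, ?_⟩⟩,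
      fun i => rfl⟩, ?_⟩
    · rw [hf]; exact hTc.1 i
    · rw [← dt_ratVec_pos, hf, hf]; exact (hTc.2 i).1
    · rintro x ⟨_, _, hx⟩
      rw [← dt_ratVec_pos, ← dt_ratVec_pos, hf, hf]
      exact (hTc.2 i).2 _ ((cls_ratVec hc).2 hx)
    · funext i
      rw [hq' i, ev_one_zero, ← hf i]; rfl
  · right
    obtain ⟨i, h1, h2⟩ := exists_last_of_not (P := fun i => 0 ≤ dt (T i) (1, 1)) (by
      rw [hTU]
      have := Int.emod_lt_of_pos (U 0).2 (hU1 0)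
      rw [Int.emod_def] at this
      simp only [dt]; linarith) hall
    refine ⟨i, T, hTc, h1, ?_, hq'⟩
    rw [dt_swap]; linarith

lemma finite_Dt (d c s : ℕ) (Q : ℕ) : (Dt d c s Q).Finite := by
  apply Set.Finite.subset (Set.finite_Icc (0 : Fin (s + 1) → ℤ) (fun _ => (Q : ℤ)))
  rintro q ⟨z, V, _, hV, hq⟩
  exact ⟨fun i => by rw [hq]; exact (hV.pos i).le, fun i => by rw [hq]; exact (hV.1 i).2.2.1⟩

/-- Counting tuples of denominators in terms of homogeneous tuples, up to a bounded error. -/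
lemma card_dsQ_near {d c s Q : ℕ} (hc : c < d) (p : (Fin (s + 1) → ℤ) → Prop) :
    |(Nat.card {q ∈ DsQ Q c d s | p fun i => (q i : ℤ)} : ℝ) -
      Set.ncard {q ∈ Dt d c s Q | p q}| ≤ s := by
  classical
  set S : Set (Fin (s + 1) → ℤ) := (fun (q : Fin (s + 1) → ℕ) (i : Fin (s + 1)) => (q i : ℤ)) ''
    {q ∈ DsQ Q c d s | p fun i => (q i : ℤ)} with hS
  have hinj : Function.Injective fun (q : Fin (s + 1) → ℕ) (i : Fin (s + 1)) => (q i : ℤ) := by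
    intro q q' h
    funext i
    have := congrFun h i
    simp only [Nat.cast_inj] at this
    exact this
  have hcardS : S.ncard = Nat.card {q ∈ DsQ Q c d s | p fun i => (q i : ℤ)} := by
    rw [hS, Set.ncard_image_of_injective _ hinj, Nat.card_coe_set_eq]
  have hsub : S ⊆ {q ∈ Dt d c s Q | p q} := by
    rintro _ ⟨q, ⟨hq, hp⟩, rfl⟩
    exact ⟨dsQ_subset hc hq, hp⟩
  have hfin : {q ∈ Dt d c s Q | p q}.Finite := (finite_Dt d c s Q).subset fun q hq => hq.1
  have hsub2 : {q ∈ Dt d c s Q | p q} ⊆ S ∪ ⋃ i ∈ (Finset.univ : Finset (Fin s)),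
      wrapTuples d c s Q i := by
    rintro q ⟨hq, hp⟩
    rcases mem_dsQ_or_wrap hc hq with ⟨q', hq', rfl⟩ | ⟨i, hi⟩
    · exact Or.inl ⟨q', ⟨hq', hp⟩, rfl⟩
    · exact Or.inr (by simpa using ⟨i, hi⟩)
  have hw : (⋃ i ∈ (Finset.univ : Finset (Fin s)), wrapTuples d c s Q i).Finite :=
    Set.Finite.biUnion (Finset.finite_toSet _) fun i _ => (wrapTuples_subsingleton d c s Q i).finite
  have hwc : (⋃ i ∈ (Finset.univ : Finset (Fin s)), wrapTuples d c s Q i).ncard ≤ s := by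
    refine (Finset.set_ncard_biUnion_le _ _).trans ?_
    have hsf := fun i => (wrapTuples_subsingleton d c s Q i).finite.to_subtype
    calc _ ≤ ∑ _i : Fin s, 1 := Finset.sum_le_sum fun i _ =>
          Set.ncard_le_one_iff_subsingleton.2 (wrapTuples_subsingleton d c s Q i)
      _ = s := by simp
  have h1 := Set.ncard_le_ncard hsub hfin
  have h2 := (Set.ncard_le_ncard hsub2 ((hfin.subset hsub).union hw)).trans (Set.ncard_union_le _ _)
  rw [hcardS] at h1 h2
  rw [abs_le]
  have h1' : (Nat.card {q ∈ DsQ Q c d s | p fun i => (q i : ℤ)} : ℝ) ≤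
    Set.ncard {q ∈ Dt d c s Q | p q} := by exact_mod_cast h1
  have h2' : (Set.ncard {q ∈ Dt d c s Q | p q} : ℝ) ≤
    Nat.card {q ∈ DsQ Q c d s | p fun i => (q i : ℤ)} + s := by exact_mod_cast h2.trans (by omega)
  constructor <;> linarith

lemma exists_class_vector {d : ℕ} (hd : 2 ≤ d) (c : ℕ) {z : ℤ × ℤ} (hz : IsCoprime z.1 z.2) :
    ∃ W : ℤ × ℤ, IsCoprime W.1 W.2 ∧ 1 ≤ W.1 ∧ (d : ℤ) ∣ ev W z - c := by
  obtain ⟨u, v, huv⟩ := hz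
  have hd' : (2 : ℤ) ≤ d := by exact_mod_cast hd
  set x := c * u + z.2 with hx
  set y := c * v - z.1 with hy
  have hcop : IsCoprime x y := ⟨v, -u, by rw [hx, hy]; linear_combination huv⟩
  have hval : x * z.1 + y * z.2 = c := by rw [hx, hy]; linear_combination c * huv
  have shear : ∀ (x y : ℤ), IsCoprime x y → (d : ℤ) ∣ (x * z.1 + y * z.2) - c → y ≠ 0 →
      ∃ W : ℤ × ℤ, IsCoprime W.1 W.2 ∧ 1 ≤ W.1 ∧ (d : ℤ) ∣ ev W z - c := by
    intro x y h1 h2 hy0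
    refine ⟨(x + y * (d * ((1 - x) ^ 2 * y)), y), (IsCoprime.add_mul_left_left h1 _), ?_, ?_⟩
    · have : 1 ≤ y ^ 2 := by have := sq_nonneg y; have : y ^ 2 ≠ 0 := pow_ne_zero _ hy0; omega
      have h3 : (1 - x) ≤ (1 - x) ^ 2 := Int.le_self_sq _
      have h4 : (1 - x) ^ 2 * 1 ≤ (1 - x) ^ 2 * (d * y ^ 2) := by
        gcongr
        nlinarith
      simp only
      nlinarith
    · have e : ev (x + y * (d * ((1 - x) ^ 2 * y)), y) z - c =
          (x * z.1 + y * z.2 - c) + d * (y * ((1 - x) ^ 2 * y) * z.1) := by simp only [ev]; ring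
      rw [e]
      exact dvd_add h2 (dvd_mul_right _ _)
  by_cases hy0 : y = 0
  · have hcop' : IsCoprime x (y + x * d) := IsCoprime.add_mul_left_right hcop _
    refine shear x (y + x * d) hcop' ?_ ?_
    · have e : x * z.1 + (y + x * d) * z.2 - c = (x * z.1 + y * z.2 - c) + d * (x * z.2) := by ring
      rw [e, hval]; simp
    · rw [hy0] at hcop ⊢
      rw [isCoprime_zero_right, Int.isUnit_iff] at hcop
      rcases hcop with h | h <;> rw [h] <;> omega
  · exact shear x y hcop (by rw [hval]; simp) hy0

/-- In every coordinate system there is a class vector with small positive first coordinate. -/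
lemma exists_class_bound {d : ℕ} (hd : 2 ≤ d) (c : ℕ) : ∃ A : ℤ, 0 < A ∧
    ∀ z : ℤ × ℤ, IsCoprime z.1 z.2 → ∃ W : ℤ × ℤ, IsCoprime W.1 W.2 ∧ 1 ≤ W.1 ∧ W.1 ≤ A ∧
      (d : ℤ) ∣ ev W z - c := by
  have : NeZero d := ⟨by omega⟩
  have h : ∀ ρ : ZMod d × ZMod d, ∃ a : ℤ, 0 < a ∧ ∀ z ∈ primClass d ρ, ∃ W : ℤ × ℤ,
      IsCoprime W.1 W.2 ∧ 1 ≤ W.1 ∧ W.1 ≤ a ∧ (d : ℤ) ∣ ev W z - c := by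
    intro ρ
    by_cases hne : ∃ z, z ∈ primClass d ρ
    · obtain ⟨z, hz⟩ := hne
      obtain ⟨W, h1, h2, h3⟩ := exists_class_vector hd c hz.1
      refine ⟨W.1, by omega, fun z' hz' => ⟨W, h1, h2, le_rfl, ?_⟩⟩
      rw [← ZMod.intCast_zmod_eq_zero_iff_dvd] at h3 ⊢
      simp only [ev] at h3 ⊢
      push_cast at h3 ⊢
      rw [hz'.2.1, hz'.2.2, ← hz.2.1, ← hz.2.2, h3]
    · exact ⟨1, one_pos, fun z hz => absurd ⟨z, hz⟩ hne⟩
  choose a ha h using h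
  refine ⟨∑ ρ, a ρ, Finset.sum_pos (fun ρ _ => ha ρ) Finset.univ_nonempty, fun z hz => ?_⟩
  obtain ⟨W, h1, h2, h3, h4⟩ := h (z.1, z.2) z ⟨hz, rfl, rfl⟩
  exact ⟨W, h1, h2, h3.trans (Finset.single_le_sum (fun ρ _ => (ha ρ).le) (Finset.mem_univ _)), h4⟩

lemma basis_expand {w0 w1 : ℤ × ℤ} (h : dt w0 w1 = 1) (V : ℤ × ℤ) :
    V = dt V w1 • w0 + dt w0 V • w1 := by
  simp only [dt] at h ⊢
  ext
  · simp; linear_combination (-V.1) * h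
  · simp; linear_combination (-V.2) * h

lemma dt_basis {w0 w1 : ℤ × ℤ} (h : dt w0 w1 = 1) (V V' : ℤ × ℤ) :
    dt V V' = dt V w1 * dt w0 V' - dt V' w1 * dt w0 V := by
  simp only [dt] at h ⊢
  linear_combination (-(V.1 * V'.2 - V.2 * V'.1)) * h

lemma dt_le_of_neighbour {d c : ℕ} {Q : ℤ} {z V V' w0 w1 : ℤ × ℤ} {K : ℤ} (hd : 2 ≤ d) (hK : 0 < K)
    (hV : Cls d c Q z V) (hV' : Cls d c Q z V') (hlt : 0 < dt V V')
    (hno : ∀ W, Cls d c Q z W → ¬ (0 < dt V W ∧ 0 < dt W V'))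
    (hw : dt w0 w1 = 1) (h0 : 0 < ev w0 z) (h1 : 0 < ev w1 z) (hl : 0 ≤ dt w0 V)
    (hr : 0 ≤ dt V' w1) (hbig : Q < 2 * K * ev w1 z) : dt V V' ≤ 4 * d * K ^ 2 := by
  set α := dt V w1 with hα
  set β := dt w0 V with hβ
  set α' := dt V' w1 with hα'
  set β' := dt w0 V' with hβ'
  have hd' : (2 : ℤ) ≤ d := by exact_mod_cast hd
  have hαpos : 0 < α := dt_trans_le' hV.2.1 hV'.2.1 h1 hlt hr
  have hβ'pos : 0 < β' := dt_trans_le h0 hV.2.1 hV'.2.1 hl hlt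
  have hevV : ev V z = α * ev w0 z + β * ev w1 z := by
    conv_lhs => rw [basis_expand hw V]
    simp [ev]; ring
  have hevV' : ev V' z = α' * ev w0 z + β' * ev w1 z := by
    conv_lhs => rw [basis_expand hw V']
    simp [ev]; ring
  have hdet : dt V V' = α * β' - α' * β := dt_basis hw V V'
  have hβK : β < 2 * K := by
    by_contra hcon
    have h2 : 2 * K * ev w1 z ≤ β * ev w1 z := by gcongr; linarith
    have h3 : 0 < α * ev w0 z := by positivity
    linarith [hV.2.2.1]
  have hβ'K : β' < 2 * K := by
    by_contra hcon
    have h2 : 2 * K * ev w1 z ≤ β' * ev w1 z := by gcongr; linarith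
    have h3 : 0 ≤ α' * ev w0 z := by positivity
    linarith [hV'.2.2.1]
  have hββ : β * β' ≤ 4 * K ^ 2 := by nlinarith
  have hdββ : d * (β * β') ≤ d * (4 * K ^ 2) := by gcongr
  have hα'β : 0 ≤ α' * β := by positivity
  rcases le_or_gt α (d * β) with hle | hgt
  · have : α * β' ≤ d * β * β' := by gcongr
    rw [hdet]; linarith
  · rcases hl.eq_or_lt with hz | hpos
    · have hz' : β = 0 := hz.symm
      have hVw : V = α • w0 := by
        have := basis_expand hw V
        rw [← hα, ← hβ, hz', zero_smul, add_zero] at this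
        exact this
      have hα1 : α = 1 := by
        have hc := hV.1
        rw [hVw] at hc
        simp only [Prod.smul_fst, Prod.smul_snd, smul_eq_mul] at hc
        have := hc.isUnit_of_dvd' (dvd_mul_right ..) (dvd_mul_right ..)
        rcases Int.isUnit_iff.1 this with h | h
        · exact h
        · omega
      rw [hdet, hα1, hz']
      nlinarith
    · set W : ℤ × ℤ := V - (d * β) • w0 with hW
      have hWev : ev W z = ev V z - d * (β * ev w0 z) := by simp [hW, ev]; ring
      have hWdt : dt V W = d * β ^ 2 := by simp [hW, dt, hβ]; ring
      have hWcls : Cls d c Q z W := by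
        refine ⟨?_, ?_, ?_, ?_⟩
        · obtain ⟨a, b, hab⟩ := hV.1
          have e1 : V.1 = W.1 + d * β * w0.1 := by simp [hW]
          have e2 : V.2 = W.2 + d * β * w0.2 := by simp [hW]
          have e3 : dt w0 W = β := by simp [hW, dt, hβ]; ring
          refine ⟨a - (a * w0.1 + b * w0.2) * d * w0.2, b + (a * w0.1 + b * w0.2) * d * w0.1, ?_⟩
          simp only [dt] at e3
          linear_combination hab - a * e1 - b * e2 + (a * w0.1 + b * w0.2) * d * e3
        · rw [hWev, hevV]
          have : 0 < (α - d * β) * ev w0 z + β * ev w1 z := by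
            have : 0 < α - d * β := by linarith
            positivity
          linarith
        · rw [hWev]
          have : 0 ≤ d * (β * ev w0 z) := by positivity
          linarith [hV.2.2.1]
        · rw [hWev]
          have e : ev V z - d * (β * ev w0 z) - c = (ev V z - c) - d * (β * ev w0 z) := by ring
          rw [e]
          exact dvd_sub hV.2.2.2 (dvd_mul_right _ _)
      have hVW : 0 < dt V W := by rw [hWdt]; positivity
      have h4 := hno W hWcls
      have h5 : dt W V' ≤ 0 := by
        by_contra hcon
        exact h4 ⟨hVW, not_le.1 hcon⟩
      have h6 : dt W V' = dt V V' - d * (β * β') := by simp [hW, dt, hβ, hβ']; ring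
      linarith

/-- Reflection of vectors. -/
def refl2 (w : ℤ × ℤ) : ℤ × ℤ := (w.1, -w.2)

lemma ev_refl2 (W z : ℤ × ℤ) : ev (refl2 W) (refl2 z) = ev W z := by simp [ev, refl2]

lemma dt_refl2 (V W : ℤ × ℤ) : dt (refl2 V) (refl2 W) = dt W V := by simp only [dt, refl2]; ring

lemma refl2_refl2 (W : ℤ × ℤ) : refl2 (refl2 W) = W := by simp [refl2]

lemma isCoprime_refl2 (W : ℤ × ℤ) : IsCoprime (refl2 W).1 (refl2 W).2 ↔ IsCoprime W.1 W.2 := by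
  simp [refl2, IsCoprime.neg_right_iff]

lemma cls_refl2 {d c : ℕ} {Q : ℤ} {z W : ℤ × ℤ} :
    Cls d c Q (refl2 z) (refl2 W) ↔ Cls d c Q z W := by
  rw [Cls, Cls, isCoprime_refl2, ev_refl2]

/-- Unimodular pairs enclosing an interval free of vectors of small value. -/
lemma exists_enclosing_pair {z V V' : ℤ × ℤ} {K Q : ℤ} (hK : 0 < K) (hQ : K ≤ Q)
    (hz : IsCoprime z.1 z.2) (hV : 0 < ev V z)
    (hno : ∀ w : ℤ × ℤ, IsCoprime w.1 w.2 → 0 < ev w z → K * ev w z ≤ Q →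
      ¬ (0 < dt V w ∧ 0 < dt w V')) :
    ∃ w0 w1, dt w0 w1 = 1 ∧ 0 < ev w0 z ∧ 0 < ev w1 z ∧ 0 ≤ dt w0 V ∧ 0 ≤ dt V' w1 ∧
      Q < K * (ev w0 z + ev w1 z) := by
  let P : ℤ → Prop := fun n => ∃ w0 w1, dt w0 w1 = 1 ∧ 0 < ev w0 z ∧ 0 < ev w1 z ∧ 0 ≤ dt w0 V ∧
    0 ≤ dt V' w1 ∧ K * ev w0 z ≤ Q ∧ K * ev w1 z ≤ Q ∧ n = ev w0 z + ev w1 z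
  have hcopt : ∀ {a b : ℤ × ℤ}, dt a b = 1 → IsCoprime a.1 a.2 := fun {a b} h =>
    ⟨b.2, -b.1, by simp only [dt] at h; linarith⟩
  have hcopt' : ∀ {a b : ℤ × ℤ}, dt a b = 1 → IsCoprime b.1 b.2 := fun {a b} h =>
    ⟨-a.2, a.1, by simp only [dt] at h; linarith⟩
  have hex : ∃ n, P n := by
    obtain ⟨a, b, hab⟩ := hz
    -- `e1 = (a, b)` has value one and `e2 = (-z₂, z₁)` has value zero
    set m := (a * V.2 - b * V.1) / ev V z with hm
    have hm0 := Int.emod_nonneg (a * V.2 - b * V.1) hV.ne'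
    have hm1 := Int.emod_lt_of_pos (a * V.2 - b * V.1) hV
    rw [Int.emod_def, ← hm] at hm0 hm1
    set w : ℤ → ℤ × ℤ := fun k => (a - k * z.2, b + k * z.1) with hw
    have hwev : ∀ k, ev (w k) z = 1 := fun k => by simp only [hw, ev]; linear_combination hab
    have hwd : ∀ k, dt (w k) (w (k + 1)) = 1 := fun k => by
      simp only [hw, dt]; linear_combination hab
    have hwV : ∀ k, dt (w k) V = a * V.2 - b * V.1 - k * ev V z := fun k => by
      simp only [hw, dt, ev]; ring
    refine ⟨_, w m, w (m + 1), hwd m, by rw [hwev]; norm_num, by rw [hwev]; norm_num, ?_, ?_,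
      by rw [hwev]; linarith, by rw [hwev]; linarith, rfl⟩
    · rw [hwV]; linarith
    · by_contra hcon
      refine hno (w (m + 1)) (hcopt (hwd _)) (by rw [hwev]; norm_num) (by rw [hwev]; linarith)
        ⟨?_, ?_⟩
      · rw [dt_swap, hwV]; linarith
      · rw [dt_swap]; linarith
  obtain ⟨n, ⟨w0, w1, h1, h2, h3, h4, h5, h6, h7, hn⟩, hmax⟩ :=
    Int.exists_greatest_of_bdd (P := P) ⟨2 * Q, by
      rintro n ⟨w0, w1, h1, h2, h3, h4, h5, h6, h7, rfl⟩
      nlinarith⟩ hex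
  refine ⟨w0, w1, h1, h2, h3, h4, h5, ?_⟩
  by_contra hcon
  have hmed : ev (w0 + w1) z = ev w0 z + ev w1 z := by simp [ev]; ring
  have hd0 : dt w0 (w0 + w1) = 1 := by rw [← h1]; simp [dt]; ring
  have hd1 : dt (w0 + w1) w1 = 1 := by rw [← h1]; simp [dt]; ring
  have hpos : 0 < ev (w0 + w1) z := by rw [hmed]; linarith
  have hle : K * ev (w0 + w1) z ≤ Q := by rw [hmed]; linarith
  have hnb := hno _ (hcopt hd1) hpos hle
  by_cases ha : 0 < dt V (w0 + w1)
  · have hb : 0 ≤ dt V' (w0 + w1) := by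
      by_contra hb
      refine hnb ⟨ha, ?_⟩
      rw [dt_swap]; linarith
    have := hmax _ ⟨w0, w0 + w1, hd0, h2, hpos, h4, hb, h6, hle, rfl⟩
    linarith
  · have := hmax _ ⟨w0 + w1, w1, hd1, hpos, h3, by rw [dt_swap]; linarith, h5, hle, h7, rfl⟩
    linarith

lemma dt_le_of_no_small {d c : ℕ} {Q : ℤ} {z V V' : ℤ × ℤ} {K : ℤ} (hd : 2 ≤ d) (hK : 0 < K)
    (hQ : K ≤ Q) (hz : IsCoprime z.1 z.2)
    (hV : Cls d c Q z V) (hV' : Cls d c Q z V') (hlt : 0 < dt V V')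
    (hno : ∀ W, Cls d c Q z W → ¬ (0 < dt V W ∧ 0 < dt W V'))
    (hsmall : ∀ w : ℤ × ℤ, IsCoprime w.1 w.2 → 0 < ev w z → K * ev w z ≤ Q →
      ¬ (0 < dt V w ∧ 0 < dt w V')) : dt V V' ≤ 4 * d * K ^ 2 := by
  obtain ⟨w0, w1, h1, h2, h3, h4, h5, h6⟩ :=
    exists_enclosing_pair hK hQ hz hV.2.1 hsmall
  rcases le_total (ev w0 z) (ev w1 z) with hle | hle
  · exact dt_le_of_neighbour hd hK hV hV' hlt hno h1 h2 h3 h4 h5 (by nlinarith)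
  · have := dt_le_of_neighbour (z := refl2 z) (V := refl2 V') (V' := refl2 V) (w0 := refl2 w1)
      (w1 := refl2 w0) hd hK (cls_refl2.2 hV') (cls_refl2.2 hV) (by rwa [dt_refl2]) (by
        intro W hW
        rw [← refl2_refl2 W] at hW ⊢
        rw [dt_refl2, dt_refl2]
        intro h
        exact hno _ (cls_refl2.1 hW) ⟨h.2, h.1⟩) (by rwa [dt_refl2]) (by rwa [ev_refl2])
      (by rwa [ev_refl2]) (by rwa [dt_refl2]) (by rwa [dt_refl2]) (by rw [ev_refl2]; nlinarith)
    rwa [dt_refl2] at this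

/-- A vector of value at most `Q / K` lying strictly inside a tuple. -/
def Straddle {s : ℕ} (K Q : ℤ) (z : ℤ × ℤ) (V : Fin (s + 1) → ℤ × ℤ) (w : ℤ × ℤ) : Prop :=
  IsCoprime w.1 w.2 ∧ 0 < ev w z ∧ K * ev w z ≤ Q ∧ 0 < dt (V 0) w ∧ 0 < dt w (V (Fin.last s))

lemma dt_bounded_of_not_straddle {d : ℕ} (hd : 2 ≤ d) (c s : ℕ) {K : ℤ} (hK : 0 < K) :
    ∃ B : ℤ, ∀ (Q : ℤ) (z : ℤ × ℤ) (V : Fin (s + 1) → ℤ × ℤ), K ≤ Q → IsCoprime z.1 z.2 →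
      Cons d c Q z V → (∀ w, ¬ Straddle K Q z V w) → ∀ i j, |dt (V i) (V j)| ≤ B := by
  have key : ∀ k : ℕ, ∃ B : ℤ, 0 ≤ B ∧ ∀ (Q : ℤ) (z : ℤ × ℤ) (V : Fin (s + 1) → ℤ × ℤ), K ≤ Q →
      IsCoprime z.1 z.2 → Cons d c Q z V → (∀ w, ¬ Straddle K Q z V w) →
      ∀ i j : Fin (s + 1), i < j → j.1 ≤ i.1 + k → dt (V i) (V j) ≤ B := by
    have mono0 : ∀ {Q : ℤ} {z : ℤ × ℤ} {V : Fin (s + 1) → ℤ × ℤ}, Cons d c Q z V →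
        ∀ {i : Fin (s + 1)} {w : ℤ × ℤ}, 0 < ev w z → 0 < dt (V i) w → 0 < dt (V 0) w := by
      intro Q z V hV i w hw h
      rcases (Fin.zero_le i).eq_or_lt with rfl | hlt
      · exact h
      · exact dt_trans (hV.pos _) (hV.pos _) hw (hV.dt_pos hlt) h
    have monos : ∀ {Q : ℤ} {z : ℤ × ℤ} {V : Fin (s + 1) → ℤ × ℤ}, Cons d c Q z V →
        ∀ {i : Fin (s + 1)} {w : ℤ × ℤ}, 0 < ev w z → 0 < dt w (V i) → 0 < dt w (V (Fin.last s)) := by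
      intro Q z V hV i w hw h
      rcases (Fin.le_last i).eq_or_lt with rfl | hlt
      · exact h
      · exact dt_trans hw (hV.pos _) (hV.pos _) h (hV.dt_pos hlt)
    have hone : ∀ (Q : ℤ) (z : ℤ × ℤ) (V : Fin (s + 1) → ℤ × ℤ), K ≤ Q →
      IsCoprime z.1 z.2 → Cons d c Q z V → (∀ w, ¬ Straddle K Q z V w) →
      ∀ i : Fin s, dt (V i.castSucc) (V i.succ) ≤ 4 * d * K ^ 2 := by
      intro Q z V hQ hz hV hst i
      refine dt_le_of_no_small hd hK hQ hz (hV.1 _) (hV.1 _) (hV.2 i).1 (hV.2 i).2 ?_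
      intro w h1 h2 h3 h4
      exact hst w ⟨h1, h2, h3, mono0 hV h2 h4.1, monos hV h2 h4.2⟩
    intro k
    induction k with
    | zero => exact ⟨0, le_rfl, fun _ _ _ _ _ _ _ i j h1 h2 => absurd h1 (by omega)⟩
    | succ k ih =>
      obtain ⟨B, hB0, hB⟩ := ih
      have hB1 : (0 : ℤ) ≤ 4 * d * K ^ 2 := by positivity
      refine ⟨K * (B + 4 * d * K ^ 2), by positivity, fun Q z V hQ hz hV hst i j hij hj => ?_⟩
      have hB2 : B + 4 * d * K ^ 2 ≤ K * (B + 4 * d * K ^ 2) :=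
        le_mul_of_one_le_left (by positivity) hK
      obtain ⟨j', rfl⟩ : ∃ j' : Fin s, j = j'.succ := Fin.exists_succ_eq.2 (by
        rintro rfl; simp at hij) |>.imp fun _ h => h.symm
      have h1 := hone Q z V hQ hz hV hst j'
      rcases (show i ≤ j'.castSucc from by
        simp only [Fin.le_def, Fin.lt_def, Fin.val_succ, Fin.val_castSucc] at *; omega).eq_or_lt with rfl | hlt
      · linarith
      · have h2 := hB Q z V hQ hz hV hst i j'.castSucc hlt (by
          simp only [Fin.val_succ, Fin.val_castSucc] at *; omega)
        have h3 : Q < K * ev (V j'.castSucc) z := by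
          by_contra hcon
          exact hst (V j'.castSucc) ⟨(hV.1 _).1, hV.pos _, not_lt.1 hcon,
            mono0 hV (hV.pos _) (hV.dt_pos hlt), monos hV (hV.pos _) (hV.2 j').1⟩
        have h4 := ev_mul_dt z (V i) (V j'.castSucc) (V j'.succ)
        have h5 := (hV.1 i).2.2.1
        have h6 := (hV.1 j'.succ).2.2.1
        have h7 := hV.pos i
        have h8 := hV.pos j'.succ
        have hQ0 : 0 ≤ Q := by linarith
        have h9 : ev (V i) z * dt (V j'.castSucc) (V j'.succ) ≤ Q * (4 * d * K ^ 2) := by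
          have := (hV.2 j').1
          gcongr
        have h10 : ev (V j'.succ) z * dt (V i) (V j'.castSucc) ≤ Q * B := by
          have := hV.dt_pos hlt
          gcongr
        have hX := hV.dt_pos hij
        by_contra hcon
        have h11 : K * (B + 4 * d * K ^ 2) < dt (V i) (V j'.succ) := not_le.1 hcon
        have h12 : ev (V j'.castSucc) z * (K * (B + 4 * d * K ^ 2)) <
          ev (V j'.castSucc) z * dt (V i) (V j'.succ) := by
            have := hV.pos j'.castSucc
            gcongr
        have h13 : Q * (B + 4 * d * K ^ 2) ≤ K * ev (V j'.castSucc) z * (B + 4 * d * K ^ 2) := by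
          gcongr
        nlinarith
  obtain ⟨B, hB0, hB⟩ := key s
  refine ⟨B, fun Q z V hQ hz hV hst i j => ?_⟩
  rcases lt_trichotomy i j with h | rfl | h
  · rw [abs_of_pos (hV.dt_pos h)]
    exact hB Q z V hQ hz hV hst i j h (by omega)
  · rw [dt_self, abs_zero]; exact hB0
  · rw [dt_swap, abs_neg, abs_of_pos (hV.dt_pos h)]
    exact hB Q z V hQ hz hV hst j i h (by omega)

/-- Tuples with all determinants bounded by `B`. -/
def DtBdd (d c s : ℕ) (B Q : ℤ) : Set (Fin (s + 1) → ℤ) :=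
  {q | ∃ (z : ℤ × ℤ) (V : Fin (s + 1) → ℤ × ℤ), IsCoprime z.1 z.2 ∧ Cons d c Q z V ∧
    (∀ i, q i = ev (V i) z) ∧ ∀ i j, |dt (V i) (V j)| ≤ B}

/-- Tuples around a vector of value at most `Q / K`. -/
def DtCusp (d c s : ℕ) (K Q : ℤ) : Set (Fin (s + 1) → ℤ) :=
  {q | ∃ (z : ℤ × ℤ) (V : Fin (s + 1) → ℤ × ℤ), IsCoprime z.1 z.2 ∧ Cons d c Q z V ∧
    (∀ i, q i = ev (V i) z) ∧ ∃ w, Straddle K Q z V w}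

lemma dtBdd_subset (d c s : ℕ) (B Q : ℤ) : DtBdd d c s B Q ⊆ Dt d c s Q :=
  fun _ ⟨z, V, hz, hV, hq, _⟩ => ⟨z, V, hz, hV, hq⟩

lemma dtCusp_subset (d c s : ℕ) (K Q : ℤ) : DtCusp d c s K Q ⊆ Dt d c s Q :=
  fun _ ⟨z, V, hz, hV, hq, _⟩ => ⟨z, V, hz, hV, hq⟩

lemma exists_dt_subset {d : ℕ} (hd : 2 ≤ d) (c s : ℕ) {K : ℤ} (hK : 0 < K) :
    ∃ B : ℤ, ∀ Q, K ≤ Q → Dt d c s Q ⊆ DtBdd d c s B Q ∪ DtCusp d c s K Q := by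
  obtain ⟨B, hB⟩ := dt_bounded_of_not_straddle hd c s hK
  refine ⟨B, fun Q hQ q ⟨z, V, hz, hV, hq⟩ => ?_⟩
  by_cases h : ∃ w, Straddle K Q z V w
  · exact Or.inr ⟨z, V, hz, hV, hq, h⟩
  · exact Or.inl ⟨z, V, hz, hV, hq, hB Q z V hQ hz hV (not_exists.1 h)⟩

lemma exists_straddle_index {s : ℕ} {w : ℤ × ℤ} {V : Fin (s + 1) → ℤ × ℤ}
    (h0 : 0 ≤ dt (V 0) w) (h1 : 0 < dt w (V (Fin.last s))) :
    ∃ i : Fin s, 0 ≤ dt (V i.castSucc) w ∧ 0 < dt w (V i.succ) := by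
  obtain ⟨i, hi, hi'⟩ := exists_last_of_not (P := fun i => 0 ≤ dt (V i) w) h0 (by
    intro h
    have := h (Fin.last s)
    rw [dt_swap] at this; linarith)
  exact ⟨i, hi, by rw [dt_swap]; linarith⟩

lemma ncard_dtCusp_le (d c : ℕ) {s : ℕ} (hs : 1 ≤ s) (K : ℕ) (hK : 0 < K) (Q : ℕ) :
    ((DtCusp d c s K Q).ncard : ℝ) ≤ s * ((Q : ℝ) / K) ^ 2 := by
  classical
  have : NeZero s := ⟨by omega⟩
  set N := Q / K with hN
  have key : ∀ q ∈ DtCusp d c s K Q, ∃ p : Fin s × ℕ × ℕ, ∃ (z : ℤ × ℤ)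
      (V : Fin (s + 1) → ℤ × ℤ), Cons d c Q z V ∧ (∀ i, q i = ev (V i) z) ∧
      0 ≤ dt (V p.1.castSucc) (0, 1) ∧ 0 < dt (0, 1) (V p.1.succ) ∧ z = ((p.2.1 : ℤ), (p.2.2 : ℤ)) ∧
      p.2.1 < N ∧ p.2.2 - 1 < N ∧ 0 < p.2.2 := by
    rintro q ⟨z, V, hz, hV, hq, w, hw1, hw2, hw3, hw4, hw5⟩
    obtain ⟨g, z', hg, hgw, h1, h2, h3⟩ := exists_gauge_center hw1 hw2
    obtain ⟨i, hi1, hi2⟩ := exists_straddle_index hw4.le hw5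
    have hle : z'.2.toNat ≤ N := by
      rw [hN, Nat.le_div_iff_mul_le hK]
      zify
      rw [Int.toNat_of_nonneg (by linarith), h3]
      linarith
    refine ⟨(i, z'.1.toNat, z'.2.toNat), z', fun i => g (V i), hg.cons hV,
      fun i => by rw [hg.ev_eq]; exact hq i, ?_, ?_, ?_, ?_, ?_, ?_⟩
    · rw [← hgw, hg.dt_eq]; exact hi1
    · rw [← hgw, hg.dt_eq]; exact hi2
    · ext
      · simp only; omega
      · simp only; omega
    · simp only; omega
    · simp only; omega
    · simp only; omega
  choose! p hp using key
  have h1 : (DtCusp d c s K Q).ncard ≤ ((Finset.univ : Finset (Fin s)) ×ˢ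
      (Finset.range N ×ˢ Finset.Ioc 0 N) : Finset (Fin s × ℕ × ℕ)).card := by
    rw [← Set.ncard_coe_finset]
    refine Set.ncard_le_ncard_of_injOn p (fun q hq => ?_) ?_ (Finset.finite_toSet _)
    · obtain ⟨z, V, hV, hqV, ha, hb, hz, e1, e2, e3⟩ := hp q hq
      simp only [Finset.coe_product, Set.mem_prod, Finset.mem_coe, Finset.mem_univ, true_and,
        Finset.mem_range, Finset.mem_Ioc]
      omega
    · intro q hq q' hq' he
      obtain ⟨z, V, hV, hqV, ha, hb, hz, e1, e2, e3⟩ := hp q hq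
      obtain ⟨z', V', hV', hqV', ha', hb', hz', e1', e2', e3'⟩ := hp q' hq'
      rw [← he] at ha' hb' hz'
      rw [← hz] at hz'
      subst hz'
      have : V = V' := hV.ext_of_straddle hV' (by rw [hz]; simpa [ev] using e3) ha hb ha' hb'
      subst this
      funext i
      rw [hqV, hqV']
  have h2 : ((N : ℕ) : ℝ) ≤ Q / K := Nat.cast_div_le
  have h3 : ((DtCusp d c s K Q).ncard : ℝ) ≤ s * (N : ℝ) ^ 2 := by
    refine (Nat.cast_le.2 h1).trans (le_of_eq ?_)
    rw [Finset.card_product, Finset.card_product, Finset.card_univ, Fintype.card_fin,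
      Finset.card_range, Nat.card_Ioc, Nat.sub_zero]
    push_cast; ring
  refine h3.trans ?_
  gcongr

/-- The value of `W` in terms of the values of the basis `a`, `b`. -/
noncomputable def cfm (a b W : ℤ × ℤ) (y : ℝ × ℝ) : ℝ :=
  (dt W b * y.1 + dt a W * y.2) / dt a b

lemma cfm_rescale {a b : ℤ × ℤ} (h : dt a b ≠ 0) (W z : ℤ × ℤ) (Q : ℕ) :
    cfm a b W (rescale Q (ev a z, ev b z)) = (ev W z : ℝ) / Q := by
  have h' : (dt a b : ℝ) ≠ 0 := by exact_mod_cast h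
  have e : (ev W z : ℝ) * dt a b = ev a z * dt W b + ev b z * dt a W := by
    exact_mod_cast ev_mul_dt z a W b
  simp only [cfm, rescale]
  rw [div_eq_iff h']
  linear_combination (-1 / (Q : ℝ)) * e

lemma cfm_comb (a b W : ℤ × ℤ) (x y : ℝ × ℝ) (s t : ℝ) :
    cfm a b W (s • x + t • y) = s * cfm a b W x + t * cfm a b W y := by
  simp only [cfm, Prod.fst_add, Prod.snd_add, Prod.smul_fst, Prod.smul_snd, smul_eq_mul]
  ring

lemma convex_cfm {I : Set ℝ} (hI : Convex ℝ I) (a b W : ℤ × ℤ) : Convex ℝ {y | cfm a b W y ∈ I} := by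
  intro x hx y hy s t hs ht hst
  simp only [Set.mem_ofPred_eq] at hx hy ⊢
  rw [cfm_comb]
  exact hI hx hy hs ht hst

/-- Congruence and order conditions on a tuple of forms. -/
def IsType (d c : ℕ) {s : ℕ} (V : Fin (s + 1) → ℤ × ℤ) (ρ : ZMod d × ZMod d) : Prop :=
  (∀ i, IsCoprime (V i).1 (V i).2 ∧ (((V i).1 : ZMod d) * ρ.1 + (V i).2 * ρ.2 = c)) ∧
    ∀ i : Fin s, 0 < dt (V i.castSucc) (V i.succ)

/-- The region where the forms `V` are consecutive, in the coordinates given by `V 0`, `V 1`. -/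
def typeRegion (d c : ℕ) {s : ℕ} (V : Fin (s + 1) → ℤ × ℤ) (ρ : ZMod d × ZMod d) : Set (ℝ × ℝ) :=
  {y | (∀ i, cfm (V 0) (V 1) (V i) y ∈ Set.Ioc (0 : ℝ) 1) ∧ ∀ W : ℤ × ℤ, IsCoprime W.1 W.2 →
    (W.1 : ZMod d) * ρ.1 + W.2 * ρ.2 = c → ∀ i : Fin s, 0 < dt (V i.castSucc) W →
    0 < dt W (V i.succ) → cfm (V 0) (V 1) W y ∈ Set.Ioi (1 : ℝ)}

lemma convex_typeRegion (d c : ℕ) {s : ℕ} (V : Fin (s + 1) → ℤ × ℤ) (ρ : ZMod d × ZMod d) :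
    Convex ℝ (typeRegion d c V ρ) := by
  intro x hx y hy a b ha hb hab
  refine ⟨fun i => convex_cfm (convex_Ioc 0 1) _ _ _ (hx.1 i) (hy.1 i) ha hb hab, ?_⟩
  intro W h1 h2 i h3 h4
  exact convex_cfm (convex_Ioi 1) _ _ _ (hx.2 W h1 h2 i h3 h4) (hy.2 W h1 h2 i h3 h4) ha hb hab

lemma dvd_ev_iff {d : ℕ} {ρ : ZMod d × ZMod d} {z : ℤ × ℤ} (hz : z ∈ primClass d ρ) (c : ℕ)
    (W : ℤ × ℤ) : (d : ℤ) ∣ ev W z - c ↔ (W.1 : ZMod d) * ρ.1 + W.2 * ρ.2 = c := by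
  rw [← ZMod.intCast_zmod_eq_zero_iff_dvd, ← hz.2.1, ← hz.2.2, ← sub_eq_zero (b := (c : ZMod d))]
  simp only [ev]
  push_cast
  rfl

lemma cons_iff {d c s : ℕ} {ρ : ZMod d × ZMod d} {z : ℤ × ℤ} (hz : z ∈ primClass d ρ)
    {Q : ℕ} (hQ : 0 < Q) {V : Fin (s + 1) → ℤ × ℤ} (h01 : dt (V 0) (V 1) ≠ 0) :
    Cons d c Q z V ↔ IsType d c V ρ ∧ rescale Q (ev (V 0) z, ev (V 1) z) ∈ typeRegion d c V ρ := by
  have hQ' : (0 : ℝ) < Q := by exact_mod_cast hQ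
  have e1 : ∀ W, cfm (V 0) (V 1) W (rescale Q (ev (V 0) z, ev (V 1) z)) ∈ Set.Ioc (0 : ℝ) 1 ↔
      0 < ev W z ∧ ev W z ≤ Q := by
    intro W
    rw [cfm_rescale h01, Set.mem_Ioc, div_le_one hQ', div_pos_iff_of_pos_right hQ']
    norm_cast
  have e2 : ∀ W, cfm (V 0) (V 1) W (rescale Q (ev (V 0) z, ev (V 1) z)) ∈ Set.Ioi (1 : ℝ) ↔
      (Q : ℤ) < ev W z := by
    intro W
    rw [cfm_rescale h01, Set.mem_Ioi, one_lt_div hQ']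
    norm_cast
  simp only [Cons, IsType, typeRegion, Set.mem_ofPred_eq, e1, e2, Cls, dvd_ev_iff hz]
  constructor
  · rintro ⟨h1, h2⟩
    refine ⟨⟨fun i => ⟨(h1 i).1, (h1 i).2.2.2⟩, fun i => (h2 i).1⟩, fun i => (h1 i).2.1 |> fun h =>
      ⟨h, (h1 i).2.2.1⟩, fun W hW1 hW2 i hl hr => ?_⟩
    by_contra hle
    refine (h2 i).2 W ⟨hW1, ?_, not_lt.1 hle, hW2⟩ ⟨hl, hr⟩
    have h := ev_mul_dt z (V i.castSucc) W (V i.succ)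
    have a := (h1 i.castSucc).2.1
    have b := (h1 i.succ).2.1
    have : 0 < ev W z * dt (V i.castSucc) (V i.succ) := by rw [h]; positivity
    exact pos_of_mul_pos_left this (h2 i).1.le
  · rintro ⟨⟨h1, h2⟩, h3, h4⟩
    refine ⟨fun i => ⟨(h1 i).1, (h3 i).1, (h3 i).2, (h1 i).2⟩, fun i => ⟨h2 i, ?_⟩⟩
    rintro W ⟨hW1, hW2, hW3, hW4⟩ ⟨hl, hr⟩
    exact absurd (h4 W hW1 hW4 i hl hr) (not_lt.2 hW3)

/-- A finite set of representatives of the tuples with determinants at most `B`. -/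
def typeSet (d c s : ℕ) (B : ℤ) : Set ((Fin (s + 1) → ℤ × ℤ) × (ZMod d × ZMod d)) :=
  {k | (∀ i, |(k.1 i).1| ≤ B + B ^ 2 + 1 ∧ |(k.1 i).2| ≤ B + B ^ 2 + 1) ∧ IsType d c k.1 k.2 ∧
    0 < dt (k.1 0) (k.1 1) ∧ ∀ i j, |dt (k.1 i) (k.1 j)| ≤ B}

lemma finite_typeSet {d : ℕ} (hd : 0 < d) (c s : ℕ) (B : ℤ) : (typeSet d c s B).Finite := by
  have : NeZero d := ⟨hd.ne'⟩
  refine Set.Finite.subset ((Set.Finite.pi' fun _ : Fin (s + 1) =>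
    (Set.finite_Icc ((-(B + B ^ 2 + 1), -(B + B ^ 2 + 1)) : ℤ × ℤ)
      (B + B ^ 2 + 1, B + B ^ 2 + 1))).prod (Set.finite_univ (α := ZMod d × ZMod d))) ?_
  rintro ⟨V, ρ⟩ ⟨h, -⟩
  refine ⟨fun i => ?_, Set.mem_univ _⟩
  obtain ⟨h1, h2⟩ := h i
  rw [abs_le] at h1 h2
  exact ⟨⟨h1.1, h2.1⟩, ⟨h1.2, h2.2⟩⟩

lemma exists_normal_form {s : ℕ} {B : ℤ} {z : ℤ × ℤ} {V : Fin (s + 1) → ℤ × ℤ}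
    (hcop : IsCoprime (V 0).1 (V 0).2) (hpos : 0 < ev (V 0) z) (h01 : 0 < dt (V 0) (V 1))
    (hB : ∀ i j, |dt (V i) (V j)| ≤ B) :
    ∃ g z', IsGauge g z z' ∧ ∀ i, |(g (V i)).1| ≤ B + B ^ 2 + 1 ∧ |(g (V i)).2| ≤ B + B ^ 2 + 1 := by
  obtain ⟨g, z', hg, h0, -⟩ := exists_gauge_center hcop hpos
  have hB0 : 0 ≤ B := (abs_nonneg _).trans (hB 0 0)
  have e1 : ∀ j, (g (V j)).1 = - dt (V 0) (V j) := by
    intro j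
    rw [← hg.dt_eq, h0]; simp [dt]
  set a := (g (V 1)).1 with ha
  have ha1 := e1 1
  have ha0 : a ≠ 0 := by omega
  have h2 := isGauge_mat (A := 1) (B := 0) (C := -((g (V 1)).2 / a)) (D := 1) (by ring) z'
  have hG := hg.comp h2
  refine ⟨_, _, hG, fun j => ?_⟩
  have haB : |a| ≤ B := by rw [ha, ha1, abs_neg]; exact hB _ _
  have hjB : ∀ j, |(g (V j)).1| ≤ B := by intro j; rw [e1, abs_neg]; exact hB _ _
  have hd := hB 1 j
  rw [← hG.dt_eq] at hd
  have hb0 := Int.emod_nonneg (g (V 1)).2 ha0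
  have hb1 := Int.emod_lt_abs (g (V 1)).2 ha0
  rw [Int.emod_def] at hb0 hb1
  set b := (g (V 1)).2 - a * ((g (V 1)).2 / a) with hb
  set x := (g (V j)).1 with hx
  set y := (g (V j)).2 + -((g (V 1)).2 / a) * x with hy
  have e : dt (((fun W : ℤ × ℤ => (1 * W.1 + 0 * W.2, -((g (V 1)).2 / a) * W.1 + 1 * W.2)) ∘ g) (V 1))
      (((fun W : ℤ × ℤ => (1 * W.1 + 0 * W.2, -((g (V 1)).2 / a) * W.1 + 1 * W.2)) ∘ g) (V j)) =
      a * y - b * x := by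
    simp only [Function.comp, dt, hb, hy, ← ha, ← hx]; ring
  rw [e] at hd
  have hxB : |x| ≤ B := hjB j
  have hbx : |b * x| ≤ B * B := by
    rw [abs_mul]
    exact mul_le_mul (by rw [abs_of_nonneg hb0]; omega) hxB (abs_nonneg _) hB0
  have hy1 : |y| ≤ B + B * B := by
    have h3 : |a * y| ≤ B + B * B := by
      have := abs_add_le (a * y - b * x) (b * x)
      rw [sub_add_cancel] at this
      linarith
    rw [abs_mul] at h3
    have : 1 * |y| ≤ |a| * |y| := mul_le_mul_of_nonneg_right (Int.one_le_abs ha0) (abs_nonneg _)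
    linarith
  simp only [Function.comp, one_mul, zero_mul, add_zero]
  refine ⟨?_, ?_⟩
  · rw [← hx]; nlinarith
  · rw [← hx, add_comm, ← hy]; nlinarith

lemma mem_dtBdd_iff {d c s : ℕ} (hs : 1 ≤ s) {B : ℤ} {Q : ℕ} (hQ : 0 < Q)
    {q : Fin (s + 1) → ℤ} : q ∈ DtBdd d c s B Q ↔ ∃ k ∈ typeSet d c s B, ∃ z ∈ primClass d k.2,
      rescale Q (ev (k.1 0) z, ev (k.1 1) z) ∈ typeRegion d c k.1 k.2 ∧ ∀ i, q i = ev (k.1 i) z := by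
  have h01 : (0 : Fin (s + 1)) < 1 := by
    have : NeZero s := ⟨by omega⟩
    exact Fin.one_pos'
  constructor
  · rintro ⟨z, V, hz, hV, hq, hB⟩
    obtain ⟨g, z', hg, hb⟩ := exists_normal_form (hV.1 0).1 (hV.pos 0) (hV.dt_pos h01) hB
    have hV' := hg.cons hV
    have hz' : z' ∈ primClass d ((z'.1 : ZMod d), (z'.2 : ZMod d)) := ⟨hg.cop_pt.2 hz, rfl, rfl⟩
    have hp := hV'.dt_pos h01
    obtain ⟨h1, h2⟩ := (cons_iff hz' hQ hp.ne').1 hV'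
    exact ⟨(fun i => g (V i), ((z'.1 : ZMod d), (z'.2 : ZMod d))),
      ⟨hb, h1, hp, fun i j => by simp only [hg.dt_eq]; exact hB i j⟩, z', hz', h2,
      fun i => by simp only [hg.ev_eq]; exact hq i⟩
  · rintro ⟨⟨V, ρ⟩, ⟨-, h1, h2, h3⟩, z, hz, hr, hq⟩
    exact ⟨z, V, hz.1, (cons_iff hz hQ h2.ne').2 ⟨h1, hr⟩, hq, h3⟩

lemma AlmostPeriodic.inter {A B : Set (ℤ × ℤ)} (hA : AlmostPeriodic A) (hB : AlmostPeriodic B) :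
    AlmostPeriodic (A ∩ B) := by
  have := AlmostPeriodic.comb (ι := Bool) (A := fun b => bif b then A else B)
    (by rintro (_ | _) <;> assumption) (fun p => p true ∧ p false)
  exact this

lemma volume_frontier_of_convex {S : Set (ℝ × ℝ)} (hS : Convex ℝ S) : volume (frontier S) = 0 :=
  hS.addHaar_frontier volume

/-- The points of the unit square whose associated tuple lies in `𝓑`. -/
def tupleRegion {s : ℕ} (V : Fin (s + 1) → ℤ × ℤ) (𝓑 : Set (Fin (s + 1) → ℝ)) : Set (ℝ × ℝ) :=
  {y | y ∈ Set.Icc (0 : ℝ) 1 ×ˢ Set.Icc (0 : ℝ) 1 ∧ (fun j => cfm (V 0) (V 1) (V j) y) ∈ 𝓑}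

lemma convex_tupleRegion {s : ℕ} (V : Fin (s + 1) → ℤ × ℤ) {𝓑 : Set (Fin (s + 1) → ℝ)}
    (h𝓑 : Convex ℝ 𝓑) : Convex ℝ (tupleRegion V 𝓑) := by
  intro x hx y hy a b ha hb hab
  refine ⟨((convex_Icc 0 1).prod (convex_Icc 0 1)) hx.1 hy.1 ha hb hab, ?_⟩
  have e : (fun j => cfm (V 0) (V 1) (V j) (a • x + b • y)) =
      a • (fun j => cfm (V 0) (V 1) (V j) x) + b • fun j => cfm (V 0) (V 1) (V j) y := by
    funext j
    simp [cfm_comb]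
  rw [e]
  exact h𝓑 hx.2 hy.2 ha hb hab

lemma isBounded_tupleRegion {s : ℕ} (V : Fin (s + 1) → ℤ × ℤ) (𝓑 : Set (Fin (s + 1) → ℝ)) :
    Bornology.IsBounded (tupleRegion V 𝓑) :=
  ((Metric.isBounded_Icc _ _).prod (Metric.isBounded_Icc _ _)).subset fun _ h => h.1

/-- `q` is realized by the forms `V` in the residue class `ρ`. -/
def HasType (d c : ℕ) {s : ℕ} (Q : ℕ) (V : Fin (s + 1) → ℤ × ℤ) (ρ : ZMod d × ZMod d)
    (q : Fin (s + 1) → ℤ) : Prop :=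
  ∃ z ∈ primClass d ρ, rescale Q (ev (V 0) z, ev (V 1) z) ∈ typeRegion d c V ρ ∧
    ∀ i, q i = ev (V i) z

/-- The pairs at which the tuples associated with two families of forms agree. -/
def agreeSet {s : ℕ} (V V' : Fin (s + 1) → ℤ × ℤ) : Set (ℤ × ℤ) :=
  {y | ∀ j, (dt (V' 0) (V' 1) * dt (V j) (V 1) - dt (V 0) (V 1) * dt (V' j) (V' 1)) * y.1 +
    (dt (V' 0) (V' 1) * dt (V 0) (V j) - dt (V 0) (V 1) * dt (V' 0) (V' j)) * y.2 = 0}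

lemma ev_eq_iff_mem_agreeSet {s : ℕ} {V V' : Fin (s + 1) → ℤ × ℤ} {z z' : ℤ × ℤ}
    (h : dt (V 0) (V 1) ≠ 0) (h' : dt (V' 0) (V' 1) ≠ 0) (h0 : ev (V 0) z = ev (V' 0) z')
    (h1 : ev (V 1) z = ev (V' 1) z') :
    (∀ j, ev (V j) z = ev (V' j) z') ↔ (ev (V 0) z, ev (V 1) z) ∈ agreeSet V V' := by
  refine forall_congr' fun j => ?_
  have e := ev_mul_dt z (V 0) (V j) (V 1)
  have e' := ev_mul_dt z' (V' 0) (V' j) (V' 1)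
  rw [← h0, ← h1] at e'
  rw [← sub_eq_zero, ← mul_right_inj' (mul_ne_zero h h'), mul_zero]
  constructor
  · intro H; linear_combination H - dt (V' 0) (V' 1) * e + dt (V 0) (V 1) * e'
  · intro H; linear_combination H + dt (V' 0) (V' 1) * e - dt (V 0) (V 1) * e'

lemma hasType_iff {d c s : ℕ} {Q : ℕ} {V V' : Fin (s + 1) → ℤ × ℤ} {ρ' : ZMod d × ZMod d}
    {z : ℤ × ℤ} (h : dt (V 0) (V 1) ≠ 0) (h' : dt (V' 0) (V' 1) ≠ 0) {q : Fin (s + 1) → ℤ}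
    (hq : ∀ i, q i = ev (V i) z) : HasType d c Q V' ρ' q ↔
      ((q 0, q 1) ∈ pairImage d ρ' (V' 0) (V' 1) ∩ agreeSet V V' ∧
        rescale Q (q 0, q 1) ∈ typeRegion d c V' ρ') := by
  constructor
  · rintro ⟨z', hz', hr, hq'⟩
    have e := fun j => (hq j).symm.trans (hq' j)
    refine ⟨⟨⟨z', hz', by rw [hq', hq']⟩, ?_⟩, by rw [hq', hq']; exact hr⟩
    rw [hq, hq]
    exact (ev_eq_iff_mem_agreeSet h h' (e 0) (e 1)).1 e
  · rintro ⟨⟨⟨z', hz', he⟩, hl⟩, hr⟩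
    rw [Prod.mk.injEq] at he
    refine ⟨z', hz', by rw [← he.1, ← he.2]; exact hr, fun i => ?_⟩
    rw [hq i]
    refine (ev_eq_iff_mem_agreeSet h h' ?_ ?_).2 ?_ i
    · rw [← hq, he.1]
    · rw [← hq, he.2]
    · rw [← hq, ← hq]; exact hl

lemma typeRegion_subset {d c s : ℕ} {V : Fin (s + 1) → ℤ × ℤ} {ρ : ZMod d × ZMod d}
    (h : dt (V 0) (V 1) ≠ 0) : typeRegion d c V ρ ⊆ Set.Icc (0 : ℝ) 1 ×ˢ Set.Icc (0 : ℝ) 1 := by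
  have h' : (dt (V 0) (V 1) : ℝ) ≠ 0 := by exact_mod_cast h
  intro y hy
  have h0 := hy.1 0
  have h1 := hy.1 1
  simp only [cfm, dt_self, Int.cast_zero, zero_mul, add_zero, zero_add] at h0 h1
  rw [mul_div_cancel_left₀ _ h'] at h0 h1
  exact ⟨⟨h0.1.le, h0.2⟩, ⟨h1.1.le, h1.2⟩⟩

open Classical in
lemma ncard_dtBdd_eq {d c s N : ℕ} (hs : 1 ≤ s) {B : ℤ} {Q : ℕ} (hQ : 0 < Q)
    {k : Fin N → (Fin (s + 1) → ℤ × ℤ) × (ZMod d × ZMod d)} (hk : Set.range k = typeSet d c s B)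
    (𝓑 : Set (Fin (s + 1) → ℝ)) :
    {q ∈ DtBdd d c s B Q | (fun i => (q i : ℝ) / Q) ∈ 𝓑}.ncard =
      ∑ i, {y : ℤ × ℤ | rescale Q y ∈ tupleRegion (k i).1 𝓑 ∧
        ((y ∈ pairImage d (k i).2 ((k i).1 0) ((k i).1 1) ∩ agreeSet (k i).1 (k i).1 ∧
          rescale Q y ∈ typeRegion d c (k i).1 (k i).2) ∧ ∀ l < i,
          ¬ (y ∈ pairImage d (k l).2 ((k l).1 0) ((k l).1 1) ∩ agreeSet (k i).1 (k l).1 ∧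
          rescale Q y ∈ typeRegion d c (k l).1 (k l).2))}.ncard := by
  have hdt : ∀ i, dt ((k i).1 0) ((k i).1 1) ≠ 0 := fun i =>
    (show k i ∈ typeSet d c s B from hk ▸ Set.mem_range_self i).2.2.1.ne'
  set S : Fin N → Set (Fin (s + 1) → ℤ) := fun i => {q | (fun i => (q i : ℝ) / Q) ∈ 𝓑 ∧
    HasType d c Q (k i).1 (k i).2 q ∧ ∀ l < i, ¬ HasType d c Q (k l).1 (k l).2 q} with hS
  have e1 : {q ∈ DtBdd d c s B Q | (fun i => (q i : ℝ) / Q) ∈ 𝓑} =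
      ⋃ i ∈ (Finset.univ : Finset (Fin N)), S i := by
    ext q
    simp only [Set.mem_ofPred_eq, mem_dtBdd_iff hs hQ, ← hk, Set.exists_range_iff, Finset.mem_univ,
      Set.iUnion_true, Set.mem_iUnion, hS]
    constructor
    · rintro ⟨⟨i, hi⟩, hq⟩
      have hne : (Finset.univ.filter fun i => HasType d c Q (k i).1 (k i).2 q).Nonempty :=
        ⟨i, Finset.mem_filter.2 ⟨Finset.mem_univ _, hi⟩⟩
      refine ⟨_, hq, (Finset.mem_filter.1 (Finset.min'_mem _ hne)).2, fun l hl hl' => ?_⟩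
      exact absurd (Finset.min'_le _ l (Finset.mem_filter.2 ⟨Finset.mem_univ _, hl'⟩)) (not_le.2 hl)
    · rintro ⟨i, hq, hi, -⟩
      exact ⟨⟨i, hi⟩, hq⟩
  have hfin : ∀ i, (S i).Finite := fun i => by
    refine (finite_Dt d c s Q).subset fun q hq => dtBdd_subset d c s B Q ?_
    have : q ∈ ⋃ i ∈ (Finset.univ : Finset (Fin N)), S i := by simp; exact ⟨i, hq⟩
    rw [← e1] at this
    exact this.1
  rw [e1, ncard_biUnion_finset]
  · refine Finset.sum_congr rfl fun i _ => ?_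
    rw [← Set.InjOn.ncard_image (f := fun q : Fin (s + 1) → ℤ => (q 0, q 1)) (s := S i)]
    · congr 1
      ext y
      simp only [Set.mem_image, Set.mem_ofPred_eq]
      have hreg : ∀ z, (fun j => ((ev ((k i).1 j) z : ℤ) : ℝ) / Q) ∈ 𝓑 ↔
          (fun j => cfm ((k i).1 0) ((k i).1 1) ((k i).1 j)
            (rescale Q (ev ((k i).1 0) z, ev ((k i).1 1) z))) ∈ 𝓑 := by
        intro z
        simp only [cfm_rescale (hdt i)]
      constructor
      · rintro ⟨q, ⟨hq, hi, hl⟩, rfl⟩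
        obtain ⟨z, hz, hr, hqz⟩ := id hi
        have hh := hasType_iff (c := c) (Q := Q) (ρ' := (k i).2) (hdt i) (hdt i) hqz
        refine ⟨⟨?_, ?_⟩, hh.1 hi, fun l hli => ?_⟩
        · rw [hqz, hqz]
          exact typeRegion_subset (hdt i) hr
        · simp only [hqz] at hq ⊢
          exact (hreg z).1 hq
        · rw [← hasType_iff (hdt i) (hdt l) hqz]
          exact hl l hli
      · rintro ⟨⟨-, h2⟩, h3, h4⟩
        obtain ⟨⟨z, hz, rfl⟩, -⟩ := h3.1
        refine ⟨fun j => ev ((k i).1 j) z, ⟨(hreg z).2 h2, ?_, fun l hli => ?_⟩, rfl⟩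
        · rw [hasType_iff (hdt i) (hdt i) fun _ => rfl]
          exact h3
        · rw [hasType_iff (hdt i) (hdt l) fun _ => rfl]
          exact h4 l hli
    · rintro q ⟨hq, ⟨z, hz, hr, hqz⟩, hl⟩ q' ⟨hq', ⟨z', hz', hr', hqz'⟩, hl'⟩ he
      simp only [Prod.mk.injEq, hqz, hqz'] at he
      funext j
      rw [hqz, hqz']
      have a := ev_mul_dt z ((k i).1 0) ((k i).1 j) ((k i).1 1)
      have b := ev_mul_dt z' ((k i).1 0) ((k i).1 j) ((k i).1 1)
      rw [he.1, he.2, ← b] at a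
      exact mul_right_cancel₀ (hdt i) a
  · intro i _ j _ hij
    rw [Function.onFun, Set.disjoint_left]
    intro q h1 h2
    rcases lt_or_gt_of_ne hij with h | h
    · exact h2.2.2 i h h1.2.1
    · exact h1.2.2 j h h2.2.1
  · exact hfin

open Classical in
lemma exists_dtBdd_limit {d : ℕ} (hd : 0 < d) (c : ℕ) {s : ℕ} (hs : 1 ≤ s) (B : ℤ) :
    ∃ (N : ℕ) (k : Fin N → (Fin (s + 1) → ℤ × ℤ) × (ZMod d × ZMod d))
      (θ : Fin N → Set (Fin N) → ℝ), (∀ i, 0 < dt ((k i).1 0) ((k i).1 1)) ∧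
      (∀ i J, 0 ≤ θ i J) ∧ ∀ 𝓑 : Set (Fin (s + 1) → ℝ), Convex ℝ 𝓑 →
      Tendsto (fun Q : ℕ => ({q ∈ DtBdd d c s B Q | (fun i => (q i : ℝ) / Q) ∈ 𝓑}.ncard : ℝ) /
        (Q : ℝ) ^ 2) atTop (nhds (∑ i, ∑ J, θ i J * volume.real (tupleRegion (k i).1 𝓑 ∩
          patternCell (fun l => typeRegion d c (k l).1 (k l).2) J))) := by
  obtain ⟨N, k, -, hk⟩ := (finite_typeSet hd c s B).fin_param
  have hdt : ∀ i, 0 < dt ((k i).1 0) ((k i).1 1) := fun i =>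
    (show k i ∈ typeSet d c s B from hk ▸ Set.mem_range_self i).2.2.1
  set A : Fin N → Fin N → Set (ℤ × ℤ) := fun i l =>
    pairImage d (k l).2 ((k l).1 0) ((k l).1 1) ∩ agreeSet (k i).1 (k l).1 with hA
  have hAP : ∀ i l, AlmostPeriodic (A i l) := fun i l =>
    (almostPeriodic_pairImage hd _ (hdt l).ne').inter (almostPeriodic_lines _ _)
  set Ψ : Fin N → (Fin N → Prop) → (Fin N → Prop) → Prop := fun i p r =>
    (p i ∧ r i) ∧ ∀ l < i, ¬ (p l ∧ r l) with hΨ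
  refine ⟨N, k, fun i J => dens {z | Ψ i (fun l => z ∈ A i l) (fun l => l ∈ J)}, hdt,
    fun i J => ?_, fun 𝓑 h𝓑 => ?_⟩
  · exact (AlmostPeriodic.comb (hAP i) fun p => Ψ i p fun l => l ∈ J).dens_nonneg
  have h1 := fun i => tendsto_count_comb (hAP i)
    (fun l => volume_frontier_of_convex (convex_typeRegion d c (k l).1 (k l).2))
    (isBounded_tupleRegion (k i).1 𝓑) (volume_frontier_of_convex (convex_tupleRegion (k i).1 h𝓑))
    (Ψ i)
  refine (tendsto_finsetSum Finset.univ fun i _ => h1 i).congr' ?_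
  filter_upwards [eventually_gt_atTop 0] with Q hQ
  rw [ncard_dtBdd_eq hs hQ hk 𝓑]
  push_cast
  rw [Finset.sum_div]

lemma card_dvd_progression_le {p d : ℕ} (hp : p.Prime) (hpd : ¬ p ∣ d) (b R : ℕ) :
    ((Finset.range R).filter fun i => p ∣ b + d * i).card ≤ R / p + 1 := by
  rw [← Finset.card_range (R / p + 1)]
  refine Finset.card_le_card_of_injOn (fun i => i / p) (fun i hi => ?_) ?_
  · simp only [Finset.coe_filter, Finset.mem_range, Set.mem_ofPred_eq] at hi
    simp only [Finset.coe_range, Set.mem_Iio]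
    exact Nat.lt_succ_of_le (Nat.div_le_div_right hi.1.le)
  · intro i hi j hj hij
    simp only [Finset.coe_filter, Finset.mem_range, Set.mem_ofPred_eq] at hi hj
    have h2 : (i : ℤ) ≡ j [ZMOD p] := by
      have a : (p : ℤ) ∣ d * (i - j) := by
        have := dvd_sub (Int.natCast_dvd_natCast.2 hi.2) (Int.natCast_dvd_natCast.2 hj.2)
        push_cast at this
        have e : (d : ℤ) * (i - j) = b + d * i - (b + d * j) := by ring
        rw [e]; exact this
      have := ((Nat.prime_iff_prime_int.1 hp).dvd_or_dvd a).resolve_left fun h => hpd (Int.natCast_dvd_natCast.1 h)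
      exact (Int.modEq_iff_dvd.2 (by rw [← dvd_neg, neg_sub]; exact this))
    have h3 : i % p = j % p := (Int.natCast_modEq_iff.1 h2)
    have e1 := Nat.div_add_mod i p
    have e2 := Nat.div_add_mod j p
    simp only at hij
    rw [← e1, ← e2, hij, h3]

lemma sum_inv_sq_le (M : ℕ) (hM : 2 ≤ M) :
    ∑ p ∈ Finset.Icc 2 M, 1 / (p : ℝ) ^ 2 ≤ 3 / 4 - 1 / (M : ℝ) := by
  induction M, hM using Nat.le_induction with
  | base => norm_num
  | succ M hM ih =>
    rw [Finset.sum_Icc_succ_top (by omega)]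
    have hM' : (0 : ℝ) < M := by positivity
    have : 1 / ((M + 1 : ℕ) : ℝ) ^ 2 ≤ 1 / M - 1 / ((M + 1 : ℕ) : ℝ) := by
      push_cast
      rw [div_sub_div _ _ (by positivity) (by positivity), div_le_div_iff₀ (by positivity)
        (by positivity)]
      nlinarith
    linarith

/-- The pairs counted below are the fractions `(1 + d j) / (c + d R + d i)`. -/
lemma card_coprime_progressions_ge {d : ℕ} (hd : 2 ≤ d) (c : ℕ) {R : ℕ} (hR : 1 ≤ R) :
    (R : ℝ) ^ 2 / 8 - 14 * d * R ≤ (((Finset.range R ×ˢ Finset.range R).filter fun x =>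
      Nat.Coprime (c + d * R + d * x.1) (1 + d * x.2)).card : ℝ) := by
  set M := 2 * d * R with hM
  have hM2 : 2 ≤ M := by nlinarith
  set S := Finset.range R ×ˢ Finset.range R with hS
  set bad := S.filter fun x => ¬ Nat.Coprime (c + d * R + d * x.1) (1 + d * x.2) with hbad
  have hsum : ((S.filter fun x => Nat.Coprime (c + d * R + d * x.1) (1 + d * x.2)).card : ℝ) +
      bad.card = (R : ℝ) ^ 2 := by
    have := Finset.card_filter_add_card_filter_not (s := S)
      (fun x => Nat.Coprime (c + d * R + d * x.1) (1 + d * x.2))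
    rw [hS, Finset.card_product, Finset.card_range] at this
    rw [← hS, ← hbad] at this
    rw [sq]
    exact_mod_cast this
  have hsub : bad ⊆ ((Finset.Icc 2 M).filter fun p => p.Prime ∧ ¬ p ∣ d).biUnion fun p =>
      ((Finset.range R).filter fun i => p ∣ (c + d * R) + d * i) ×ˢ
        ((Finset.range R).filter fun i => p ∣ 1 + d * i) := by
    intro x hx
    simp only [hbad, hS, Finset.mem_filter, Finset.mem_product, Finset.mem_range] at hx
    obtain ⟨p, hp, h1, h2⟩ := Nat.Prime.not_coprime_iff_dvd.1 hx.2
    have hpd : ¬ p ∣ d := fun h => hp.one_lt.ne' (Nat.dvd_one.1 ((Nat.dvd_add_left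
      (h.mul_right _)).1 h2))
    have hle : p ≤ M := by
      refine (Nat.le_of_dvd (by omega) h2).trans ?_
      have : d * x.2 + d ≤ d * R := by
        calc d * x.2 + d = d * (x.2 + 1) := by ring
          _ ≤ d * R := Nat.mul_le_mul_left _ hx.1.2
      rw [hM]; nlinarith
    simp only [Finset.mem_biUnion, Finset.mem_filter, Finset.mem_product, Finset.mem_range,
      Finset.mem_Icc]
    exact ⟨p, ⟨⟨hp.two_le, hle⟩, hp, hpd⟩, ⟨hx.1.1, h1⟩, hx.1.2, h2⟩
  have hbd : (bad.card : ℝ) ≤ ∑ p ∈ Finset.Icc 2 M, ((R : ℝ) / p + 1) ^ 2 := by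
    calc (bad.card : ℝ) ≤ ∑ p ∈ (Finset.Icc 2 M).filter fun p => p.Prime ∧ ¬ p ∣ d,
          ((R : ℝ) / p + 1) ^ 2 := by
          have h1 := (Finset.card_le_card hsub).trans Finset.card_biUnion_le
          refine (Nat.cast_le.2 h1).trans ?_
          push_cast
          refine Finset.sum_le_sum fun p hp => ?_
          obtain ⟨-, hp1, hp2⟩ := Finset.mem_filter.1 hp
          rw [Finset.card_product, sq]
          push_cast
          have hle : ∀ b, ((((Finset.range R).filter fun i => p ∣ b + d * i).card : ℕ) : ℝ) ≤
              R / p + 1 := by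
            intro b
            have h2 := card_dvd_progression_le hp1 hp2 b R
            have h3 : ((R / p : ℕ) : ℝ) ≤ R / p := Nat.cast_div_le
            have h4 : ((((Finset.range R).filter fun i => p ∣ b + d * i).card : ℕ) : ℝ) ≤
              ((R / p : ℕ) : ℝ) + 1 := by exact_mod_cast h2
            linarith
          exact mul_le_mul (hle _) (hle _) (Nat.cast_nonneg _) (by positivity)
      _ ≤ _ := Finset.sum_le_sum_of_subset_of_nonneg (Finset.filter_subset _ _)
          fun _ _ _ => by positivity
  have hterm : ∀ p ∈ Finset.Icc 2 M, ((R : ℝ) / p + 1) ^ 2 ≤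
      7 / 6 * (R : ℝ) ^ 2 * (1 / (p : ℝ) ^ 2) + 7 := by
    intro p hp
    have e : (R : ℝ) ^ 2 * (1 / (p : ℝ) ^ 2) = (R / p) ^ 2 := by ring
    rw [mul_assoc, e]
    nlinarith [sq_nonneg ((R : ℝ) / p - 6)]
  have h2 := hbd.trans (Finset.sum_le_sum hterm)
  rw [Finset.sum_add_distrib, ← Finset.mul_sum, Finset.sum_const, Nat.card_Icc, nsmul_eq_mul] at h2
  have h3 := sum_inv_sq_le M hM2
  have h4 : ((M + 1 - 2 : ℕ) : ℝ) ≤ 2 * d * R := by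
    have : M + 1 - 2 ≤ 2 * d * R := by omega
    exact_mod_cast this
  have h5 : 0 ≤ 1 / (M : ℝ) := by positivity
  have h6 : 7 / 6 * (R : ℝ) ^ 2 * ∑ p ∈ Finset.Icc 2 M, 1 / (p : ℝ) ^ 2 ≤
      7 / 6 * (R : ℝ) ^ 2 * (3 / 4) := by gcongr; linarith
  linarith

lemma finite_fareyFracCD (Q c d : ℕ) : (FareyFracCD Q c d).Finite := by
  have : Set.InjOn (fun x : ℚ => (x.num, x.den)) (FareyFracCD Q c d) := by
    intro x _ y _ h
    simp only [Prod.mk.injEq] at h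
    exact Rat.ext h.1 h.2
  refine Set.Finite.of_finite_image ?_ this
  refine ((Set.finite_Icc (0 : ℤ) Q).prod (Set.finite_Iic Q)).subset ?_
  rintro _ ⟨x, ⟨h1, h2, h3, -⟩, rfl⟩
  refine ⟨⟨Rat.num_nonneg.2 h1, ?_⟩, h3⟩
  have h4 : x.num ≤ x.den := by
    rw [← Rat.num_div_den x, div_le_one (by exact_mod_cast x.pos)] at h2
    exact_mod_cast h2
  exact h4.trans (by exact_mod_cast h3)

lemma eventually_card_fareyFracCD_ge {d : ℕ} (hd : 2 ≤ d) {c : ℕ} (hc : c < d) :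
    ∃ κ : ℝ, 0 < κ ∧ ∀ᶠ Q : ℕ in atTop, κ * (Q : ℝ) ^ 2 ≤ (FareyFracCD Q c d).ncard := by
  have hd' : (2 : ℝ) ≤ d := by exact_mod_cast hd
  have key : ∀ Q : ℕ, 2 * d ≤ Q → ((Q / (2 * d) : ℕ) : ℝ) ^ 2 / 8 - 14 * d * ((Q / (2 * d) : ℕ) : ℝ)
      ≤ (FareyFracCD Q c d).ncard := by
    intro Q hQ
    set R := Q / (2 * d) with hR
    have hR1 : 1 ≤ R := (Nat.one_le_div_iff (by omega)).2 hQ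
    have hRQ : 2 * d * R ≤ Q := by rw [hR]; exact Nat.mul_div_le Q (2 * d)
    refine (card_coprime_progressions_ge hd c hR1).trans ?_
    rw [← Set.ncard_coe_finset, Nat.cast_le]
    have hden : ∀ x : ℕ × ℕ, Nat.Coprime (c + d * R + d * x.1) (1 + d * x.2) →
        (((1 + d * x.2 : ℕ) : ℚ) / ((c + d * R + d * x.1 : ℕ) : ℚ)).den = c + d * R + d * x.1 := by
      intro x hx
      have hpos : 0 < c + d * R + d * x.1 := by nlinarith
      have := Rat.den_div_eq_of_coprime (a := ((1 + d * x.2 : ℕ) : ℤ))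
        (b := ((c + d * R + d * x.1 : ℕ) : ℤ)) (by exact_mod_cast hpos)
        (by rw [Int.natAbs_natCast, Int.natAbs_natCast]; exact hx.symm)
      rw [Int.cast_natCast, Int.cast_natCast] at this
      exact Nat.cast_injective this
    have hnum : ∀ x : ℕ × ℕ, Nat.Coprime (c + d * R + d * x.1) (1 + d * x.2) →
        (((1 + d * x.2 : ℕ) : ℚ) / ((c + d * R + d * x.1 : ℕ) : ℚ)).num = ((1 + d * x.2 : ℕ) : ℤ) := by
      intro x hx
      have hpos : 0 < c + d * R + d * x.1 := by nlinarith
      have := Rat.num_div_eq_of_coprime (a := ((1 + d * x.2 : ℕ) : ℤ))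
        (b := ((c + d * R + d * x.1 : ℕ) : ℤ)) (by exact_mod_cast hpos)
        (by rw [Int.natAbs_natCast, Int.natAbs_natCast]; exact hx.symm)
      rw [Int.cast_natCast, Int.cast_natCast] at this
      exact this
    refine Set.ncard_le_ncard_of_injOn (fun x : ℕ × ℕ => ((1 + d * x.2 : ℕ) : ℚ) /
      ((c + d * R + d * x.1 : ℕ) : ℚ)) (fun x hx => ?_) ?_ (finite_fareyFracCD Q c d)
    · simp only [Finset.coe_filter, Finset.mem_product, Finset.mem_range, Set.mem_ofPred_eq] at hx
      have hpos : 0 < c + d * R + d * x.1 := by nlinarith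
      have a1 : d * x.2 + d ≤ d * R := by nlinarith [Nat.mul_le_mul_left d hx.1.2]
      have a2 : d * x.1 + d ≤ d * R := by nlinarith [Nat.mul_le_mul_left d hx.1.1]
      refine ⟨by positivity, ?_, ?_, ?_⟩
      · rw [div_le_one (by exact_mod_cast hpos)]
        have : 1 + d * x.2 ≤ c + d * R + d * x.1 := by omega
        exact_mod_cast this
      · rw [hden x hx.2]; nlinarith
      · rw [hden x hx.2, add_assoc, ← mul_add, Nat.add_mul_mod_self_left, Nat.mod_eq_of_lt hc]
    · intro x hx y hy hxy
      simp only [Finset.coe_filter, Finset.mem_product, Finset.mem_range, Set.mem_ofPred_eq] at hx hy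
      have e1 := hden x hx.2
      have e2 := hnum x hx.2
      simp only at hxy
      rw [hxy, hden y hy.2] at e1
      rw [hxy, hnum y hy.2] at e2
      have e2' : 1 + d * y.2 = 1 + d * x.2 := by exact_mod_cast e2
      have d0 : 0 < d := by omega
      ext
      · exact Nat.eq_of_mul_eq_mul_left d0 (by omega)
      · exact Nat.eq_of_mul_eq_mul_left d0 (by omega)
  refine ⟨1 / (256 * d ^ 2), by positivity, ?_⟩
  filter_upwards [eventually_ge_atTop (2 * d * (224 * d)), eventually_ge_atTop (2 * d)] with Q hQ hQ2
  refine le_trans ?_ (key Q hQ2)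
  set R := Q / (2 * d) with hR
  have h1 : 224 * d ≤ R := by
    rw [hR, Nat.le_div_iff_mul_le (by omega)]; linarith
  have h2 : Q ≤ 4 * d * R := by
    have a := Nat.div_add_mod Q (2 * d)
    have b := Nat.mod_lt Q (show 0 < 2 * d by omega)
    rw [← hR] at a
    nlinarith
  have h1' : 224 * (d : ℝ) ≤ R := by exact_mod_cast h1
  have h2' : (Q : ℝ) ≤ 4 * d * R := by exact_mod_cast h2
  have h3 : 1 / (256 * (d : ℝ) ^ 2) * (Q : ℝ) ^ 2 ≤ 1 / (256 * (d : ℝ) ^ 2) * (4 * d * R) ^ 2 := by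
    gcongr
  have h4 : 1 / (256 * (d : ℝ) ^ 2) * (4 * d * R) ^ 2 = (R : ℝ) ^ 2 / 16 := by
    field_simp; ring
  rw [h4] at h3
  have h5 : (0 : ℝ) ≤ R := Nat.cast_nonneg _
  nlinarith

/-- The determinant of two fractions. -/
def ratDet (x y : ℚ) : ℤ := x.den * y.num - x.num * y.den

lemma ratDet_eq (x y : ℚ) : y - x = ratDet x y / (x.den * y.den) := by
  have hx : (x.den : ℚ) ≠ 0 := by exact_mod_cast x.den_nz
  have hy : (y.den : ℚ) ≠ 0 := by exact_mod_cast y.den_nz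
  conv_lhs => rw [← Rat.num_div_den x, ← Rat.num_div_den y]
  rw [ratDet]
  push_cast
  field_simp

lemma ratDet_pos {x y : ℚ} (h : x < y) : 0 < ratDet x y := by
  rw [Rat.lt_iff] at h
  rw [ratDet]; linarith

lemma eq_of_den_eq_of_ratDet_eq {x y x' y' : ℚ} (h0 : x.den = x'.den) (h1 : y.den = y'.den)
    (hpos : 0 < ratDet x y) (hdet : ratDet x y = ratDet x' y')
    (hfl : ⌊(ratDet x y : ℚ) * x⌋ = ⌊(ratDet x y : ℚ) * x'⌋) : x = x' := by
  have hx : (0 : ℚ) < x.den := by exact_mod_cast x.pos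
  set D := ratDet x y with hD
  have e1 : (x.den : ℤ) * y.num - x.num * y.den = D := rfl
  have e2 : (x.den : ℤ) * y'.num - x'.num * y.den = D := by
    rw [hdet, ratDet, h0, h1]
  have hdvd : (x.den : ℤ) ∣ (x.num - x'.num) * D := by
    refine ⟨(x.num - x'.num) * y.num - x.num * (y.num - y'.num), ?_⟩
    linear_combination (-x.num) * (e2 - e1) - (x.num - x'.num) * e1
  have habs : |(x.num - x'.num) * D| < (x.den : ℤ) := by
    have h := Int.abs_sub_lt_one_of_floor_eq_floor hfl
    have e : (D : ℚ) * x - D * x' = ((x.num - x'.num) * D : ℤ) / x.den := by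
      conv_lhs => rw [← Rat.num_div_den x, ← Rat.num_div_den x', ← h0]
      push_cast
      field_simp
    rw [e, abs_div, abs_of_pos hx, div_lt_one hx] at h
    exact_mod_cast h
  have h3 := Int.eq_zero_of_abs_lt_dvd hdvd habs
  rcases mul_eq_zero.1 h3 with h3 | h3
  · exact Rat.ext (by linarith) h0
  · omega

lemma card_good_le {d c s : ℕ} (hs : 1 ≤ s) {Q N : ℕ} (B : ℕ) (f : ℕ → ℚ)
    (hf : ∀ i, i < N → f i ∈ FareyFracCD Q c d) (hmono : ∀ i j, i < j → j < N → f i < f j)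
    (hcons : ∀ i, i + s < N → FareyCDConsecTuple Q c d s fun j => f (i + j)) :
    (N : ℝ) ≤ s + (B + 1) ^ 2 * Nat.card (DsQ Q c d s) + (Q : ℝ) ^ 2 / (B + 1) := by
  classical
  have hfin : (DsQ Q c d s).Finite := by
    refine (Set.Finite.pi' fun _ : Fin (s + 1) => Set.finite_Iic Q).subset ?_
    rintro q ⟨g, hg, hq⟩ i
    rw [Set.mem_Iic, hq]
    exact (hg.1 i).2.2.1
  rcases Nat.eq_zero_or_pos (N - s) with hNs | hNs
  · have : (N : ℝ) ≤ s := by exact_mod_cast (by omega)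
    have h2 : 0 ≤ ((B : ℝ) + 1) ^ 2 * Nat.card (DsQ Q c d s) := by positivity
    have h3 : 0 ≤ (Q : ℝ) ^ 2 / (B + 1) := by positivity
    linarith
  have hQ : 0 < Q := by
    have h := (hf 0 (by omega)).2.2.1
    have := (f 0).pos
    omega
  have hQ' : (0 : ℝ) < Q := by exact_mod_cast hQ
  have hlt : ∀ i, i < N - s → f i < f (i + 1) := fun i hi => hmono _ _ (by omega) (by omega)
  set good := (Finset.range (N - s)).filter fun i => ratDet (f i) (f (i + 1)) ≤ B with hgood
  set bad := (Finset.range (N - s)).filter fun i => ¬ ratDet (f i) (f (i + 1)) ≤ B with hbad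
  have hcard : good.card + bad.card = N - s := by
    rw [hgood, hbad, Finset.card_filter_add_card_filter_not, Finset.card_range]
  have hbound : (bad.card : ℝ) ≤ (Q : ℝ) ^ 2 / (B + 1) := by
    have h1 : ∑ i ∈ Finset.range (N - s), (f (i + 1) - f i) ≤ 1 := by
      rw [Finset.sum_range_sub]
      have a := (hf (N - s) (by omega)).2.1
      have b := (hf 0 (by omega)).1
      linarith
    have h2 : ∑ _i ∈ bad, ((B : ℚ) + 1) / (Q : ℚ) ^ 2 ≤
        ∑ i ∈ Finset.range (N - s), (f (i + 1) - f i) := by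
      refine (Finset.sum_le_sum fun i hi => ?_).trans (Finset.sum_le_sum_of_subset_of_nonneg
        (Finset.filter_subset _ _) fun i hi _ => sub_nonneg.2 (hlt i (Finset.mem_range.1 hi)).le)
      obtain ⟨hi1, hi2⟩ := Finset.mem_filter.1 hi
      rw [Finset.mem_range] at hi1
      rw [ratDet_eq]
      have a : ((B : ℚ) + 1) ≤ ratDet (f i) (f (i + 1)) := by
        exact_mod_cast (show (B : ℤ) + 1 ≤ _ by omega)
      have q0 : ((f i).den : ℚ) ≤ Q := by exact_mod_cast (hf i (by omega)).2.2.1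
      have q1 : ((f (i + 1)).den : ℚ) ≤ Q := by exact_mod_cast (hf (i + 1) (by omega)).2.2.1
      have p0 : (0 : ℚ) < (f i).den := by exact_mod_cast (f i).pos
      have p1 : (0 : ℚ) < (f (i + 1)).den := by exact_mod_cast (f (i + 1)).pos
      have : ((f i).den : ℚ) * (f (i + 1)).den ≤ (Q : ℚ) ^ 2 := by
        rw [sq]; exact mul_le_mul q0 q1 p1.le (p0.le.trans q0)
      have a0 : (0 : ℚ) ≤ ratDet (f i) (f (i + 1)) := le_trans (by positivity) a
      gcongr
    have h3 := h2.trans h1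
    rw [Finset.sum_const, nsmul_eq_mul] at h3
    have h4 := (Rat.cast_le (K := ℝ)).2 h3
    push_cast at h4
    rw [le_div_iff₀ (by positivity)]
    rw [← mul_div_assoc, div_le_one (by positivity)] at h4
    exact h4
  have hgoodle : good.card ≤ (B + 1) ^ 2 * Nat.card (DsQ Q c d s) := by
    set T : Finset ((Fin (s + 1) → ℕ) × ℤ × ℤ) :=
      hfin.toFinset ×ˢ (Finset.Icc 0 (B : ℤ) ×ˢ Finset.Icc 0 (B : ℤ)) with hT
    have hTc : T.card = (B + 1) ^ 2 * Nat.card (DsQ Q c d s) := by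
      rw [hT, Finset.card_product, Finset.card_product, Int.card_Icc,
        ← Set.ncard_eq_toFinset_card _ hfin, Nat.card_coe_set_eq]
      have : ((B : ℤ) + 1 - 0).toNat = B + 1 := by omega
      rw [this]; ring
    rw [← hTc]
    refine Finset.card_le_card_of_injOn (fun i => (fun j : Fin (s + 1) => (f (i + j)).den,
      ratDet (f i) (f (i + 1)), ⌊(ratDet (f i) (f (i + 1)) : ℚ) * f i⌋)) (fun i hi => ?_) ?_
    · obtain ⟨hi1, hi2⟩ := Finset.mem_filter.1 hi
      rw [Finset.mem_range] at hi1
      have hp := ratDet_pos (hlt i hi1)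
      have h0 := (hf i (by omega)).1
      have h1 := (hf i (by omega)).2.1
      simp only [hT, Finset.coe_product, Set.mem_prod, Finset.mem_coe, Set.Finite.mem_toFinset,
        Finset.mem_Icc]
      refine ⟨⟨_, hcons i (by omega), fun j => rfl⟩, ⟨hp.le, hi2⟩, Int.floor_nonneg.2 ?_, ?_⟩
      · have : (0 : ℚ) < ratDet (f i) (f (i + 1)) := by exact_mod_cast hp
        positivity
      · refine le_trans ?_ hi2
        have a : (0 : ℚ) < ratDet (f i) (f (i + 1)) := by exact_mod_cast hp
        rw [Int.floor_le_iff]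
        nlinarith
    · intro i hi j hj hij
      obtain ⟨hi1, hi2⟩ := Finset.mem_filter.1 hi
      obtain ⟨hj1, hj2⟩ := Finset.mem_filter.1 hj
      rw [Finset.mem_range] at hi1 hj1
      simp only [Prod.mk.injEq] at hij
      have : NeZero s := ⟨by omega⟩
      have hone : ((1 : Fin (s + 1)) : ℕ) = 1 := by
        rw [Fin.val_one', Nat.mod_eq_of_lt (by omega)]
      have d0 := congrFun hij.1 0
      have d1 := congrFun hij.1 1
      simp only [Fin.val_zero, add_zero, hone] at d0 d1
      have := eq_of_den_eq_of_ratDet_eq d0 d1 (ratDet_pos (hlt i hi1)) hij.2.1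
        (by rw [hij.2.2, hij.2.1])
      by_contra hne
      rcases lt_or_gt_of_ne hne with h | h
      · exact (hmono _ _ h (by omega)).ne this
      · exact (hmono _ _ h (by omega)).ne this.symm
  have h5 : (N : ℝ) ≤ s + good.card + bad.card := by exact_mod_cast (by omega)
  have h6 : (good.card : ℝ) ≤ (B + 1) ^ 2 * Nat.card (DsQ Q c d s) := by exact_mod_cast hgoodle
  linarith

lemma eventually_card_dsQ_ge {d : ℕ} (hd : 2 ≤ d) {c : ℕ} (hc : c < d) {s : ℕ} (hs : 1 ≤ s) :
    ∃ κ : ℝ, 0 < κ ∧ ∀ᶠ Q : ℕ in atTop, κ * (Q : ℝ) ^ 2 ≤ Nat.card (DsQ Q c d s) := by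
  classical
  obtain ⟨κ, hκ, hev⟩ := eventually_card_fareyFracCD_ge hd hc
  have key : ∀ Q B : ℕ, ((FareyFracCD Q c d).ncard : ℝ) ≤
      s + (B + 1) ^ 2 * Nat.card (DsQ Q c d s) + (Q : ℝ) ^ 2 / (B + 1) := by
    intro Q B
    set F := (finite_fareyFracCD Q c d).toFinset with hF
    set N := (FareyFracCD Q c d).ncard with hN
    have hcard : F.card = N := by rw [hN, Set.ncard_eq_toFinset_card _ (finite_fareyFracCD Q c d)]
    set e := F.orderEmbOfFin hcard with he
    have hmem : ∀ x, x ∈ FareyFracCD Q c d ↔ ∃ i, e i = x := by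
      intro x
      rw [← Set.mem_range, he, Finset.range_orderEmbOfFin, hF]
      simp
    set f : ℕ → ℚ := fun i => if h : i < N then e ⟨i, h⟩ else 0 with hf
    have hfe : ∀ i (h : i < N), f i = e ⟨i, h⟩ := fun i h => dif_pos h
    have hfm : ∀ i, i < N → f i ∈ FareyFracCD Q c d := fun i h => by
      rw [hfe i h, hmem]; exact ⟨_, rfl⟩
    have hmono : ∀ i j, i < j → j < N → f i < f j := fun i j hij hj => by
      rw [hfe i (by omega), hfe j hj]
      exact e.strictMono hij
    refine card_good_le hs B f hfm hmono fun i hi => ⟨fun j => hfm _ (by omega), fun j => ?_⟩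
    simp only [Fin.val_castSucc, Fin.val_succ]
    refine ⟨hmono _ _ (by omega) (by omega), fun x hx => ?_⟩
    obtain ⟨m, rfl⟩ := (hmem x).1 hx
    rw [hfe (i + j) (by omega), hfe (i + (j + 1)) (by omega), e.lt_iff_lt, e.lt_iff_lt]
    rintro ⟨h1, h2⟩
    simp only [Fin.lt_def] at h1 h2
    omega
  obtain ⟨B, hB⟩ := exists_nat_gt (4 / κ)
  refine ⟨κ / 2 / (B + 1) ^ 2, by positivity, ?_⟩
  filter_upwards [hev, eventually_linear_le_sq (show 0 < κ / 4 by positivity) s] with Q h1 h2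
  have h3 := key Q B
  have h4 : (Q : ℝ) ^ 2 / (B + 1) ≤ κ / 4 * (Q : ℝ) ^ 2 := by
    rw [div_lt_iff₀ hκ] at hB
    rw [div_le_iff₀ (by positivity)]
    nlinarith [sq_nonneg (Q : ℝ)]
  have h5 : (s : ℝ) ≤ s * ((Q : ℝ) + 1) := by nlinarith [Nat.cast_nonneg (α := ℝ) s, Nat.cast_nonneg (α := ℝ) Q]
  rw [div_mul_eq_mul_div, div_le_iff₀ (by positivity)]
  linarith

lemma exists_dt_limit {d : ℕ} (hd : 2 ≤ d) (c : ℕ) {s : ℕ} (hs : 1 ≤ s)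
    {𝓑 : Set (Fin (s + 1) → ℝ)} (h𝓑 : Convex ℝ 𝓑) : ∃ l, Tendsto (fun Q : ℕ =>
      ({q ∈ Dt d c s Q | (fun i => (q i : ℝ) / Q) ∈ 𝓑}.ncard : ℝ) / (Q : ℝ) ^ 2) atTop (nhds l) := by
  classical
  refine exists_tendsto_of_approx _ fun ε hε => ?_
  obtain ⟨K, hK⟩ := exists_nat_gt (s / ε + 1)
  have hK1 : (1 : ℝ) < K := lt_of_le_of_lt (by simp; positivity) hK
  have hK0 : 0 < K := by exact_mod_cast (zero_lt_one.trans hK1)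
  obtain ⟨B, hB⟩ := exists_dt_subset hd c s (K := K) (by exact_mod_cast hK0)
  obtain ⟨N, k, θ, -, -, h⟩ := exists_dtBdd_limit (d := d) (by omega) c hs B
  refine ⟨_, _, h 𝓑 h𝓑, ?_⟩
  filter_upwards [eventually_ge_atTop K] with Q hQ
  have hQ0 : (0 : ℝ) < Q := by exact_mod_cast (hK0.trans_le hQ)
  have hsub := hB Q (by exact_mod_cast hQ)
  have f1 : {q ∈ Dt d c s Q | (fun i => (q i : ℝ) / Q) ∈ 𝓑}.Finite :=
    (finite_Dt d c s Q).subset fun q h => h.1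
  have f2 : {q ∈ DtBdd d c s B Q | (fun i => (q i : ℝ) / Q) ∈ 𝓑}.Finite :=
    (finite_Dt d c s Q).subset fun q h => dtBdd_subset d c s B Q h.1
  have f3 : (DtCusp d c s K Q).Finite := (finite_Dt d c s Q).subset (dtCusp_subset d c s K Q)
  have h1 := abs_ncard_sub_ncard_le f1 f2 f3
    (fun q hq => (hsub hq.1.1).resolve_left fun hh => hq.2 ⟨hh, hq.1.2⟩)
    (fun q hq => absurd ⟨dtBdd_subset d c s B Q hq.1.1, hq.1.2⟩ hq.2)
  have h2 := ncard_dtCusp_le d c hs K hK0 Q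
  rw [← sub_div, abs_div, abs_of_pos (show (0 : ℝ) < (Q : ℝ) ^ 2 by positivity),
    div_le_iff₀ (by positivity)]
  refine (h1.trans h2).trans ?_
  have h3 : (s : ℝ) ≤ ε * (K : ℝ) ^ 2 := by
    have h4 : (s : ℝ) / ε ≤ K := by linarith
    rw [div_le_iff₀ hε] at h4
    nlinarith
  rw [div_pow, ← mul_div_assoc, div_le_iff₀ (by positivity)]
  nlinarith [sq_nonneg (Q : ℝ)]

/-- The proportion of tuples in a convex set converges. -/
lemma exists_dsQ_limit {d : ℕ} (hd : 2 ≤ d) {c : ℕ} (hc : c < d) {s : ℕ} (hs : 1 ≤ s) :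
    ∃ τ : ℝ, 0 < τ ∧ ∀ 𝓑 : Set (Fin (s + 1) → ℝ), ∀ l : ℝ, Tendsto (fun Q : ℕ =>
      ({q ∈ Dt d c s Q | (fun i => (q i : ℝ) / Q) ∈ 𝓑}.ncard : ℝ) / (Q : ℝ) ^ 2) atTop (nhds l) →
      Tendsto (fun Q : ℕ => (Nat.card {q ∈ DsQ Q c d s | (fun i => (q i : ℝ) / Q) ∈ 𝓑} : ℝ) /
        (Nat.card (DsQ Q c d s) : ℝ)) atTop (nhds (l / τ)) := by
  have trans : ∀ (𝓑 : Set (Fin (s + 1) → ℝ)) (l : ℝ), Tendsto (fun Q : ℕ =>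
      ({q ∈ Dt d c s Q | (fun i => (q i : ℝ) / Q) ∈ 𝓑}.ncard : ℝ) / (Q : ℝ) ^ 2) atTop (nhds l) →
      Tendsto (fun Q : ℕ => (Nat.card {q ∈ DsQ Q c d s | (fun i => (q i : ℝ) / Q) ∈ 𝓑} : ℝ) /
        (Q : ℝ) ^ 2) atTop (nhds l) := by
    intro 𝓑 l h
    rw [← tendsto_sub_nhds_zero_iff] at h ⊢
    have h0 : Tendsto (fun Q : ℕ => (s : ℝ) / (Q : ℝ) ^ 2) atTop (nhds 0) :=
      (tendsto_pow_atTop two_ne_zero).comp tendsto_natCast_atTop_atTop |>.const_div_atTop _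
    have h3 : Tendsto (fun Q : ℕ =>
        (Nat.card {q ∈ DsQ Q c d s | (fun i => (q i : ℝ) / Q) ∈ 𝓑} : ℝ) / (Q : ℝ) ^ 2 -
        ({q ∈ Dt d c s Q | (fun i => (q i : ℝ) / Q) ∈ 𝓑}.ncard : ℝ) / (Q : ℝ) ^ 2) atTop
        (nhds 0) := by
      refine squeeze_zero_norm (fun Q => ?_) h0
      rw [← sub_div, Real.norm_eq_abs, abs_div, abs_of_nonneg (sq_nonneg (Q : ℝ))]
      have := card_dsQ_near (s := s) (Q := Q) hc fun q => (fun i => (q i : ℝ) / Q) ∈ 𝓑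
      simp only [Int.cast_natCast] at this
      gcongr
    have := h.add h3
    simpa using this
  obtain ⟨τ, hτ⟩ := exists_dt_limit hd c hs (convex_univ (𝕜 := ℝ) (E := Fin (s + 1) → ℝ))
  have hτ' := trans _ _ hτ
  simp only [Set.mem_univ, and_true] at hτ'
  obtain ⟨κ, hκ, hev⟩ := eventually_card_dsQ_ge hd hc hs
  have hτ0 : κ ≤ τ := by
    refine ge_of_tendsto hτ' ?_
    filter_upwards [hev, eventually_gt_atTop 0] with Q h1 hQ
    have : (0 : ℝ) < Q := by exact_mod_cast hQ
    rw [le_div_iff₀ (by positivity)]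
    exact h1
  refine ⟨τ, hκ.trans_le hτ0, fun 𝓑 l h => ?_⟩
  refine ((trans 𝓑 l h).div hτ' (hκ.trans_le hτ0).ne').congr' ?_
  filter_upwards [eventually_gt_atTop 0] with Q hQ
  have : (0 : ℝ) < Q := by exact_mod_cast hQ
  exact div_div_div_cancel_right₀ (by positivity) _ _

/-- Reflection in the second axis. -/
def refl1 (w : ℤ × ℤ) : ℤ × ℤ := (-w.1, w.2)

lemma ev_refl1 (W z : ℤ × ℤ) : ev (refl1 W) (refl1 z) = ev W z := by simp [ev, refl1]

lemma dt_refl1 (V W : ℤ × ℤ) : dt (refl1 V) (refl1 W) = dt W V := by simp only [dt, refl1]; ring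

lemma refl1_refl1 (W : ℤ × ℤ) : refl1 (refl1 W) = W := by simp [refl1]

lemma isCoprime_refl1 (W : ℤ × ℤ) : IsCoprime (refl1 W).1 (refl1 W).2 ↔ IsCoprime W.1 W.2 := by
  simp [refl1, IsCoprime.neg_left_iff]

lemma cls_refl1 {d c : ℕ} {Q : ℤ} {z W : ℤ × ℤ} :
    Cls d c Q (refl1 z) (refl1 W) ↔ Cls d c Q z W := by
  rw [Cls, Cls, isCoprime_refl1, ev_refl1]

lemma Cons.refl1 {d c s : ℕ} {Q : ℤ} {z : ℤ × ℤ} {V : Fin (s + 1) → ℤ × ℤ} (h : Cons d c Q z V) :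
    Cons d c Q (refl1 z) fun i => refl1 (V i.rev) := by
  refine ⟨fun i => cls_refl1.2 (h.1 _), fun i => ?_⟩
  beta_reduce
  rw [Fin.rev_castSucc, Fin.rev_succ, dt_refl1]
  refine ⟨(h.2 _).1, fun W hW hb => (h.2 i.rev).2 (_root_.refl1 W) ?_ ?_⟩
  · rw [← cls_refl1, refl1_refl1]; exact hW
  · have e1 : ∀ U, dt U (_root_.refl1 W) = dt W (_root_.refl1 U) := fun U => by
      rw [← dt_refl1, refl1_refl1]
    have e2 : ∀ U, dt (_root_.refl1 W) U = dt (_root_.refl1 U) W := fun U => by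
      rw [← dt_refl1, refl1_refl1]
    rw [e1, e2]
    exact ⟨hb.2, hb.1⟩

lemma ev_eq_dt (z V W : ℤ × ℤ) : W.1 * ev V z = V.1 * ev W z + dt W V * z.2 := by
  simp only [ev, dt]; ring

lemma isCoprime_shear {W : ℤ × ℤ} (h : IsCoprime W.1 W.2) (k : ℤ) :
    IsCoprime W.1 (W.2 + W.1 * k) := by
  obtain ⟨a, b, hab⟩ := h
  exact ⟨a - b * k, b, by linear_combination hab⟩

lemma ev_shear (W z : ℤ × ℤ) (t : ℤ) : ev (W.1, W.2 + t) z = ev W z + t * z.2 := by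
  simp only [ev]; ring

lemma dvd_ev_shear {d c : ℕ} {W z : ℤ × ℤ} (h : (d : ℤ) ∣ ev W z - c) (k : ℤ) :
    (d : ℤ) ∣ ev (W.1, W.2 + W.1 * (d * k)) z - c := by
  obtain ⟨m, hm⟩ := h
  rw [ev_shear]
  exact ⟨m + W.1 * k * z.2, by linear_combination hm⟩

/-- Among the shears of a vector of the class one has its value just below `Q`. -/
lemma exists_shear {d c : ℕ} (hd : 0 < d) {W z : ℤ × ℤ} (hW : IsCoprime W.1 W.2) (h1 : 1 ≤ W.1)
    (h : (d : ℤ) ∣ ev W z - c) (hz : 0 < z.2) (Q : ℤ) : ∃ W' : ℤ × ℤ, W'.1 = W.1 ∧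
      IsCoprime W'.1 W'.2 ∧ (d : ℤ) ∣ ev W' z - c ∧ ev W' z ≤ Q ∧ Q - d * W.1 * z.2 < ev W' z ∧
      ∀ t, ev (W.1, W.2 + W.1 * (d * t)) z ≤ Q → W.2 + W.1 * (d * t) ≤ W'.2 := by
  have hp : 0 < d * W.1 * z.2 := by positivity
  set P := d * W.1 * z.2 with hP
  have e1 := Int.emod_nonneg (Q - ev W z) hp.ne'
  have e2 := Int.emod_lt_of_pos (Q - ev W z) hp
  have e3 := Int.mul_ediv_add_emod (Q - ev W z) P
  set k := (Q - ev W z) / P with hk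
  have e4 : ev (W.1, W.2 + W.1 * (d * k)) z = ev W z + P * k := by rw [ev_shear, hP]; ring
  refine ⟨(W.1, W.2 + W.1 * (d * k)), rfl, isCoprime_shear hW _, dvd_ev_shear h k, ?_, ?_,
    fun t ht => ?_⟩
  · rw [e4]; linarith
  · rw [e4]; linarith
  · have e5 : ev (W.1, W.2 + W.1 * (d * t)) z = ev W z + P * t := by rw [ev_shear, hP]; ring
    rw [e5] at ht
    have : t ≤ k := by rw [hk, Int.le_ediv_iff_mul_le hp]; linarith
    have hd' : (0 : ℤ) ≤ d := by positivity
    have hW1 : 0 ≤ W.1 := by linarith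
    show _ ≤ W.2 + W.1 * (d * k)
    gcongr

set_option maxHeartbeats 1000000 in
lemma left_of_cusp {d c : ℕ} (hd : 2 ≤ d) (s : ℕ) {A Q : ℤ}
    (hA : ∀ z : ℤ × ℤ, IsCoprime z.1 z.2 → ∃ W : ℤ × ℤ, IsCoprime W.1 W.2 ∧ 1 ≤ W.1 ∧ W.1 ≤ A ∧
      (d : ℤ) ∣ ev W z - c) {z : ℤ × ℤ} {V : Fin (s + 1) → ℤ × ℤ} (hz : IsCoprime z.1 z.2)
    (hV : Cons d c Q z V) (hn : 0 < z.2) (hQ : (A + 1) * ((s + 1) * d * A) * z.2 < Q)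
    (hlast : (V (Fin.last s)).1 ≤ 0) :
    ∃ a, 1 ≤ a ∧ a ≤ A ∧ ∀ i, 0 < (V i).1 →
      (V i).1 = a ∧ Q - (s + 1) * d * A * z.2 ≤ ev (V i) z := by
  classical
  have hex : ∃ x : ℕ, 1 ≤ x ∧ ∃ W : ℤ × ℤ, IsCoprime W.1 W.2 ∧ W.1 = x ∧
      (d : ℤ) ∣ ev W z - c := by
    obtain ⟨W, h1, h2, h3, h4⟩ := hA z hz
    exact ⟨W.1.toNat, by omega, W, h1, by omega, h4⟩
  obtain ⟨ha1, W0, hW0, hWa, hWd⟩ := Nat.find_spec hex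
  have hmin : ∀ W : ℤ × ℤ, IsCoprime W.1 W.2 → 0 < W.1 → (d : ℤ) ∣ ev W z - c →
      (Nat.find hex : ℤ) ≤ W.1 := by
    intro W h1 h2 h3
    have := Nat.find_min' hex (m := W.1.toNat) ⟨by omega, W, h1, by omega, h3⟩
    omega
  set a : ℤ := (Nat.find hex : ℤ) with haa
  have ha1' : 1 ≤ a := by omega
  have haA : a ≤ A := by
    obtain ⟨W, h1, h2, h3, h4⟩ := hA z hz
    exact (hmin W h1 (by omega) h4).trans h3
  have hd' : (2 : ℤ) ≤ d := by exact_mod_cast hd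
  set m : ℤ := d * A * z.2 with hm
  have hA1 : 1 ≤ A := ha1'.trans haA
  have hm0 : 0 < m := by positivity
  have hdm : d * a * z.2 ≤ m := by rw [hm]; gcongr
  have hQm : (A + 1) * ((s + 1) * m) < Q := by
    refine lt_of_eq_of_lt ?_ hQ
    rw [hm]; ring
  have hsm : 0 ≤ (s + 1) * m := by positivity
  have hSQ : (s + 1) * m < Q := by
    have := mul_le_mul_of_nonneg_right (show 1 ≤ A + 1 by omega) hsm
    linarith
  have hmQ : m < Q := by
    have : 0 ≤ (s : ℤ) * m := by positivity
    linarith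
  have key : ∀ (k : ℕ) (U W : ℤ × ℤ), k ≤ s + 1 → Cls d c Q z U → 0 < U.1 → W.1 = a →
      Q - k * m ≤ ev W z → 0 ≤ dt W U → U.1 = a ∧ ev W z ≤ ev U z := by
    intro k U W hk hU hU1 hWa' hWev hdt
    have h1 := ev_eq_dt z U W
    rw [hWa'] at h1
    have h2 : 0 ≤ dt W U * z.2 := by positivity
    have h3 := hmin U hU.1 hU1 hU.2.2.2
    have hk' : (k : ℤ) * m ≤ (s + 1) * m := by
      have : (k : ℤ) ≤ s + 1 := by exact_mod_cast hk
      gcongr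
    have h4 : U.1 = a := by
      by_contra hne
      have h5 : a + 1 ≤ U.1 := by omega
      have h7 : 0 < Q - (s + 1) * m := by linarith
      have h6 : (a + 1) * (Q - (s + 1) * m) ≤ U.1 * ev W z := by
        gcongr
        linarith
      have h8 : a * ev U z ≤ a * Q := by have := hU.2.2.1; gcongr
      have h9 : (a + 1) * ((s + 1) * m) ≤ (A + 1) * ((s + 1) * m) := by gcongr
      nlinarith
    refine ⟨h4, ?_⟩
    rw [h4] at h1
    have : a * ev W z ≤ a * ev U z := by linarith
    exact le_of_mul_le_mul_left this (by omega)
  have ind : ∀ (k : ℕ) (i : Fin (s + 1)), i.1 + k = s → 0 < (V i).1 →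
      ∃ W : ℤ × ℤ, W.1 = a ∧ Q - (k + 1 : ℕ) * m ≤ ev W z ∧ 0 ≤ dt W (V i) := by
    have main : ∀ (j : Fin s), 0 < (V j.castSucc).1 → (V j.succ).1 ≤ 0 →
        ∃ W : ℤ × ℤ, W.1 = a ∧ Q - m ≤ ev W z ∧ 0 ≤ dt W (V j.castSucc) := by
      intro j h1 h2
      obtain ⟨W, hW1, hWc, hWd', hWQ, hWQ', -⟩ :=
        exists_shear (by omega : 0 < d) hW0 (by omega) hWd hn Q
      have hWa' : W.1 = a := hW1.trans hWa
      rw [hWa] at hWQ'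
      have hQ' : Q - m ≤ ev W z := by linarith
      refine ⟨W, hWa', hQ', ?_⟩
      by_contra hcon
      have hlt : 0 < dt (V j.castSucc) W := by rw [dt_swap]; omega
      refine (hV.2 j).2 W ⟨hWc, by linarith, hWQ, hWd'⟩ ⟨hlt, ?_⟩
      have h3 := ev_eq_dt z (V j.succ) W
      rw [hWa'] at h3
      have h4 := hV.pos j.succ
      have h5 : 0 < dt W (V j.succ) * z.2 := by
        have : (V j.succ).1 * ev W z ≤ 0 := mul_nonpos_of_nonpos_of_nonneg h2 (by linarith)
        nlinarith
      exact pos_of_mul_pos_left h5 hn.le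
    intro k
    induction k with
    | zero =>
      intro i hi h
      have : i = Fin.last s := Fin.ext (by simpa using hi)
      rw [this] at h; omega
    | succ k ih =>
      intro i hi h
      obtain ⟨j, rfl⟩ : ∃ j : Fin s, j.castSucc = i := ⟨⟨i.1, by omega⟩, rfl⟩
      by_cases h' : 0 < (V j.succ).1
      · obtain ⟨W, h1, h2, h3⟩ := ih j.succ (by simp at hi ⊢; omega) h'
        obtain ⟨h4, h5⟩ := key (k + 1) _ W (by omega) (hV.1 _) h' h1 h2 h3
        set U := V j.succ with hU
        have hcls := hV.1 j.succ
        rw [← hU] at hcls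
        have e : ev (U.1, U.2 + U.1 * (d * (-1))) z = ev U z - d * a * z.2 := by
          rw [ev_shear, h4]; ring
        have hkm : ((k + 1 : ℕ) : ℤ) * m + m ≤ (s + 1) * m := by
          have : ((k + 1 : ℕ) : ℤ) + 1 ≤ s + 1 := by exact_mod_cast (by omega)
          nlinarith
        have hpos : 0 < ev (U.1, U.2 + U.1 * (d * (-1))) z := by
          rw [e]; linarith
        refine ⟨(U.1, U.2 + U.1 * (d * (-1))), h4, ?_, ?_⟩
        · rw [e]; push_cast at h2 ⊢; linarith
        · by_contra hcon
          refine (hV.2 j).2 (U.1, U.2 + U.1 * (d * (-1))) ⟨isCoprime_shear hcls.1 _, hpos,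
            by rw [e]; have := hcls.2.2.1; have : 0 < d * a * z.2 := by positivity
               linarith, dvd_ev_shear hcls.2.2.2 _⟩ ⟨?_, ?_⟩
          · rw [dt_swap]; omega
          · rw [← hU]
            simp only [dt]
            have : 0 < U.1 * (U.1 * d) := by rw [h4]; positivity
            linarith
      · obtain ⟨W, h1, h2, h3⟩ := main j h (by omega)
        refine ⟨W, h1, h2.trans' ?_, h3⟩
        push_cast; nlinarith
  refine ⟨a, ha1', haA, fun i hi => ?_⟩
  obtain ⟨W, h1, h2, h3⟩ := ind (s - i.1) i (by omega) hi
  obtain ⟨h4, h5⟩ := key _ _ W (by omega) (hV.1 i) hi h1 h2 h3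
  refine ⟨h4, h5.trans' (h2.trans' ?_)⟩
  have : ((s - i.1 + 1 : ℕ) : ℤ) ≤ s + 1 := by exact_mod_cast (by omega)
  rw [hm]
  have := mul_le_mul_of_nonneg_right this hm0.le
  rw [hm] at this
  linarith

/-- The vectors around a vector of small value. -/
lemma exists_cusp_structure {d : ℕ} (hd : 2 ≤ d) (c s : ℕ) : ∃ A M : ℤ, 0 < A ∧ 0 < M ∧
    ∀ (Q : ℤ) (z : ℤ × ℤ) (V : Fin (s + 1) → ℤ × ℤ) (w : ℤ × ℤ), IsCoprime z.1 z.2 →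
      Cons d c Q z V → ∀ K, M ≤ K → Straddle K Q z V w →
      ∃ z' g, IsGauge g z z' ∧ g w = (0, 1) ∧ 0 < z'.2 ∧ z'.2 = ev w z ∧
        ∃ a b, 1 ≤ a ∧ a ≤ A ∧ 1 ≤ b ∧ b ≤ A ∧ ∀ i,
          ((g (V i)).1 = a ∧ Q - M * z'.2 ≤ ev (V i) z ∧ 0 < dt (V i) w) ∨
          ((g (V i)).1 = -b ∧ Q - M * z'.2 ≤ ev (V i) z ∧ dt (V i) w < 0) ∨
          (g (V i) = (0, 1) ∧ V i = w) := by
  obtain ⟨A, hA0, hA⟩ := exists_class_bound hd c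
  have hd' : (0 : ℤ) < d := by exact_mod_cast (by omega)
  refine ⟨A, (A + 1) * ((s + 1) * d * A) + 1, hA0, by positivity, ?_⟩
  intro Q z V w hz hV K hK ⟨hwc, hw0, hwK, hs0, hs1⟩
  obtain ⟨g, z', hg, hgw, -, hz'lt, hz'⟩ := exists_gauge_center hwc hw0
  have hn : 0 < z'.2 := by rw [hz']; exact hw0
  have hV' := hg.cons hV
  have hzc := hg.cop_pt.2 hz
  have hMQ : (A + 1) * ((s + 1) * d * A) * z'.2 < Q := by
    rw [← hz'] at hwK
    have : ((A + 1) * ((s + 1) * d * A) + 1) * z'.2 ≤ K * z'.2 := by gcongr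
    linarith
  have hMM : (s + 1) * d * A * z'.2 ≤ ((A + 1) * ((s + 1) * d * A) + 1) * z'.2 := by
    have : 0 ≤ (s + 1) * d * A * z'.2 := by positivity
    nlinarith
  have hdt : ∀ v, dt v w = (g v).1 := by
    intro v
    rw [← hg.dt_eq, hgw]; simp [dt]
  have hlast : (g (V (Fin.last s))).1 < 0 := by
    rw [← hdt, dt_swap]; omega
  have hfirst : 0 < (g (V 0)).1 := by rw [← hdt]; exact hs0
  obtain ⟨a, ha1, haA, ha⟩ := left_of_cusp hd s hA hzc hV' hn hMQ hlast.le
  obtain ⟨b, hb1, hbA, hb⟩ := left_of_cusp hd s hA ((isCoprime_refl1 z').2 hzc) hV'.refl1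
    (by simpa [refl1] using hn) (by simpa [refl1] using hMQ) (by simp [refl1]; exact hfirst.le)
  refine ⟨z', g, hg, hgw, hn, hz', a, b, ha1, haA, hb1, hbA, fun i => ?_⟩
  rw [hdt]
  rcases lt_trichotomy (g (V i)).1 0 with h | h | h
  · refine Or.inr (Or.inl ?_)
    obtain ⟨h1, h2⟩ := hb i.rev (by simpa [refl1] using h)
    rw [ev_refl1, Fin.rev_rev, hg.ev_eq] at h2
    simp only [refl1, Fin.rev_rev] at h1 h2
    exact ⟨by omega, by linarith, h⟩
  · refine Or.inr (Or.inr ?_)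
    have : V i = w := eq_of_dt_eq_zero (hV.1 i).1 hwc (hV.pos i) hw0 (by rw [hdt]; exact h)
    exact ⟨by rw [this, hgw], this⟩
  · obtain ⟨h1, h2⟩ := ha i h
    rw [hg.ev_eq] at h2
    exact Or.inl ⟨h1, by linarith, h⟩

/-- The open cube of edge `2 * η` centred at `u`. -/
def cube {ι : Type*} (u : ι → ℝ) (η : ℝ) : Set (ι → ℝ) := {v | ∀ i, |v i - u i| < η}

lemma convex_cube {ι : Type*} (u : ι → ℝ) (η : ℝ) : Convex ℝ (cube u η) := by
  intro x hx y hy a b ha hb hab i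
  have e : (a • x + b • y) i - u i = a * (x i - u i) + b * (y i - u i) := by
    simp only [Pi.add_apply, Pi.smul_apply, smul_eq_mul]
    linear_combination u i * hab
  rw [e]
  obtain ⟨h1, h2⟩ := abs_lt.1 (hx i)
  obtain ⟨h3, h4⟩ := abs_lt.1 (hy i)
  have h5 := convex_Ioo (-η) η ⟨h1, h2⟩ ⟨h3, h4⟩ ha hb hab
  exact abs_lt.2 h5

/-- The point with all coordinates `1`, except possibly one which is `0`. -/
def cornerPt {s : ℕ} (o : Option (Fin (s + 1))) (j : Fin (s + 1)) : ℝ := if o = some j then 0 else 1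

/-- Corners which are limits of tuples straddling small denominators. -/
def IsCuspCorner {s : ℕ} (o : Option (Fin (s + 1))) : Prop := ∀ i, o = some i → 0 < i ∧ i < Fin.last s

lemma Cons.injective {d c s : ℕ} {Q : ℤ} {z : ℤ × ℤ} {V : Fin (s + 1) → ℤ × ℤ}
    (h : Cons d c Q z V) : Function.Injective V := by
  intro i j hij
  by_contra hne
  rcases lt_or_gt_of_ne hne with h1 | h1
  · have := h.dt_pos h1
    rw [hij, dt_self] at this; omega
  · have := h.dt_pos h1
    rw [hij, dt_self] at this; omega

lemma dtCusp_near_corner {d : ℕ} (hd : 2 ≤ d) (c s : ℕ) : ∃ M : ℤ, 0 < M ∧ ∀ K, M ≤ K → ∀ Q : ℕ,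
    0 < Q → ∀ q ∈ DtCusp d c s K Q, ∃ o, IsCuspCorner o ∧
      ∀ j, |(q j : ℝ) / Q - cornerPt o j| ≤ M / K := by
  obtain ⟨A, M, hA, hM, H⟩ := exists_cusp_structure hd c s
  refine ⟨M, hM, fun K hK Q hQ q ⟨z, V, hz, hV, hq, w, hw⟩ => ?_⟩
  obtain ⟨z', g, hg, hgw, hn, hnw, a, b, -, -, -, -, hi⟩ := H Q z V w hz hV K hK hw
  have hK0 : (0 : ℝ) < K := by exact_mod_cast hM.trans_le hK
  have hQ0 : (0 : ℝ) < Q := by exact_mod_cast hQ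
  have hM1 : (1 : ℝ) ≤ M := by exact_mod_cast hM
  have hsmall : (ev w z : ℝ) / Q ≤ 1 / K := by
    rw [div_le_div_iff₀ hQ0 hK0]
    have := hw.2.2.1
    have h' : ((K * ev w z : ℤ) : ℝ) ≤ Q := by exact_mod_cast this
    push_cast at h'; linarith
  have hbig : ∀ j, (Q : ℤ) - M * z'.2 ≤ ev (V j) z → |(q j : ℝ) / Q - 1| ≤ M / K := by
    intro j hj
    have h1 : ((Q : ℝ) - M * ev w z) ≤ q j := by rw [hq, ← hnw]; exact_mod_cast hj
    have h2 : (q j : ℝ) ≤ Q := by rw [hq]; exact_mod_cast (hV.1 j).2.2.1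
    rw [abs_sub_comm, abs_of_nonneg (by rw [sub_nonneg, div_le_one hQ0]; exact h2)]
    have h3 : (M : ℝ) * (ev w z / Q) ≤ M * (1 / K) := by gcongr
    rw [mul_one_div] at h3
    refine le_trans ?_ h3
    rw [sub_le_iff_le_add, ← mul_div_assoc, ← add_div, le_div_iff₀ hQ0]
    linarith
  by_cases hc : ∃ i, V i = w
  · obtain ⟨i, hi'⟩ := hc
    refine ⟨some i, ?_, fun j => ?_⟩
    · rintro _ ⟨rfl⟩
      constructor
      · refine Fin.pos_iff_ne_zero.2 fun h => ?_
        have := hw.2.2.2.1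
        rw [← hi', h, dt_self] at this; omega
      · refine lt_of_le_of_ne (Fin.le_last _) fun h => ?_
        have := hw.2.2.2.2
        rw [← hi', h, dt_self] at this; omega
    · by_cases hij : i = j
      · subst hij
        rw [cornerPt, if_pos rfl, sub_zero, hq, hi', abs_of_nonneg (by
          have := hw.2.1
          have : (0 : ℝ) < ev w z := by exact_mod_cast this
          positivity)]
        exact hsmall.trans (by gcongr)
      · rw [cornerPt, if_neg (by simpa using hij)]
        rcases hi j with h | h | h
        · exact hbig j h.2.1
        · exact hbig j h.2.1
        · exact absurd (hV.injective (hi'.trans h.2.symm)) hij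
  · refine ⟨none, fun i h => (by cases h), fun j => ?_⟩
    rw [cornerPt, if_neg (by simp)]
    rcases hi j with h | h | h
    · exact hbig j h.2.1
    · exact hbig j h.2.1
    · exact absurd ⟨j, h.2⟩ hc

lemma exists_bdd_of_not_corner {d : ℕ} (hd : 2 ≤ d) (c s : ℕ) {u : Fin (s + 1) → ℝ}
    (hu : ∀ o, IsCuspCorner o → cornerPt o ≠ u) : ∃ (B : ℤ) (η₀ : ℝ), 0 < η₀ ∧ ∀ η ≤ η₀,
      ∀ᶠ Q : ℕ in atTop, {q ∈ Dt d c s Q | (fun i => (q i : ℝ) / Q) ∈ cube u η} =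
        {q ∈ DtBdd d c s B Q | (fun i => (q i : ℝ) / Q) ∈ cube u η} := by
  obtain ⟨M, hM, H⟩ := dtCusp_near_corner hd c s
  have h1 : ∀ o : Option (Fin (s + 1)), ∃ δ : ℝ, 0 < δ ∧ (IsCuspCorner o →
      ∃ j, δ ≤ |cornerPt o j - u j|) := by
    intro o
    by_cases ho : IsCuspCorner o
    · obtain ⟨j, hj⟩ := Function.ne_iff.1 (hu o ho)
      exact ⟨_, abs_pos.2 (sub_ne_zero.2 hj), fun _ => ⟨j, le_rfl⟩⟩
    · exact ⟨1, one_pos, fun h => absurd h ho⟩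
  choose δ hδ0 hδ using h1
  obtain ⟨o₀, ho₀⟩ := Finite.exists_min δ
  obtain ⟨K, hK⟩ := exists_nat_gt (max (M : ℝ) (2 * M / δ o₀))
  have hM0 : (0 : ℝ) < M := by exact_mod_cast hM
  have hK1 : (M : ℝ) < K := (le_max_left _ _).trans_lt hK
  have hK2 : 2 * M / δ o₀ < K := (le_max_right _ _).trans_lt hK
  have hK0 : (0 : ℝ) < K := hM0.trans hK1
  obtain ⟨B, hB⟩ := exists_dt_subset hd c s (K := K) (by exact_mod_cast hK0)
  refine ⟨B, δ o₀ / 2, half_pos (hδ0 _), fun η hη => ?_⟩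
  filter_upwards [eventually_ge_atTop K] with Q hQ
  have hQ0 : 0 < Q := lt_of_lt_of_le (by exact_mod_cast hK0) hQ
  ext q
  refine ⟨fun h => ⟨(hB Q (by exact_mod_cast hQ) h.1).resolve_right fun hc => ?_, h.2⟩,
    fun h => ⟨dtBdd_subset _ _ _ _ _ h.1, h.2⟩⟩
  obtain ⟨o, ho, hoj⟩ := H K (by exact_mod_cast hK1.le) Q hQ0 q hc
  obtain ⟨j, hj⟩ := hδ o ho
  have h3 := hoj j
  have h4 : |(q j : ℝ) / Q - u j| < η := h.2 j
  have h5 : (M : ℝ) / (K : ℕ) < δ o₀ / 2 := by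
    rw [div_lt_iff₀ (hδ0 _)] at hK2
    rw [div_lt_iff₀ hK0]; linarith
  have h6 := abs_sub_le (cornerPt o j) ((q j : ℝ) / Q) (u j)
  rw [abs_sub_comm (cornerPt o j) ((q j : ℝ) / Q)] at h6
  have := ho₀ o
  push_cast at h3
  linarith

/-- An order-connected condition is eventually decided near `0` on the right. -/
lemma eventually_or_eventually_not {S : Set ℝ} (hS : S.OrdConnected) :
    (∀ᶠ η in nhdsWithin 0 (Set.Ioi 0), η ∈ S) ∨ ∀ᶠ η in nhdsWithin 0 (Set.Ioi 0), η ∉ S := by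
  by_cases h : ∃ᶠ η in nhdsWithin (0 : ℝ) (Set.Ioi 0), η ∈ S
  · left
    obtain ⟨η₁, h1, h2⟩ := (h.and_eventually self_mem_nhdsWithin).exists
    filter_upwards [Ioo_mem_nhdsGT h2] with η hη
    obtain ⟨η₂, h3, h4⟩ := (h.and_eventually (Ioo_mem_nhdsGT hη.1)).exists
    exact hS.out h3 h1 ⟨h4.2.le, hη.2.le⟩
  · right
    exact not_frequently.1 h

lemma decided_forall {ι : Type*} [Finite ι] {P : ι → ℝ → Prop} {l : Filter ℝ}
    (h : ∀ i, (∀ᶠ η in l, P i η) ∨ ∀ᶠ η in l, ¬ P i η) :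
    (∀ᶠ η in l, ∀ i, P i η) ∨ ∀ᶠ η in l, ¬ ∀ i, P i η := by
  by_cases h1 : ∀ i, ∀ᶠ η in l, P i η
  · exact Or.inl (eventually_all.2 h1)
  · obtain ⟨i, hi⟩ := not_forall.1 h1
    refine Or.inr (((h i).resolve_left hi).mono fun η h2 h3 => h2 (h3 i))

lemma decided_and {P R : ℝ → Prop} {l : Filter ℝ} (h : (∀ᶠ η in l, P η) ∨ ∀ᶠ η in l, ¬ P η)
    (h' : (∀ᶠ η in l, R η) ∨ ∀ᶠ η in l, ¬ R η) :
    (∀ᶠ η in l, P η ∧ R η) ∨ ∀ᶠ η in l, ¬ (P η ∧ R η) := by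
  rcases h with h | h
  · rcases h' with h' | h'
    · exact Or.inl (h.and h')
    · exact Or.inr (h'.mono fun η h1 h2 => h1 h2.2)
  · exact Or.inr (h.mono fun η h1 h2 => h1 h2.1)

lemma continuous_cfm (a b W : ℤ × ℤ) : Continuous (cfm a b W) := by
  unfold cfm; fun_prop

lemma measurableSet_forall {α ι : Type*} [MeasurableSpace α] [Countable ι] {P : ι → α → Prop}
    (h : ∀ i, MeasurableSet {x | P i x}) : MeasurableSet {x | ∀ i, P i x} := by
  rw [← Set.iInter_ofPred]
  exact MeasurableSet.iInter h

lemma measurableSet_typeRegion (d c : ℕ) {s : ℕ} (V : Fin (s + 1) → ℤ × ℤ)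
    (ρ : ZMod d × ZMod d) : MeasurableSet (typeRegion d c V ρ) := by
  have h : ∀ W (I : Set ℝ), MeasurableSet I → MeasurableSet {y | cfm (V 0) (V 1) W y ∈ I} :=
    fun W I hI => (continuous_cfm _ _ _).measurable hI
  refine MeasurableSet.inter (measurableSet_forall fun i => h _ _ measurableSet_Ioc) ?_
  exact measurableSet_forall fun W => (MeasurableSet.const _).imp <| (MeasurableSet.const _).imp <|
    measurableSet_forall fun i => (MeasurableSet.const _).imp <| (MeasurableSet.const _).imp <|
      h W _ measurableSet_Ioi

lemma exists_volume_limit {ι : Type*} [Finite ι] {s : ℕ} (u : Fin (s + 1) → ℝ)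
    {V : Fin (s + 1) → ℤ × ℤ} (h01 : 0 < dt (V 0) (V 1)) {Ω : ι → Set (ℝ × ℝ)}
    (hΩ : ∀ i, Convex ℝ (Ω i)) (hΩm : ∀ i, MeasurableSet (Ω i)) (J : Set ι) :
    ∃ l, Tendsto (fun η => volume.real (tupleRegion V (cube u η) ∩ patternCell Ω J) / η ^ 2)
      (nhdsWithin 0 (Set.Ioi 0)) (nhds l) := by
  set x₀ : ℝ × ℝ := (u 0, u 1) with hx₀
  set As : ℝ → Set (ℝ × ℝ) := fun η =>
    {t | x₀ + η • t ∈ tupleRegion V (cube u η) ∩ patternCell Ω J} with hAs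
  have hlin : ∀ (t : ℝ × ℝ) {S : Set (ℝ × ℝ)}, Convex ℝ S →
      (∀ᶠ η in nhdsWithin (0 : ℝ) (Set.Ioi 0), x₀ + η • t ∈ S) ∨
      ∀ᶠ η in nhdsWithin (0 : ℝ) (Set.Ioi 0), x₀ + η • t ∉ S := by
    intro t S hS
    refine eventually_or_eventually_not (S := {η : ℝ | x₀ + η • t ∈ S}) (Convex.ordConnected ?_)
    intro x hx y hy a b ha hb hab
    have e : x₀ + (a • x + b • y) • t = a • (x₀ + x • t) + b • (x₀ + y • t) := by
      conv_lhs => rw [← one_smul ℝ x₀, ← hab]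
      module
    rw [Set.mem_ofPred_eq, e]
    exact hS hx hy ha hb hab
  have hdec : ∀ t, (∀ᶠ η in nhdsWithin (0 : ℝ) (Set.Ioi 0), t ∈ As η) ∨
      ∀ᶠ η in nhdsWithin (0 : ℝ) (Set.Ioi 0), t ∉ As η := by
    intro t
    refine decided_and (decided_and ?_ ?_) ?_
    · exact hlin t ((convex_Icc 0 1).prod (convex_Icc 0 1))
    · refine decided_forall fun j => ?_
      refine eventually_or_eventually_not
        (S := {η : ℝ | |cfm (V 0) (V 1) (V j) (x₀ + η • t) - u j| < η}) ⟨?_⟩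
      intro x hx y hy w hw
      simp only [Set.mem_ofPred_eq] at hx hy ⊢
      have e : ∀ r : ℝ, cfm (V 0) (V 1) (V j) (x₀ + r • t) =
          cfm (V 0) (V 1) (V j) x₀ + r * cfm (V 0) (V 1) (V j) t := fun r => by
        have := cfm_comb (V 0) (V 1) (V j) x₀ t 1 r
        simpa using this
      rw [e, abs_lt] at *
      obtain ⟨hw1, hw2⟩ := hw
      rcases eq_or_lt_of_le (hw1.trans hw2) with hxy | hxy
      · have : w = x := le_antisymm (by rw [hxy]; exact hw2) hw1
        rw [this]; exact hx
      · set p := cfm (V 0) (V 1) (V j) x₀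
        set r := cfm (V 0) (V 1) (V j) t
        have h1 : 0 < y - x := sub_pos.2 hxy
        constructor
        · have : 0 < (y - x) * (p + w * r - u j + w) := by
            rcases eq_or_lt_of_le hw1 with h | h <;> nlinarith
          nlinarith [(pos_iff_pos_of_mul_pos this).1 h1]
        · have : 0 < (y - x) * (w - (p + w * r - u j)) := by
            rcases eq_or_lt_of_le hw1 with h | h <;> nlinarith
          nlinarith [(pos_iff_pos_of_mul_pos this).1 h1]
    · refine decided_forall fun i => ?_
      by_cases hi : i ∈ J
      · simpa only [hi, iff_true] using hlin t (hΩ i)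
      · simp only [hi, iff_false, not_not]
        exact (hlin t (hΩ i)).symm
  set A : Set (ℝ × ℝ) := {t | ∀ᶠ η in nhdsWithin (0 : ℝ) (Set.Ioi 0), t ∈ As η} with hA
  set Bx : Set (ℝ × ℝ) := Set.Icc (-1 : ℝ) 1 ×ˢ Set.Icc (-1 : ℝ) 1 with hBx
  have hc0 : ∀ y, cfm (V 0) (V 1) (V 0) y = y.1 := by
    intro y
    have : (dt (V 0) (V 1) : ℝ) ≠ 0 := by exact_mod_cast h01.ne'
    simp only [cfm, dt_self, Int.cast_zero, zero_mul, add_zero]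
    field_simp
  have hc1 : ∀ y, cfm (V 0) (V 1) (V 1) y = y.2 := by
    intro y
    have : (dt (V 0) (V 1) : ℝ) ≠ 0 := by exact_mod_cast h01.ne'
    simp only [cfm, dt_self, Int.cast_zero, zero_mul, zero_add]
    field_simp
  have hsub : ∀ η, 0 < η → As η ⊆ Bx := by
    intro η hη t ht
    have h0 := ht.1.2 0
    have h1 := ht.1.2 1
    simp only [hc0, hc1, hx₀, Prod.fst_add, Prod.snd_add, Prod.smul_fst, Prod.smul_snd,
      smul_eq_mul, add_sub_cancel_left, abs_mul, abs_of_pos hη] at h0 h1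
    rw [mul_lt_iff_lt_one_right hη] at h0 h1
    exact ⟨abs_le.1 h0.le, abs_le.1 h1.le⟩
  have hpos : ∀ᶠ η in nhdsWithin (0 : ℝ) (Set.Ioi 0), 0 < η := self_mem_nhdsWithin
  have hBfin : volume Bx < ⊤ :=
    ((Metric.isBounded_Icc _ _).prod (Metric.isBounded_Icc _ _)).measure_lt_top
  have hlim : Tendsto (fun η => volume (As η)) (nhdsWithin 0 (Set.Ioi 0)) (nhds (volume A)) := by
    refine tendsto_measure_of_tendsto_indicator (nhdsWithin 0 (Set.Ioi 0)) (B := Bx) (fun η => ?_)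
      (measurableSet_Icc.prod measurableSet_Icc) hBfin.ne (hpos.mono hsub) fun t => ?_
    · have hm : Measurable fun t : ℝ × ℝ => x₀ + η • t := by fun_prop
      refine hm (((measurableSet_Icc.prod measurableSet_Icc).inter ?_).inter ?_)
      · refine measurableSet_forall fun j => ?_
        exact measurableSet_lt (by have := (continuous_cfm (V 0) (V 1) (V j)).measurable; fun_prop)
          measurable_const
      · have : Countable ι := Finite.to_countable
        refine measurableSet_forall fun i => ?_
        exact MeasurableSet.iff (hΩm i) (MeasurableSet.const _)
    · rcases hdec t with h | h
      · exact h.mono fun η h' => iff_of_true h' h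
      · refine h.mono fun η h' => iff_of_false h' fun h2 => ?_
        obtain ⟨_, h3, h4⟩ :=
          ((show ∀ᶠ η in nhdsWithin (0 : ℝ) (Set.Ioi 0), t ∈ As η from h2).and h).exists
        exact h4 h3
  have hAB : A ⊆ Bx := by
    intro t ht
    obtain ⟨η, h1, h2⟩ := (Eventually.and (show ∀ᶠ η in nhdsWithin (0 : ℝ) (Set.Ioi 0), t ∈ As η from ht) hpos).exists
    exact hsub η h2 h1
  refine ⟨_, ((ENNReal.tendsto_toReal ((measure_mono hAB).trans_lt hBfin).ne).comp hlim).congr' ?_⟩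
  filter_upwards [hpos] with η hη
  have e : As η = (fun t => η • t) ⁻¹' ((fun y => x₀ + y) ⁻¹'
    (tupleRegion V (cube u η) ∩ patternCell Ω J)) := rfl
  rw [Function.comp_apply, e, Measure.addHaar_preimage_smul _ hη.ne', measure_preimage_add,
    ENNReal.toReal_mul, ENNReal.toReal_ofReal (abs_nonneg _), Measure.real]
  simp only [Module.finrank_prod, Module.finrank_self]
  rw [abs_of_pos (by positivity)]
  ring

lemma limit_of_bdd {d : ℕ} (hd : 2 ≤ d) (c : ℕ) {s : ℕ} (hs : 1 ≤ s) {u : Fin (s + 1) → ℝ}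
    (hu : ∀ o, IsCuspCorner o → cornerPt o ≠ u) {ℓ : ℝ → ℝ} (hℓ : ∀ η, 0 < η →
      Tendsto (fun Q : ℕ => ({q ∈ Dt d c s Q | (fun i => (q i : ℝ) / Q) ∈ cube u η}.ncard : ℝ) /
        (Q : ℝ) ^ 2) atTop (nhds (ℓ η))) :
    ∃ l, Tendsto (fun η => ℓ η / η ^ 2) (nhdsWithin 0 (Set.Ioi 0)) (nhds l) := by
  obtain ⟨B, η₀, hη₀, hB⟩ := exists_bdd_of_not_corner hd c s hu
  obtain ⟨N, k, θ, h01, -, H⟩ := exists_dtBdd_limit (d := d) (by omega) c hs B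
  have h1 := fun i J => exists_volume_limit u (h01 i)
    (Ω := fun l => typeRegion d c (k l).1 (k l).2) (fun l => convex_typeRegion _ _ _ _)
    (fun l => measurableSet_typeRegion _ _ _ _) J
  choose l hl using h1
  refine ⟨∑ i, ∑ J, θ i J * l i J, Tendsto.congr' ?_ (tendsto_finsetSum _ fun i _ =>
    tendsto_finsetSum _ fun J _ => (hl i J).const_mul (θ i J))⟩
  filter_upwards [Ioo_mem_nhdsGT hη₀] with η hη
  have h2 := tendsto_nhds_unique ((hℓ η hη.1).congr' ((hB η hη.2.le).mono fun Q hQ => by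
    rw [hQ])) (H _ (convex_cube u η))
  rw [h2, Finset.sum_div]
  refine Finset.sum_congr rfl fun i _ => ?_
  rw [Finset.sum_div]
  exact Finset.sum_congr rfl fun J _ => (mul_div_assoc _ _ _).symm

lemma measurableSet_patternCell {ι : Type*} [Countable ι] {Ω : ι → Set (ℝ × ℝ)}
    (hΩ : ∀ i, MeasurableSet (Ω i)) (J : Set ι) : MeasurableSet (patternCell Ω J) :=
  measurableSet_forall fun i => MeasurableSet.iff (hΩ i) (MeasurableSet.const _)

open Classical in
lemma sum_measureReal_patternCell {ι : Type*} [Fintype ι] {Ω : ι → Set (ℝ × ℝ)}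
    (hΩ : ∀ i, MeasurableSet (Ω i)) {S : Set (ℝ × ℝ)} (hS : MeasurableSet S)
    (hSb : volume S ≠ ⊤) {h : ℝ × ℝ → ℝ × ℝ} (hh : Measurable h) :
    volume.real S = ∑ J : Set ι, volume.real (S ∩ h ⁻¹' patternCell Ω J) := by
  rw [← measureReal_biUnion_finset]
  · congr 1
    ext x
    simp only [Finset.mem_univ, Set.iUnion_true, Set.mem_iUnion, Set.mem_inter_iff, Set.mem_preimage,
      exists_and_left, iff_self_and]
    exact fun _ => ⟨{i | h x ∈ Ω i}, fun i => Iff.rfl⟩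
  · intro J _ J' _ hne
    rw [Function.onFun, Set.disjoint_left]
    rintro x ⟨-, h1⟩ ⟨-, h2⟩
    exact hne (Set.ext fun i => (h1 i).symm.trans (h2 i))
  · exact fun J _ => hS.inter (hh (measurableSet_patternCell hΩ J))

open Classical in
lemma sum_mul_patternCell_le {ι : Type*} [Fintype ι] {Ω : ι → Set (ℝ × ℝ)}
    (hΩ : ∀ i, MeasurableSet (Ω i)) {D : Set ι → ℝ} (hD : Monotone D) {S : Set (ℝ × ℝ)}
    (hS : MeasurableSet S) (hSb : volume S ≠ ⊤) {h : ℝ × ℝ → ℝ × ℝ} (hh : Measurable h)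
    (hmap : ∀ y ∈ S, ∀ i, y ∈ Ω i → h y ∈ Ω i) :
    ∑ J, D J * volume.real (S ∩ patternCell Ω J) ≤
      ∑ J, D J * volume.real (S ∩ h ⁻¹' patternCell Ω J) := by
  have e1 : ∀ J, volume.real (S ∩ patternCell Ω J) =
      ∑ J', volume.real ((S ∩ patternCell Ω J) ∩ h ⁻¹' patternCell Ω J') := fun J =>
    sum_measureReal_patternCell hΩ (hS.inter (measurableSet_patternCell hΩ J))
      (measure_ne_top_of_subset Set.inter_subset_left hSb) hh
  have e2 : ∀ J', volume.real (S ∩ h ⁻¹' patternCell Ω J') =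
      ∑ J, volume.real ((S ∩ h ⁻¹' patternCell Ω J') ∩ id ⁻¹' patternCell Ω J) := fun J' =>
    sum_measureReal_patternCell hΩ (hS.inter (hh (measurableSet_patternCell hΩ J')))
      (measure_ne_top_of_subset Set.inter_subset_left hSb) measurable_id
  simp only [e1, e2, Finset.mul_sum]
  conv_rhs => rw [Finset.sum_comm]
  refine Finset.sum_le_sum fun J _ => Finset.sum_le_sum fun J' _ => ?_
  rw [Set.preimage_id, Set.inter_right_comm]
  rcases (S ∩ h ⁻¹' patternCell Ω J' ∩ patternCell Ω J).eq_empty_or_nonempty with he | ⟨y, hy⟩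
  · simp [he]
  · refine mul_le_mul_of_nonneg_right (hD fun i hi => ?_) measureReal_nonneg
    exact (hy.1.2 i).1 (hmap y hy.1.1 i ((hy.2 i).2 hi))

/-- Contraction of the plane towards `(1, 1)`. -/
def shrink (r : ℝ) (y : ℝ × ℝ) : ℝ × ℝ := (1 - r + r * y.1, 1 - r + r * y.2)

lemma volume_shrink_preimage {r : ℝ} (hr : 0 < r) (S : Set (ℝ × ℝ)) :
    volume.real (shrink r ⁻¹' S) = volume.real S / r ^ 2 := by
  have e : shrink r ⁻¹' S = (fun t => r • t) ⁻¹' ((fun y => (1 - r, 1 - r) + y) ⁻¹' S) := rfl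
  rw [Measure.real, e, Measure.addHaar_preimage_smul _ hr.ne', measure_preimage_add,
    ENNReal.toReal_mul, ENNReal.toReal_ofReal (abs_nonneg _), Measure.real]
  simp only [Module.finrank_prod, Module.finrank_self]
  rw [abs_of_pos (by positivity)]
  ring

lemma shrink_mem_typeRegion {d c : ℕ} {V : Fin 2 → ℤ × ℤ} {ρ : ZMod d × ZMod d}
    (h01 : 0 < dt (V 0) (V 1)) {r : ℝ} (hr0 : 0 < r) (hr1 : r ≤ 1) {y : ℝ × ℝ}
    (hy : y ∈ typeRegion d c V ρ) : shrink r y ∈ typeRegion d c V ρ := by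
  have hD : (0 : ℝ) < dt (V 0) (V 1) := by exact_mod_cast h01
  have hc0 : ∀ y, cfm (V 0) (V 1) (V 0) y = y.1 := by
    intro y
    simp only [cfm, dt_self, Int.cast_zero, zero_mul, add_zero]
    field_simp
  have hc1 : ∀ y, cfm (V 0) (V 1) (V 1) y = y.2 := by
    intro y
    simp only [cfm, dt_self, Int.cast_zero, zero_mul, zero_add]
    field_simp
  obtain ⟨hy1, hy2⟩ := hy
  have hy10 := hy1 0
  have hy11 := hy1 1
  rw [hc0] at hy10
  rw [hc1] at hy11
  refine ⟨fun i => ?_, fun W h1 h2 i h3 h4 => ?_⟩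
  · fin_cases i
    · show cfm (V 0) (V 1) (V 0) _ ∈ _
      rw [hc0]
      constructor <;> simp only [shrink] <;> nlinarith [hy10.1, hy10.2]
    · show cfm (V 0) (V 1) (V 1) _ ∈ _
      rw [hc1]
      constructor <;> simp only [shrink] <;> nlinarith [hy11.1, hy11.2]
  · have h5 := hy2 W h1 h2 i h3 h4
    have hi : i = 0 := Subsingleton.elim _ _
    subst hi
    have h3' : (0 : ℝ) < dt (V 0) W := by exact_mod_cast h3
    have h4' : (0 : ℝ) < dt W (V 1) := by exact_mod_cast h4
    simp only [cfm, Set.mem_Ioi, shrink] at h5 ⊢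
    rw [lt_div_iff₀ hD] at h5 ⊢
    have h6 : (dt (V 0) (V 1) : ℝ) < dt W (V 1) + dt (V 0) W := by nlinarith [hy10.2, hy11.2]
    nlinarith

open Classical in
lemma exists_dtBdd_limit_pair {d : ℕ} (hd : 0 < d) (c : ℕ) (B : ℤ) : ∃ ℓB : ℝ → ℝ,
    (∀ η, 0 < η → Tendsto (fun Q : ℕ => ({q ∈ DtBdd d c 1 B Q | (fun i => (q i : ℝ) / Q) ∈
      cube (fun _ => 1) η}.ncard : ℝ) / (Q : ℝ) ^ 2) atTop (nhds (ℓB η))) ∧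
    ∀ η' η, 0 < η' → η' ≤ η → ℓB η / η ^ 2 ≤ ℓB η' / η' ^ 2 := by
  obtain ⟨N, k, -, hk⟩ := (finite_typeSet hd c 1 B).fin_param
  have hdt : ∀ i, 0 < dt ((k i).1 0) ((k i).1 1) := fun i =>
    (show k i ∈ typeSet d c 1 B from hk ▸ Set.mem_range_self i).2.2.1
  set A : Fin N → Set (ℤ × ℤ) := fun l => pairImage d (k l).2 ((k l).1 0) ((k l).1 1) with hA
  have hAP : ∀ l, AlmostPeriodic (A l) := fun l => almostPeriodic_pairImage hd _ (hdt l).ne'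
  set Ω : Fin N → Set (ℝ × ℝ) := fun l => typeRegion d c (k l).1 (k l).2 with hΩ
  have hΩm : ∀ l, MeasurableSet (Ω l) := fun l => measurableSet_typeRegion _ _ _ _
  set Bx : ℝ → Set (ℝ × ℝ) := fun η => Set.Ioo (1 - η) (1 + η) ×ˢ Set.Ioo (1 - η) (1 + η) with hBx
  set Ψ : (Fin N → Prop) → (Fin N → Prop) → Prop := fun a b => ∃ l, a l ∧ b l with hΨ
  set D : Set (Fin N) → ℝ := fun J => dens {z | Ψ (fun i => z ∈ A i) (fun i => i ∈ J)} with hD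
  have hDmono : Monotone D := by
    intro J J' hJ
    refine AlmostPeriodic.dens_mono (AlmostPeriodic.comb hAP fun a => Ψ a fun i => i ∈ J)
      (AlmostPeriodic.comb hAP fun a => Ψ a fun i => i ∈ J') ?_
    rintro z ⟨l, h1, h2⟩
    exact ⟨l, h1, hJ h2⟩
  have hBb : ∀ η, Bornology.IsBounded (Bx η) := fun η =>
    (Metric.isBounded_Ioo _ _).prod (Metric.isBounded_Ioo _ _)
  have hBc : ∀ η, Convex ℝ (Bx η) := fun η => (convex_Ioo _ _).prod (convex_Ioo _ _)
  refine ⟨fun η => ∑ J, D J * volume.real (Bx η ∩ patternCell Ω J), fun η hη => ?_, ?_⟩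
  · refine (tendsto_count_comb hAP (fun l => volume_frontier_of_convex (convex_typeRegion _ _ _ _))
      (hBb η) (volume_frontier_of_convex (hBc η)) Ψ).congr' ?_
    filter_upwards [eventually_gt_atTop 0] with Q hQ
    congr 2
    have inj : Set.InjOn (fun q : Fin 2 → ℤ => (q 0, q 1))
        {q ∈ DtBdd d c 1 B Q | (fun i => (q i : ℝ) / Q) ∈ cube (fun _ => 1) η} := by
      intro q _ q' _ h
      simp only [Prod.mk.injEq] at h
      funext i
      fin_cases i
      exacts [h.1, h.2]
    rw [← inj.ncard_image]
    congr 1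
    ext y
    have hcube : ∀ q : Fin 2 → ℤ, (fun i => (q i : ℝ) / Q) ∈ cube (fun _ => (1 : ℝ)) η ↔
        rescale Q (q 0, q 1) ∈ Bx η := by
      intro q
      rw [cube, Set.mem_ofPred_eq, Fin.forall_fin_two, abs_lt, abs_lt, hBx]
      simp only [rescale, Set.mem_prod, Set.mem_Ioo]
      constructor
      · rintro ⟨⟨h1, h2⟩, h3, h4⟩
        exact ⟨⟨by linarith, by linarith⟩, by linarith, by linarith⟩
      · rintro ⟨⟨h1, h2⟩, h3, h4⟩
        exact ⟨⟨by linarith, by linarith⟩, by linarith, by linarith⟩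
    constructor
    · rintro ⟨h1, l, ⟨z, hz, rfl⟩, h3⟩
      refine ⟨fun i => ev ((k l).1 i) z, ⟨?_, (hcube _).2 h1⟩, rfl⟩
      rw [mem_dtBdd_iff le_rfl hQ]
      exact ⟨k l, hk ▸ Set.mem_range_self l, z, hz, h3, fun _ => rfl⟩
    · rintro ⟨q, ⟨h1, h2⟩, rfl⟩
      rw [mem_dtBdd_iff le_rfl hQ, ← hk] at h1
      obtain ⟨_, ⟨l, rfl⟩, z, hz, h3, h4⟩ := h1
      refine ⟨(hcube q).1 h2, l, ?_, ?_⟩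
      · exact ⟨z, hz, by beta_reduce; rw [h4, h4]⟩
      · beta_reduce
        rw [h4, h4]
        exact h3
  · intro η' η hη' hle
    have hη : 0 < η := hη'.trans_le hle
    have hr : 0 < η' / η := by positivity
    have hpre : ∀ S, shrink (η' / η) ⁻¹' (Bx η' ∩ S) = Bx η ∩ shrink (η' / η) ⁻¹' S := by
      intro S
      rw [Set.preimage_inter]
      congr 1
      ext y
      have e : ∀ x : ℝ, 1 - η' / η + η' / η * x ∈ Set.Ioo (1 - η') (1 + η') ↔
          x ∈ Set.Ioo (1 - η) (1 + η) := by
        intro x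
        have e1 : 1 - η' / η + η' / η * x = 1 + η' * ((x - 1) / η) := by field_simp; ring
        rw [e1]
        simp only [Set.mem_Ioo]
        have e2 : 1 - η' < 1 + η' * ((x - 1) / η) ↔ -1 < (x - 1) / η := by
          constructor <;> intro h <;> nlinarith
        have e3 : 1 + η' * ((x - 1) / η) < 1 + η' ↔ (x - 1) / η < 1 := by
          constructor <;> intro h <;> nlinarith
        rw [e2, e3, lt_div_iff₀ hη, div_lt_iff₀ hη]
        constructor <;> rintro ⟨h1, h2⟩ <;> constructor <;> linarith
      simp only [Set.mem_preimage, shrink, hBx, Set.mem_prod, e]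
    have h1 := sum_mul_patternCell_le hΩm hDmono (S := Bx η)
      (measurableSet_Ioo.prod measurableSet_Ioo) (hBb η).measure_lt_top.ne
      (h := shrink (η' / η)) (by unfold shrink; fun_prop)
      (fun y _ i => shrink_mem_typeRegion (hdt i) hr ((div_le_one hη).2 hle))
    simp only [← hpre, volume_shrink_preimage hr] at h1
    rw [div_le_div_iff₀ (by positivity) (by positivity), Finset.sum_mul]
    have h2 := mul_le_mul_of_nonneg_right h1 (sq_nonneg η')
    rw [Finset.sum_mul] at h2
    refine h2.trans_eq ?_
    rw [Finset.sum_mul, Finset.sum_mul]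
    refine Finset.sum_congr rfl fun J _ => ?_
    field_simp

lemma limit_of_pair {d : ℕ} (hd : 2 ≤ d) (c : ℕ) {ℓ : ℝ → ℝ} (hℓ : ∀ η, 0 < η →
      Tendsto (fun Q : ℕ => ({q ∈ Dt d c 1 Q | (fun i => (q i : ℝ) / Q) ∈
        cube (fun _ => 1) η}.ncard : ℝ) / (Q : ℝ) ^ 2) atTop (nhds (ℓ η))) (C : ℝ) (hC : 0 ≤ C) :
    ∃ g : ENNReal, Tendsto (fun η => ENNReal.ofReal (C * (ℓ η / η ^ 2)))
      (nhdsWithin 0 (Set.Ioi 0)) (nhds g) := by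
  have key : ∀ ε, 0 < ε → ∃ ℓB : ℝ → ℝ, (∀ η, 0 < η → ℓB η ≤ ℓ η ∧ ℓ η ≤ ℓB η + ε) ∧
      ∀ η' η, 0 < η' → η' ≤ η → ℓB η / η ^ 2 ≤ ℓB η' / η' ^ 2 := by
    intro ε hε
    obtain ⟨K, hK⟩ := exists_nat_gt (1 / ε + 1)
    have hK1 : (1 : ℝ) < K := lt_of_le_of_lt (by simp; positivity) hK
    have hK0 : 0 < K := by exact_mod_cast (zero_lt_one.trans hK1)
    obtain ⟨B, hB⟩ := exists_dt_subset hd c 1 (K := K) (by exact_mod_cast hK0)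
    obtain ⟨ℓB, h1, h2⟩ := exists_dtBdd_limit_pair (d := d) (by omega) c B
    have hsub : ∀ (Q : ℕ) η, {q ∈ DtBdd d c 1 B Q | (fun i => (q i : ℝ) / Q) ∈
        cube (fun _ => 1) η} ⊆ {q ∈ Dt d c 1 Q | (fun i => (q i : ℝ) / Q) ∈
        cube (fun _ => 1) η} := fun Q η q hq => ⟨dtBdd_subset _ _ _ _ _ hq.1, hq.2⟩
    have hfin : ∀ (Q : ℕ) η, {q ∈ Dt d c 1 Q | (fun i => (q i : ℝ) / Q) ∈
        cube (fun _ => 1) η}.Finite := fun Q η => (finite_Dt d c 1 Q).subset fun q h => h.1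
    refine ⟨ℓB, fun η hη => ⟨?_, ?_⟩, h2⟩
    · refine le_of_tendsto_of_tendsto (h1 η hη) (hℓ η hη) (Eventually.of_forall fun Q => ?_)
      have := Set.ncard_le_ncard (hsub Q η) (hfin Q η)
      beta_reduce
      gcongr
    · refine le_of_tendsto_of_tendsto (hℓ η hη) ((h1 η hη).add_const ε) ?_
      filter_upwards [eventually_ge_atTop K] with Q hQ
      have hQ0 : (0 : ℝ) < Q := by exact_mod_cast (hK0.trans_le hQ)
      have h3 : ({q ∈ Dt d c 1 Q | (fun i => (q i : ℝ) / Q) ∈ cube (fun _ => 1) η}.ncard : ℝ) ≤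
          {q ∈ DtBdd d c 1 B Q | (fun i => (q i : ℝ) / Q) ∈ cube (fun _ => 1) η}.ncard +
          (DtCusp d c 1 K Q).ncard := by
        have f3 : (DtCusp d c 1 K Q).Finite := (finite_Dt d c 1 Q).subset (dtCusp_subset d c 1 K Q)
        have hcov : {q ∈ Dt d c 1 Q | (fun i => (q i : ℝ) / Q) ∈ cube (fun _ => 1) η} ⊆
            {q ∈ DtBdd d c 1 B Q | (fun i => (q i : ℝ) / Q) ∈ cube (fun _ => 1) η} ∪
            DtCusp d c 1 K Q := fun q hq => (hB Q (by exact_mod_cast hQ) hq.1).imp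
          (fun h => ⟨h, hq.2⟩) id
        have := (Set.ncard_le_ncard hcov (((hfin Q η).subset (hsub Q η)).union f3)).trans
          (Set.ncard_union_le _ _)
        exact_mod_cast this
      have h4 := ncard_dtCusp_le d c le_rfl K hK0 Q
      rw [div_le_iff₀ (by positivity), add_mul, div_mul_cancel₀ _ (by positivity)]
      have h5 : 1 ≤ ε * (K : ℝ) ^ 2 := by
        have h6 : 1 / ε ≤ K := by linarith
        rw [div_le_iff₀ hε] at h6
        nlinarith
      have h7 : ((1 : ℕ) : ℝ) * ((Q : ℝ) / K) ^ 2 ≤ ε * (Q : ℝ) ^ 2 := by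
        rw [Nat.cast_one, one_mul, div_pow, div_le_iff₀ (by positivity)]
        nlinarith [sq_nonneg (Q : ℝ)]
      linarith
  have hanti : ∀ η' η, 0 < η' → η' ≤ η → ℓ η / η ^ 2 ≤ ℓ η' / η' ^ 2 := by
    intro η' η hη' hle
    have hη : 0 < η := hη'.trans_le hle
    refine le_of_forall_pos_le_add fun ε hε => ?_
    obtain ⟨ℓB, h1, h2⟩ := key (ε * η ^ 2) (by positivity)
    have h3 : ℓ η / η ^ 2 ≤ ℓB η / η ^ 2 + ε := by
      rw [div_add' _ _ _ (by positivity)]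
      have := (h1 η hη).2
      gcongr
    have h4 : ℓB η' / η' ^ 2 ≤ ℓ η' / η' ^ 2 := by
      have := (h1 η' hη').1
      gcongr
    linarith [h2 η' η hη' hle]
  have : AntitoneOn (fun η => ENNReal.ofReal (C * (ℓ η / η ^ 2))) (Set.Ioi 0) :=
    fun η' h1 η h2 h => ENNReal.ofReal_le_ofReal (mul_le_mul_of_nonneg_left (hanti η' η h1 h) hC)
  exact ⟨_, this.tendsto_nhdsGT (OrderTop.bddAbove _)⟩

section

variable {d c : ℕ} {Q Q' a k b : ℤ} {z V V' W : ℤ × ℤ}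

/-- The shear `(x, y) ↦ (x, y + t x)`. -/
def shear (t : ℤ) (W : ℤ × ℤ) : ℤ × ℤ := (W.1, W.2 + W.1 * t)

lemma ev_shear' (t : ℤ) (W z : ℤ × ℤ) : ev (shear t W) z = ev W z + W.1 * t * z.2 :=
  ev_shear W z _

lemma dt_shear (t : ℤ) (V W : ℤ × ℤ) : dt (shear t V) (shear t W) = dt V W := by
  simp only [dt, shear]; ring

lemma shear_shear (t t' : ℤ) (V : ℤ × ℤ) : shear t (shear t' V) = shear (t' + t) V := by
  simp only [shear, Prod.mk.injEq, true_and]; ring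

lemma refl1_shear (t : ℤ) (V : ℤ × ℤ) : refl1 (shear t V) = shear (-t) (refl1 V) := by
  simp only [shear, refl1, Prod.mk.injEq, true_and]; ring

lemma Cls.shear (hW : Cls d c Q z W) {Q' : ℤ} {k : ℤ} (h0 : 0 < ev (shear (d * k) W) z)
    (h1 : ev (_root_.shear (d * k) W) z ≤ Q') : Cls d c Q' z (_root_.shear (d * k) W) :=
  ⟨isCoprime_shear hW.1 _, h0, h1, dvd_ev_shear hW.2.2.2 k⟩

lemma not_right_of_shear (hd : 0 < d) (hn : 0 < z.2) (ha : 1 ≤ a) (hVa : V.1 = a)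
    (hQ' : Q' = Q + k * a * d * z.2) (hV : Cls d c Q z V) (hV'0 : 0 < ev V' z) (hV'1 : V'.1 ≤ 0)
    (hgap : ∀ W, Cls d c Q z W → ¬ (0 < dt V W ∧ 0 < dt W V'))
    (hs1 : (a + 1) * (Q - ev V z) < Q') (hs2 : a ^ 2 * d * z.2 < Q)
    (hW : Cls d c Q' z W) (hW1 : 0 < W.1) : ¬ 0 < dt (shear (d * k) V) W := by
  intro h1
  obtain ⟨-, hV0, hVQ, -⟩ := hV
  have e1 := ev_eq_dt z (shear (d * k) V) W
  rw [dt_swap _ W, ev_shear', show (shear (d * k) V).1 = a from hVa, hVa] at e1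
  have p1 : 0 < dt (shear (d * k) V) W * z.2 := by positivity
  have h2 : W.1 ≤ a := by
    by_contra hlt
    rw [not_le] at hlt
    have h3 : a * ev W z ≤ a * Q' := by have := hW.2.2.1; gcongr
    have h4 : (a + 1) * (ev V z + a * (d * k) * z.2) ≤ W.1 * (ev V z + a * (d * k) * z.2) := by
      have : 0 ≤ ev V z + a * (d * k) * z.2 := by
        have : 0 ≤ (a + 1) * (ev V z + a * (d * k) * z.2) := by
          nlinarith [hW.2.1, hW.2.2.1]
        nlinarith
      gcongr
      omega
    nlinarith [hW.2.1, hW.2.2.1]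
  have right : ∀ U : ℤ × ℤ, 0 < U.1 → 0 < ev U z → 0 < dt U V' := by
    intro U hU1 hU0
    have e2 := ev_eq_dt z V' U
    have : 0 < dt U V' * z.2 := by nlinarith [mul_pos hU1 hV'0]
    exact pos_of_mul_pos_left this hn.le
  rcases h2.eq_or_lt with h2 | h2
  · have e0 : shear (d * k) (shear (d * -k) W) = W := by rw [shear_shear, shear]; simp
    have e3 : dt V (shear (d * -k) W) = dt (shear (d * k) V) W := by rw [← dt_shear (d * k), e0]
    have e4 := ev_eq_dt z V (shear (d * -k) W)
    rw [dt_swap V, e3, hVa, show (shear (d * -k) W).1 = a from h2] at e4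
    have h3 : 0 < ev (shear (d * -k) W) z := by
      have : 0 < a * ev (shear (d * -k) W) z := by nlinarith [mul_pos (by omega : 0 < a) hV0]
      exact pos_of_mul_pos_right this (by omega)
    refine hgap _ (hW.shear h3 ?_) ⟨by rw [e3]; exact h1, right _ hW1 h3⟩
    rw [ev_shear', h2]
    have := hW.2.2.1
    rw [hQ'] at this
    linarith
  · obtain ⟨U, hU1, hUc, hUd, hUQ, hUQ', -⟩ := exists_shear hd hW.1 hW1 hW.2.2.2 hn Q
    have hdn : 0 ≤ d * z.2 := by positivity
    have h3 : d * W.1 * z.2 ≤ d * z.2 * a := by nlinarith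
    have h4 : d * z.2 * a ≤ d * z.2 * a ^ 2 := by
      have : a ≤ a ^ 2 := by nlinarith
      gcongr
    have hU0 : 0 < ev U z := by nlinarith
    have e2 := ev_eq_dt z V U
    rw [dt_swap V, hVa, hU1] at e2
    have h5 : 0 < dt V U * z.2 := by
      have h6 : a * (Q - d * z.2 * a) < a * ev U z := by
        have : Q - d * z.2 * a < ev U z := by linarith
        gcongr
      have h7 : W.1 * ev V z ≤ (a - 1) * Q := by
        have : W.1 ≤ a - 1 := by omega
        have : 0 ≤ a - 1 := by omega
        gcongr
      nlinarith
    exact hgap _ ⟨hUc, hU0, hUQ, hUd⟩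
      ⟨pos_of_mul_pos_left h5 hn.le, right _ (by omega) hU0⟩

lemma gap_shear_of_eq (hn : 0 < z.2) (ha : 1 ≤ a) (hVa : V.1 = a) (hVa' : V'.1 = a)
    (hQ' : Q' = Q + k * a * d * z.2) (hV : Cls d c Q z V) (hV' : Cls d c Q z V')
    (hVV : 0 < dt V V') (hgap : ∀ W, Cls d c Q z W → ¬ (0 < dt V W ∧ 0 < dt W V'))
    (hs1 : (a + 1) * (Q - ev V z) < Q') (hW : Cls d c Q' z W) :
    ¬ (0 < dt (shear (d * k) V) W ∧ 0 < dt W (shear (d * k) V')) := by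
  rintro ⟨h1, h2⟩
  have e1 := ev_eq_dt z (shear (d * k) V) W
  rw [dt_swap _ W, ev_shear', show (shear (d * k) V).1 = a from hVa, hVa] at e1
  have p1 : 0 < dt (shear (d * k) V) W * z.2 := by positivity
  have hW1 : 0 < W.1 := by
    have e : W.1 * dt V V' = a * (dt (shear (d * k) V) W + dt W (shear (d * k) V')) := by
      simp only [dt, shear, hVa, hVa']; ring
    have : 0 < W.1 * dt V V' := by rw [e]; positivity
    exact pos_of_mul_pos_left this hVV.le
  have h3 : W.1 ≤ a := by
    by_contra hlt
    rw [not_le] at hlt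
    have h3 : a * ev W z ≤ a * Q' := by have := hW.2.2.1; gcongr
    have hVQ := hV.2.2.1
    have h4 : (a + 1) * (ev V z + a * (d * k) * z.2) ≤ W.1 * (ev V z + a * (d * k) * z.2) := by
      have : 0 ≤ ev V z + a * (d * k) * z.2 := by
        have : 0 ≤ (a + 1) * (ev V z + a * (d * k) * z.2) := by
          nlinarith [hW.2.1, hW.2.2.1]
        nlinarith
      gcongr
      omega
    nlinarith [hW.2.1, hW.2.2.1]
  have e0 : shear (d * k) (shear (d * -k) W) = W := by rw [shear_shear, shear]; simp
  have e3 : dt V (shear (d * -k) W) = dt (shear (d * k) V) W := by rw [← dt_shear (d * k), e0]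
  have e3' : dt (shear (d * -k) W) V' = dt W (shear (d * k) V') := by
    rw [← dt_shear (d * k), e0]
  have e4 := ev_eq_dt z V (shear (d * -k) W)
  have e5 := ev_eq_dt z V' (shear (d * -k) W)
  rw [dt_swap V, e3, hVa, show (shear (d * -k) W).1 = W.1 from rfl] at e4
  rw [e3', hVa', show (shear (d * -k) W).1 = W.1 from rfl] at e5
  have h4 : 0 < ev (shear (d * -k) W) z := by
    have : 0 < a * ev (shear (d * -k) W) z := by nlinarith [mul_pos hW1 hV.2.1]
    exact pos_of_mul_pos_right this (by omega)
  refine hgap _ (hW.shear h4 ?_) ⟨by rw [e3]; exact h1, by rw [e3']; exact h2⟩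
  have p2 : 0 < dt W (shear (d * k) V') * z.2 := by positivity
  have h6 : W.1 * ev V' z ≤ a * Q := by
    have := hV'.2.2.1
    have := hV'.2.1
    gcongr
  by_contra hlt
  rw [not_le] at hlt
  nlinarith

/-- The piecewise linear shear, with different slopes on both sides of `(0, 1)`. -/
def bishear (d : ℕ) (k a b : ℤ) (W : ℤ × ℤ) : ℤ × ℤ :=
  if 0 ≤ W.1 then shear (d * (k * b)) W else shear (d * -(k * a)) W

lemma cons_bishear {s : ℕ} {V : Fin (s + 1) → ℤ × ℤ} (h : Cons d c Q z V) (hd : 0 < d)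
    (hn : 0 < z.2) (ha : 1 ≤ a) (hb : 1 ≤ b)
    (hα : ∀ i, (V i).1 = a ∨ (V i).1 = -b ∨ V i = (0, 1))
    (hQ' : Q' = Q + k * a * b * d * z.2)
    (hs1 : ∀ i, (V i).1 ≠ 0 → (a + b + 1) * (Q - ev (V i) z) < Q') (hs2 : a ^ 2 * d * z.2 < Q)
    (hs3 : b ^ 2 * d * z.2 < Q) (hs4 : z.2 ≤ Q') :
    Cons d c Q' z fun i => bishear d k a b (V i) := by
  have el : ∀ W : ℤ × ℤ, W.1 = a → bishear d k a b W = shear (d * (k * b)) W :=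
    fun W hW => if_pos (by omega)
  have er : ∀ W : ℤ × ℤ, W.1 = -b → bishear d k a b W = shear (d * -(k * a)) W :=
    fun W hW => if_neg (by omega)
  have ec : ∀ W : ℤ × ℤ, W = (0, 1) → bishear d k a b W = W := fun W hW => by
    rw [bishear, if_pos (by simp [hW]), shear, hW]; simp
  have vl : ∀ i, (V i).1 = a → ev (bishear d k a b (V i)) z = Q' - (Q - ev (V i) z) := by
    intro i hi
    rw [el _ hi, ev_shear', hi, hQ']; ring
  have vr : ∀ i, (V i).1 = -b → ev (bishear d k a b (V i)) z = Q' - (Q - ev (V i) z) := by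
    intro i hi
    rw [er _ hi, ev_shear', hi, hQ']; ring
  have vc : ∀ i, V i = (0, 1) → ev (bishear d k a b (V i)) z = z.2 := by
    intro i hi
    rw [ec _ hi, hi]; simp [ev]
  have hQ0 : ∀ i, 0 ≤ Q - ev (V i) z := fun i => by have := (h.1 i).2.2.1; linarith
  have hpos : ∀ i, (V i).1 ≠ 0 → 0 < Q' - (Q - ev (V i) z) := fun i hi => by
    nlinarith [hs1 i hi, mul_nonneg (by omega : 0 ≤ a + b) (hQ0 i)]
  have hs1a : ∀ i, (V i).1 ≠ 0 → (a + 1) * (Q - ev (V i) z) < Q' := fun i hi => by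
    nlinarith [hs1 i hi, mul_nonneg (by omega : 0 ≤ b) (hQ0 i)]
  have hs1b : ∀ i, (V i).1 ≠ 0 → (b + 1) * (Q - ev (V i) z) < Q' := fun i hi => by
    nlinarith [hs1 i hi, mul_nonneg (by omega : 0 ≤ a) (hQ0 i)]
  have hcls : ∀ i, Cls d c Q' z (bishear d k a b (V i)) := by
    intro i
    rcases hα i with hi | hi | hi
    · have hv := vl i hi
      have := hpos i (by omega)
      rw [el _ hi] at hv ⊢
      exact (h.1 i).shear (by rw [hv]; exact this) (by rw [hv]; linarith [hQ0 i])
    · have hv := vr i hi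
      have := hpos i (by omega)
      rw [er _ hi] at hv ⊢
      exact (h.1 i).shear (by rw [hv]; exact this) (by rw [hv]; linarith [hQ0 i])
    · have hv := vc i hi
      rw [ec _ hi] at hv ⊢
      exact ⟨(h.1 i).1, (h.1 i).2.1, hv.trans_le hs4, (h.1 i).2.2.2⟩
  -- the vector `(0, 1)` separates the two sides
  have sep : ∀ W, Cls d c Q' z W → W.1 = 0 → Cls d c Q z (0, 1) ∧ W = (0, 1) := by
    intro W hW h0
    have e : W = (0, 1) := by
      obtain ⟨x, y⟩ := W
      simp only at h0
      subst h0
      have h1 := hW.1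
      have h2 := hW.2.1
      simp only [isCoprime_zero_left, Int.isUnit_iff, ev, zero_mul, zero_add] at h1 h2
      rcases h1 with rfl | rfl
      · rfl
      · linarith
    refine ⟨⟨isCoprime_one_right, by simpa [ev] using hn, ?_, ?_⟩, e⟩
    · simp only [ev, zero_mul, one_mul, zero_add]
      nlinarith [mul_pos (by positivity : 0 < a ^ 2 * (d : ℤ)) hn,
        (by positivity : 0 < a ^ 2 * (d : ℤ))]
    · have := hW.2.2.2
      rwa [e] at this
  refine ⟨hcls, fun i => ?_⟩
  obtain ⟨hij, hgap⟩ := h.2 i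
  have hgap' : ∀ W, Cls d c Q (refl1 z) W →
      ¬ (0 < dt (refl1 (V i.succ)) W ∧ 0 < dt W (refl1 (V i.castSucc))) := by
    intro W hW
    rw [← refl1_refl1 W, dt_refl1, dt_refl1]
    exact fun h => hgap _ (by rw [← cls_refl1, refl1_refl1]; exact hW) h.symm
  have hW' : ∀ W, Cls d c Q' z W → Cls d c Q' (refl1 z) (refl1 W) := fun W => cls_refl1.2
  have hpi := h.pos i.castSucc
  have hpj := h.pos i.succ
  have hci := h.1 i.castSucc
  have hcj := h.1 i.succ
  beta_reduce
  set U := V i.castSucc with hU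
  set U' := V i.succ with hU'
  have nr : ∀ W, Cls d c Q' z W → U.1 = a → U'.1 ≤ 0 → 0 < W.1 →
      ¬ 0 < dt (bishear d k a b U) W := fun W hW hUa hU0 hW1 => by
    rw [el _ hUa]
    exact not_right_of_shear hd hn ha hUa (by rw [hQ']; ring) hci hpj hU0 hgap
      (hs1a i.castSucc (by rw [← hU]; omega)) hs2 hW hW1
  have nl : ∀ W, Cls d c Q' z W → U'.1 = -b → 0 ≤ U.1 → W.1 < 0 →
      ¬ 0 < dt W (bishear d k a b U') := fun W hW hUa hU0 hW1 => by
    rw [er _ hUa, ← dt_refl1, refl1_shear, ← mul_neg, neg_neg]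
    exact not_right_of_shear (Q := Q) (V' := refl1 U) hd (z := refl1 z) hn hb (by simp [refl1, hUa])
      (by rw [hQ', refl1]) (cls_refl1.2 hcj) (by rw [ev_refl1]; exact hpi)
      (by simp only [refl1]; omega) hgap' (by rw [ev_refl1]; exact hs1b i.succ (by rw [← hU']; omega)) hs3
      (hW' _ hW) (by simp only [refl1]; omega)
  rcases hα i.castSucc with hi | hi | hi <;> rcases hα i.succ with hj | hj | hj <;>
    rw [← hU] at hi <;> rw [← hU'] at hj
  · rw [el _ hi, el _ hj]
    refine ⟨by rw [dt_shear]; exact hij, fun W hW => ?_⟩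
    exact gap_shear_of_eq hn ha hi hj (by rw [hQ']; ring) hci hcj hij hgap (hs1a i.castSucc (by rw [← hU]; omega)) hW
  · have v1 := vl _ hi
    have v2 := vr _ hj
    refine ⟨?_, fun W hW hb' => ?_⟩
    · have e := ev_eq_dt z (bishear d k a b U') (bishear d k a b U)
      have p1 := hpos i.castSucc (by rw [← hU]; omega)
      have p2 := hpos i.succ (by rw [← hU']; omega)
      rw [v1, v2, el _ hi, er _ hj, show (shear (d * (k * b)) U).1 = U.1 from rfl,
        show (shear (d * -(k * a)) U').1 = U'.1 from rfl, hi, hj] at e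
      rw [el _ hi, er _ hj]
      refine pos_of_mul_pos_left (b := z.2) ?_ hn.le
      nlinarith [mul_pos (by omega : 0 < a) p2, mul_pos (by omega : 0 < b) p1]
    · rcases lt_trichotomy W.1 0 with h0 | h0 | h0
      · exact nl W hW hj (by omega) h0 hb'.2
      · refine hgap _ (sep W hW h0).1 ⟨?_, ?_⟩ <;> simp only [dt] <;> omega
      · exact nr W hW hi (by omega) h0 hb'.1
  · refine ⟨?_, fun W hW hb' => nr W hW hi (by simp [hj]) ?_ hb'.1⟩
    · rw [el _ hi, ec _ hj, hj]
      simp only [dt, shear]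
      omega
    · have := hb'.2
      rw [ec _ hj, hj] at this
      simp only [dt] at this
      omega
  · exfalso
    have e := ev_eq_dt z U' U
    rw [hi, hj] at e
    nlinarith [mul_pos (by omega : 0 < a) hpi, mul_pos (by omega : 0 < b) hpj, mul_pos hij hn]
  · rw [er _ hi, er _ hj]
    refine ⟨by rw [dt_shear]; exact hij, fun W hW => ?_⟩
    rw [← dt_refl1 W, ← dt_refl1 _ W, refl1_shear, refl1_shear, ← mul_neg, neg_neg, and_comm]
    exact gap_shear_of_eq (Q := Q) (z := refl1 z) hn hb (by simp [refl1, hj]) (by simp [refl1, hi])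
      (by rw [hQ', refl1]) (cls_refl1.2 hcj) (cls_refl1.2 hci) (by rw [dt_refl1]; exact hij)
      hgap' (by rw [ev_refl1]; exact hs1b i.succ (by rw [← hU']; omega)) (hW' _ hW)
  · exfalso
    rw [hj] at hij
    simp only [dt] at hij
    omega
  · exfalso
    rw [hi] at hij
    simp only [dt] at hij
    omega
  · refine ⟨?_, fun W hW hb' => nl W hW hj (by simp [hi]) ?_ hb'.2⟩
    · rw [er _ hj, ec _ hi, hi]
      simp only [dt, shear]
      omega
    · have := hb'.1
      rw [ec _ hi, hi] at this
      simp only [dt] at this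
      omega
  · rw [hi, hj, dt_self] at hij
    exact absurd hij (lt_irrefl _)

end

section

open Classical in
lemma card_filter_periodic {p : ℕ → Prop} {P : ℕ} (hp : Function.Periodic p P) (A k : ℕ) :
    ((Finset.Ico A (A + k * P)).filter p).card = k * P.count p := by
  induction k with
  | zero => simp
  | succ k ih =>
    have e : A + (k + 1) * P = (A + k * P) + P := by ring
    rw [e, ← Finset.Ico_union_Ico_eq_Ico (b := A + k * P) (by omega) (by omega),
      Finset.filter_union, Finset.card_union_of_disjoint, ih,
      Nat.filter_Ico_card_eq_of_periodic _ _ _ hp]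
    · ring
    · exact Finset.disjoint_filter_filter (Finset.Ico_disjoint_Ico_consecutive _ _ _)

open Classical in
lemma card_filter_window_le {p : ℕ → Prop} {P A₀ : ℕ} (hP : 0 < P)
    (hp : ∀ Q, A₀ ≤ Q → (p Q ↔ p (Q + P))) {A A' H m : ℕ} (hA : A₀ ≤ A) (hA' : A₀ ≤ A')
    (hH : m * P ≤ H) :
    m * ((Finset.Ico A (A + H)).filter p).card ≤
      (m + 1) * ((Finset.Ico A' (A' + H)).filter p).card := by
  have hper : Function.Periodic (fun x => p (A₀ + x)) P := fun x => by
    beta_reduce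
    rw [← add_assoc]
    exact propext (hp _ (by omega)).symm
  have hsh : ∀ B L, A₀ ≤ B → ((Finset.Ico B (B + L)).filter p).card =
      ((Finset.Ico (B - A₀) (B - A₀ + L)).filter fun x => p (A₀ + x)).card := by
    intro B L hB
    refine (Finset.card_bij (fun x _ => A₀ + x) ?_ ?_ ?_).symm
    · intro x hx
      simp only [Finset.mem_filter, Finset.mem_Ico] at hx ⊢
      exact ⟨by omega, hx.2⟩
    · intro x _ y _ h
      omega
    · intro y hy
      simp only [Finset.mem_filter, Finset.mem_Ico] at hy
      have e : A₀ + (y - A₀) = y := by omega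
      exact ⟨y - A₀, by simp only [Finset.mem_filter, Finset.mem_Ico, e]; exact ⟨by omega, hy.2⟩, e⟩
  have hmk : m ≤ H / P := (Nat.le_div_iff_mul_le hP).2 hH
  have hk := Nat.div_add_mod H P
  have hr := Nat.mod_lt H hP
  set k := H / P with hkdef
  have up : ((Finset.Ico A (A + H)).filter p).card ≤ (k + 1) * P.count fun x => p (A₀ + x) := by
    rw [hsh A H hA, ← card_filter_periodic hper (A - A₀)]
    refine Finset.card_le_card (Finset.filter_subset_filter _ (Finset.Ico_subset_Ico le_rfl ?_))
    have := mul_comm k P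
    have : (k + 1) * P = k * P + P := by ring
    omega
  have lo : k * (P.count fun x => p (A₀ + x)) ≤ ((Finset.Ico A' (A' + H)).filter p).card := by
    rw [hsh A' H hA', ← card_filter_periodic hper (A' - A₀)]
    refine Finset.card_le_card (Finset.filter_subset_filter _ (Finset.Ico_subset_Ico le_rfl ?_))
    have := mul_comm k P
    omega
  calc _ ≤ m * ((k + 1) * P.count fun x => p (A₀ + x)) := Nat.mul_le_mul_left _ up
    _ ≤ (m + 1) * (k * P.count fun x => p (A₀ + x)) := by
      rw [← mul_assoc, ← mul_assoc]
      exact Nat.mul_le_mul_right _ (by nlinarith)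
    _ ≤ _ := Nat.mul_le_mul_left _ lo

/-- The number of offsets of size less than `Y` satisfying a condition depending on `Q`. -/
noncomputable def offsetCount {s : ℕ} (X : (Fin (s + 1) → ℤ) → ℕ → Prop) (Y : ℝ) (Q : ℕ) : ℝ :=
  ({o : Fin (s + 1) → ℤ | (∀ i, |(o i : ℝ)| < Y) ∧ X o Q}.ncard : ℝ)

/-- The property that sums over windows of equal lengths are almost equal. -/
def WindowUniform (F : ℝ → ℕ → ℝ) : Prop :=
  ∀ θ : ℝ, 0 < θ → ∃ R : ℝ, 0 < R ∧ ∀ Y : ℝ, 1 ≤ Y → ∀ A A' H : ℕ, R * Y ≤ A → R * Y ≤ A' →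
    R * Y ≤ H → ∑ Q ∈ Finset.Ico A (A + H), F Y Q ≤ (1 + θ) * ∑ Q ∈ Finset.Ico A' (A' + H), F Y Q

lemma WindowUniform.add {F G : ℝ → ℕ → ℝ} (hF : WindowUniform F) (hG : WindowUniform G) :
    WindowUniform fun Y Q => F Y Q + G Y Q := by
  intro θ hθ
  obtain ⟨R, hR, h⟩ := hF θ hθ
  obtain ⟨R', hR', h'⟩ := hG θ hθ
  refine ⟨max R R', lt_max_of_lt_left hR, fun Y hY A A' H h1 h2 h3 => ?_⟩
  have hY0 : 0 ≤ Y := by linarith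
  have e1 : R * Y ≤ max R R' * Y := by gcongr; exact le_max_left _ _
  have e2 : R' * Y ≤ max R R' * Y := by gcongr; exact le_max_right _ _
  rw [Finset.sum_add_distrib, Finset.sum_add_distrib, mul_add]
  exact add_le_add (h Y hY A A' H (e1.trans h1) (e1.trans h2) (e1.trans h3))
    (h' Y hY A A' H (e2.trans h1) (e2.trans h2) (e2.trans h3))

lemma finite_offsets (s : ℕ) (Y : ℝ) : {o : Fin (s + 1) → ℤ | ∀ i, |(o i : ℝ)| < Y}.Finite := by
  refine (Set.Finite.pi' fun _ => Set.finite_Icc (-⌈Y⌉) ⌈Y⌉).subset fun o ho i => ?_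
  have h1 := abs_lt.1 (ho i)
  have h2 := Int.le_ceil Y
  constructor <;> [skip; skip] <;> (rw [← Int.cast_le (R := ℝ)]; push_cast; linarith)

lemma offsetCount_nonneg {s : ℕ} (X : (Fin (s + 1) → ℤ) → ℕ → Prop) (Y : ℝ) (Q : ℕ) :
    0 ≤ offsetCount X Y Q := Nat.cast_nonneg _

lemma offsetCount_mono {s : ℕ} (X : (Fin (s + 1) → ℤ) → ℕ → Prop) (Q : ℕ) :
    Monotone fun Y => offsetCount X Y Q := fun _ Y' h =>
  Nat.cast_le.2 (Set.ncard_le_ncard (fun _ ho => ⟨fun i => (ho.1 i).trans_le h, ho.2⟩)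
    ((finite_offsets s Y').subset fun _ ho => ho.1))

open Classical in
lemma windowUniform_offsetCount {s : ℕ} {X : (Fin (s + 1) → ℤ) → ℕ → Prop} {C R₀ : ℝ}
    (hC : 0 < C) (h : ∀ (o : Fin (s + 1) → ℤ) (Y : ℝ), 1 ≤ Y → (∀ i, |(o i : ℝ)| < Y) →
      ∃ P : ℕ, 0 < P ∧ P ≤ C * Y ∧ ∀ Q : ℕ, R₀ * Y ≤ Q → (X o Q ↔ X o (Q + P))) :
    WindowUniform (offsetCount X) := by
  intro θ hθ
  obtain ⟨m, hm⟩ := exists_nat_gt (1 / θ)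
  have hm0 : (0 : ℝ) < m := (by positivity : (0 : ℝ) < 1 / θ).trans hm
  refine ⟨max (m * C) (|R₀| + 1), lt_max_of_lt_left (by positivity), ?_⟩
  intro Y hY A A' H hA hA' hH
  have hY0 : 0 ≤ Y := by linarith
  have e1 : m * C * Y ≤ max (m * C) (|R₀| + 1) * Y := by gcongr; exact le_max_left _ _
  have e2 : (|R₀| + 1) * Y ≤ max (m * C) (|R₀| + 1) * Y := by gcongr; exact le_max_right _ _
  have e3 : R₀ * Y + 1 ≤ (|R₀| + 1) * Y := by nlinarith [le_abs_self R₀]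
  have hsum : ∀ B : ℕ, ∑ Q ∈ Finset.Ico B (B + H), offsetCount X Y Q =
      ∑ o ∈ (finite_offsets s Y).toFinset, (((Finset.Ico B (B + H)).filter (X o)).card : ℝ) := by
    intro B
    have : ∀ Q, offsetCount X Y Q =
        ∑ o ∈ (finite_offsets s Y).toFinset, if X o Q then (1 : ℝ) else 0 := by
      intro Q
      rw [Finset.sum_boole, offsetCount, ← Set.ncard_coe_finset]
      congr 2
      ext o
      simp
    simp only [this]
    rw [Finset.sum_comm]
    refine Finset.sum_congr rfl fun o _ => ?_
    rw [Finset.sum_boole]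
  rw [hsum, hsum, Finset.mul_sum]
  refine Finset.sum_le_sum fun o ho => ?_
  obtain ⟨P, hP, hPC, hper⟩ := h o Y hY (by simpa using ho)
  have key := card_filter_window_le (p := X o) (A₀ := ⌈R₀ * Y⌉₊) hP
    (fun Q hQ => hper Q (Nat.ceil_le.1 hQ)) (A := A) (A' := A') (H := H) (m := m)
    (Nat.ceil_le.2 (by linarith)) (Nat.ceil_le.2 (by linarith)) (by
      have : (m * P : ℝ) ≤ m * (C * Y) := by gcongr
      rw [← Nat.cast_le (α := ℝ)]; push_cast; linarith)
  have key' : (m : ℝ) * ((Finset.Ico A (A + H)).filter (X o)).card ≤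
      (m + 1) * ((Finset.Ico A' (A' + H)).filter (X o)).card := by exact_mod_cast key
  have h1 : (1 : ℝ) ≤ m * θ := by
    rw [div_lt_iff₀ hθ] at hm; exact hm.le
  have h2 : (0 : ℝ) ≤ ((Finset.Ico A' (A' + H)).filter (X o)).card := Nat.cast_nonneg _
  have h3 : (m : ℝ) * ((Finset.Ico A (A + H)).filter (X o)).card ≤
      m * ((1 + θ) * ((Finset.Ico A' (A' + H)).filter (X o)).card) := by nlinarith
  exact le_of_mul_le_mul_left h3 hm0

end

set_option maxHeartbeats 2000000 in
lemma limit_le_of_window {F : ℝ → ℕ → ℝ} (hmono : ∀ Q, Monotone fun Y => F Y Q)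
    {ℓ : ℝ → ℝ} (hnn : ∀ Y Q, 0 ≤ F Y Q) {η₁ : ℝ}
    (hℓ : ∀ η, 0 < η → η < η₁ →
      Tendsto (fun Q : ℕ => F (η * Q) Q / (Q : ℝ) ^ 2) atTop (nhds (ℓ η)))
    (hwin : WindowUniform F) {θ : ℝ} (hθ : 0 < θ) (hθ1 : θ ≤ 1 / 4) :
    ∃ η₀, 0 < η₀ ∧ ∀ η η', 0 < η → η < η₀ → η < η₁ → 0 < η' → η' < η₀ → η' < η₁ →
      (1 - θ) ^ 2 * (ℓ η / η ^ 2) ≤ (1 + θ) ^ 3 * (ℓ η' / η' ^ 2) := by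
  obtain ⟨R, hR, hwin⟩ := hwin θ hθ
  refine ⟨θ / (R + 1), by positivity, fun η η' hη hη0 hη1 hη' hη'0 hη'1 => ?_⟩
  have hℓ0 : ∀ η, 0 < η → η < η₁ → 0 ≤ ℓ η := fun η h1 h2 =>
    ge_of_tendsto (hℓ η h1 h2) (Eventually.of_forall fun Q => by have := hnn (η * Q) Q; positivity)
  set m := min (1 / η) (1 / η') with hm
  have hmR : R + 1 ≤ θ * m := by
    have : ∀ x, 0 < x → x < θ / (R + 1) → (R + 1) / θ ≤ 1 / x := by
      intro x hx h
      rw [div_le_div_iff₀ hθ hx]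
      rw [lt_div_iff₀ (by positivity)] at h
      linarith
    have := le_min (this η hη hη0) (this η' hη' hη'0)
    rw [div_le_iff₀ hθ] at this
    linarith
  have hm1 : m ≤ 1 / η := min_le_left _ _
  have hm2 : m ≤ 1 / η' := min_le_right _ _
  have hm0 : 0 < m := by
    have : 0 < θ * m := by linarith
    exact pos_of_mul_pos_right this hθ.le
  -- comparison of the sums for large `Y`
  have main : ∀ ε, 0 < ε → ∀ᶠ N : ℕ in atTop,
      max (ℓ η - ε) 0 * ((1 - θ) / η - 1 / (N : ℝ)) ^ 2 ≤
        (1 + θ) * ((ℓ η' + ε) * ((1 + θ) / η' + 1 / (N : ℝ)) ^ 2) := by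
    intro ε hε
    obtain ⟨N₁, hN₁⟩ := eventually_atTop.1 ((hℓ η hη hη1).eventually (lt_mem_nhds
      (show ℓ η - ε < ℓ η by linarith)))
    obtain ⟨N₂, hN₂⟩ := eventually_atTop.1 ((hℓ η' hη' hη'1).eventually (gt_mem_nhds
      (show ℓ η' < ℓ η' + ε by linarith)))
    have hbig : ∀ᶠ N : ℕ in atTop, ((N₁ : ℝ) + N₂ + 3) ≤ R * N :=
      (tendsto_natCast_atTop_atTop.const_mul_atTop hR).eventually_ge_atTop _
    filter_upwards [hbig, eventually_ge_atTop 1] with N hN hN1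
    have hN1' : (1 : ℝ) ≤ N := by exact_mod_cast hN1
    have hN0 : (0 : ℝ) < N := by linarith
    set H := ⌊θ * m * N⌋₊ with hH
    set T := ⌊N / η⌋₊ with hT
    set A' := ⌈N / η'⌉₊ with hA'
    have hH1 : (H : ℝ) ≤ θ * m * N := Nat.floor_le (by positivity)
    have hH2 : θ * m * N < H + 1 := Nat.lt_floor_add_one _
    have hT1 : (T : ℝ) ≤ N / η := Nat.floor_le (by positivity)
    have hT2 : N / η < T + 1 := Nat.lt_floor_add_one _
    have hA1 : N / η' ≤ A' := Nat.le_ceil _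
    have hA2 : (A' : ℝ) < N / η' + 1 := Nat.ceil_lt_add_one (by positivity)
    have hmT : m * N ≤ N / η := by
      calc m * N ≤ 1 / η * N := by gcongr
        _ = N / η := by ring
    have hmA : m * N ≤ N / η' := by
      calc m * N ≤ 1 / η' * N := by gcongr
        _ = N / η' := by ring
    have hRN : R * N + N ≤ θ * m * N := by
      calc R * N + N = (R + 1) * N := by ring
        _ ≤ θ * m * N := by gcongr
    have hRN' : R * N + N ≤ m * N / 4 := by
      have : θ * (m * N) ≤ 1 / 4 * (m * N) := by gcongr
      rw [mul_assoc] at hRN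
      linarith
    have hθT : θ * m * N ≤ θ * (N / η) := by rw [mul_assoc]; gcongr
    have hθA : θ * m * N ≤ θ * (N / η') := by rw [mul_assoc]; gcongr
    have hHT : H ≤ T := by
      rw [← Nat.cast_le (α := ℝ)]
      nlinarith
    have hHR : R * N ≤ H := by linarith
    have hTH : ((T - H : ℕ) : ℝ) = T - H := Nat.cast_sub hHT
    have hTH' : (1 - θ) * (N / η) - 1 ≤ ((T - H : ℕ) : ℝ) := by rw [hTH]; linarith
    have h14 : θ * (N / η) ≤ 1 / 4 * (N / η) := by gcongr
    have hTR : R * N ≤ ((T - H : ℕ) : ℝ) := by linarith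
    have hAR : R * N ≤ (A' : ℝ) := by nlinarith
    have key := hwin N hN1' (T - H) A' H hTR hAR hHR
    have lo : H * (max (ℓ η - ε) 0 * ((T - H : ℕ) : ℝ) ^ 2) ≤
        ∑ Q ∈ Finset.Ico (T - H) (T - H + H), F N Q := by
      have : ∀ Q ∈ Finset.Ico (T - H) (T - H + H),
          max (ℓ η - ε) 0 * ((T - H : ℕ) : ℝ) ^ 2 ≤ F N Q := by
        intro Q hQ
        rw [Finset.mem_Ico, Nat.sub_add_cancel hHT] at hQ
        have hQ1 : ((T - H : ℕ) : ℝ) ≤ Q := by exact_mod_cast hQ.1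
        have hQ2 : (Q : ℝ) ≤ T := by exact_mod_cast hQ.2.le
        have hQ0 : (0 : ℝ) < Q := by linarith [(by positivity : (0 : ℝ) ≤ N₁), (by positivity : (0 : ℝ) ≤ N₂)]
        have hQN : N₁ ≤ Q := by
          rw [← Nat.cast_le (α := ℝ)]; linarith [(by positivity : (0 : ℝ) ≤ N₂)]
        have h1 := hN₁ Q hQN
        rw [lt_div_iff₀ (by positivity)] at h1
        have h2 : max (ℓ η - ε) 0 * (Q : ℝ) ^ 2 ≤ F (η * Q) Q := by
          rcases max_choice (ℓ η - ε) 0 with h | h <;> rw [h]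
          · exact h1.le
          · rw [zero_mul]; exact hnn _ _
        have h3 : η * Q ≤ N := by
          have := hQ2.trans hT1
          rw [le_div_iff₀ hη] at this
          linarith
        calc _ ≤ max (ℓ η - ε) 0 * (Q : ℝ) ^ 2 := by gcongr
          _ ≤ _ := h2.trans (hmono Q h3)
      have := Finset.card_nsmul_le_sum _ _ _ this
      simpa using this
    have up : ∑ Q ∈ Finset.Ico A' (A' + H), F N Q ≤
        H * ((ℓ η' + ε) * ((A' : ℝ) + H) ^ 2) := by
      have : ∀ Q ∈ Finset.Ico A' (A' + H), F N Q ≤ (ℓ η' + ε) * ((A' : ℝ) + H) ^ 2 := by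
        intro Q hQ
        rw [Finset.mem_Ico] at hQ
        have hQ1 : (A' : ℝ) ≤ Q := by exact_mod_cast hQ.1
        have hQ2 : (Q : ℝ) ≤ A' + H := by exact_mod_cast hQ.2.le
        have hQ0 : (0 : ℝ) < Q := by linarith [(by positivity : (0 : ℝ) ≤ N₁), (by positivity : (0 : ℝ) ≤ N₂)]
        have hQN : N₂ ≤ Q := by
          rw [← Nat.cast_le (α := ℝ)]; linarith [(by positivity : (0 : ℝ) ≤ N₁)]
        have h1 := hN₂ Q hQN
        rw [div_lt_iff₀ (by positivity)] at h1
        have h3 : (N : ℝ) ≤ η' * Q := by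
          have := hA1.trans hQ1
          rw [div_le_iff₀ hη'] at this
          linarith
        have h4 := hℓ0 η' hη' hη'1
        calc _ ≤ (ℓ η' + ε) * (Q : ℝ) ^ 2 := (hmono Q h3).trans h1.le
          _ ≤ _ := by gcongr
      have := Finset.sum_le_card_nsmul _ _ _ this
      simpa using this
    have hH0 : (0 : ℝ) < H := by nlinarith
    have h5 : max (ℓ η - ε) 0 * ((T - H : ℕ) : ℝ) ^ 2 ≤
        (1 + θ) * ((ℓ η' + ε) * ((A' : ℝ) + H) ^ 2) := by
      have := lo.trans (key.trans (mul_le_mul_of_nonneg_left up (by linarith : 0 ≤ 1 + θ)))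
      refine le_of_mul_le_mul_left (this.trans_eq ?_) hH0
      ring
    have h6 : ((1 - θ) / η - 1 / (N : ℝ)) ^ 2 * (N : ℝ) ^ 2 ≤ ((T - H : ℕ) : ℝ) ^ 2 := by
      rw [← mul_pow]
      have e : ((1 - θ) / η - 1 / (N : ℝ)) * N = (1 - θ) * (N / η) - 1 := by field_simp
      rw [e]
      have : 0 ≤ (1 - θ) * (N / η) - 1 := by
        have : (1 - θ) * (N / η) - 1 ≥ 3 / 4 * (m * N) - 1 := by nlinarith
        nlinarith
      gcongr
    have h7 : ((A' : ℝ) + H) ^ 2 ≤ ((1 + θ) / η' + 1 / (N : ℝ)) ^ 2 * (N : ℝ) ^ 2 := by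
      rw [← mul_pow]
      have e : ((1 + θ) / η' + 1 / (N : ℝ)) * N = (1 + θ) * (N / η') + 1 := by field_simp
      rw [e]
      have : (A' : ℝ) + H ≤ (1 + θ) * (N / η') + 1 := by linarith
      gcongr
    have h8 := hℓ0 η' hη' hη'1
    have h9 : (0 : ℝ) ≤ max (ℓ η - ε) 0 := le_max_right _ _
    refine le_of_mul_le_mul_right (a := (N : ℝ) ^ 2) ?_ (by positivity)
    calc _ = max (ℓ η - ε) 0 * (((1 - θ) / η - 1 / (N : ℝ)) ^ 2 * (N : ℝ) ^ 2) := by ring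
      _ ≤ max (ℓ η - ε) 0 * ((T - H : ℕ) : ℝ) ^ 2 := by gcongr
      _ ≤ _ := h5
      _ ≤ (1 + θ) * ((ℓ η' + ε) * (((1 + θ) / η' + 1 / (N : ℝ)) ^ 2 * (N : ℝ) ^ 2)) := by gcongr
      _ = _ := by ring
  have hinv : Tendsto (fun N : ℕ => 1 / (N : ℝ)) atTop (nhds 0) := tendsto_one_div_atTop_nhds_zero_nat
  have main2 : ∀ ε, 0 < ε → max (ℓ η - ε) 0 * ((1 - θ) / η) ^ 2 ≤
      (1 + θ) * ((ℓ η' + ε) * ((1 + θ) / η') ^ 2) := by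
    intro ε hε
    have t1 := ((hinv.const_sub ((1 - θ) / η)).pow 2).const_mul (max (ℓ η - ε) 0)
    have t2 := (((hinv.const_add ((1 + θ) / η')).pow 2).const_mul (ℓ η' + ε)).const_mul (1 + θ)
    rw [sub_zero] at t1
    rw [add_zero] at t2
    exact le_of_tendsto_of_tendsto t1 t2 (main ε hε)
  have c1 : Tendsto (fun ε : ℝ => max (ℓ η - ε) 0 * ((1 - θ) / η) ^ 2)
      (nhdsWithin 0 (Set.Ioi 0)) (nhds (max (ℓ η - 0) 0 * ((1 - θ) / η) ^ 2)) :=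
    (Continuous.tendsto (by fun_prop) _).mono_left nhdsWithin_le_nhds
  have c2 : Tendsto (fun ε : ℝ => (1 + θ) * ((ℓ η' + ε) * ((1 + θ) / η') ^ 2))
      (nhdsWithin 0 (Set.Ioi 0)) (nhds ((1 + θ) * ((ℓ η' + 0) * ((1 + θ) / η') ^ 2))) :=
    (Continuous.tendsto (by fun_prop) _).mono_left nhdsWithin_le_nhds
  have fin := le_of_tendsto_of_tendsto c1 c2
    (eventually_nhdsWithin_of_forall fun ε hε => main2 ε hε)
  rw [sub_zero, add_zero, max_eq_left (hℓ0 η hη hη1)] at fin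
  calc _ = ℓ η * ((1 - θ) / η) ^ 2 := by rw [div_pow]; ring
    _ ≤ _ := fin
    _ = _ := by rw [div_pow]; ring

lemma tendsto_of_window {F : ℝ → ℕ → ℝ} (hmono : ∀ Q, Monotone fun Y => F Y Q)
    {ℓ : ℝ → ℝ} (hnn : ∀ Y Q, 0 ≤ F Y Q) {η₁ : ℝ} (hη₁ : 0 < η₁)
    (hℓ : ∀ η, 0 < η → η < η₁ →
      Tendsto (fun Q : ℕ => F (η * Q) Q / (Q : ℝ) ^ 2) atTop (nhds (ℓ η)))
    (hwin : WindowUniform F) :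
    ∃ l, Tendsto (fun η => ℓ η / η ^ 2) (nhdsWithin 0 (Set.Ioi 0)) (nhds l) := by
  have hφ0 : ∀ η, 0 < η → η < η₁ → 0 ≤ ℓ η / η ^ 2 := fun η h1 h2 => by
    have : 0 ≤ ℓ η := ge_of_tendsto (hℓ η h1 h2)
      (Eventually.of_forall fun Q => by have := hnn (η * Q) Q; positivity)
    positivity
  obtain ⟨η₂, hη₂, hB⟩ := limit_le_of_window hmono hnn hℓ hwin (θ := 1 / 4) (by norm_num) le_rfl
  obtain ⟨y, hy0, hy⟩ : ∃ y, 0 < y ∧ y < min η₁ η₂ := exists_between (lt_min hη₁ hη₂)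
  have hy1 := hy.trans_le (min_le_left _ _)
  have hy2 := hy.trans_le (min_le_right _ _)
  obtain ⟨M, hM0, hM⟩ : ∃ M : ℝ, 0 < M ∧ ∀ η, 0 < η → η < min η₁ η₂ → ℓ η / η ^ 2 ≤ M := by
    refine ⟨4 * (ℓ y / y ^ 2) + 1, by have := hφ0 y hy0 hy1; positivity, fun η h1 h2 => ?_⟩
    have := hB η y h1 (h2.trans_le (min_le_right _ _)) (h2.trans_le (min_le_left _ _)) hy0 hy2 hy1
    have h3 := hφ0 y hy0 hy1
    norm_num at this
    linarith
  refine cauchy_map_iff_exists_tendsto.1 (Metric.cauchy_iff.2 ⟨inferInstance, fun ε hε => ?_⟩)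
  set θ := min (1 / 4) (ε / (12 * M)) with hθ
  have hθ0 : 0 < θ := lt_min (by norm_num) (by positivity)
  have hθ1 : θ ≤ 1 / 4 := min_le_left _ _
  have hθ2 : 12 * M * θ ≤ ε := by
    have : θ ≤ ε / (12 * M) := min_le_right _ _
    rw [le_div_iff₀ (by positivity)] at this
    linarith
  obtain ⟨η₀, hη₀, hC⟩ := limit_le_of_window hmono hnn hℓ hwin hθ0 hθ1
  have key : ∀ a b, 0 < a → a < min η₀ (min η₁ η₂) → 0 < b → b < min η₀ (min η₁ η₂) →
      ℓ a / a ^ 2 - ℓ b / b ^ 2 < ε := by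
    intro a b ha ha' hb hb'
    rw [lt_min_iff, lt_min_iff] at ha' hb'
    have h1 := hC a b ha ha'.1 ha'.2.1 hb hb'.1 hb'.2.1
    have h2 := hM b hb (lt_min hb'.2.1 hb'.2.2)
    have h3 := hφ0 b hb hb'.2.1
    set x := ℓ a / a ^ 2
    set y := ℓ b / b ^ 2
    have h4 : (1 - θ) ^ 2 * (x - y) ≤ (6 * θ) * M := by
      have e : (1 + θ) ^ 3 - (1 - θ) ^ 2 ≤ 6 * θ := by
        have q2 : θ ^ 2 ≤ 1 / 4 * θ := by nlinarith
        have q3 : θ ^ 3 ≤ 1 / 4 * (1 / 4 * θ) := by nlinarith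
        nlinarith
      have : y * ((1 + θ) ^ 3 - (1 - θ) ^ 2) ≤ y * (6 * θ) := by gcongr
      nlinarith
    have h5 : (9 / 16 : ℝ) ≤ (1 - θ) ^ 2 := by nlinarith
    by_contra hlt
    rw [not_lt] at hlt
    nlinarith
  refine ⟨_, image_mem_map (Ioo_mem_nhdsGT (lt_min hη₀ (lt_min hη₁ hη₂))), ?_⟩
  rintro _ ⟨a, ha, rfl⟩ _ ⟨b, hb, rfl⟩
  rw [Real.dist_eq, abs_lt]
  have h1 := key a b ha.1 ha.2 hb.1 hb.2
  have h2 := key b a hb.1 hb.2 ha.1 ha.2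
  constructor <;> linarith

section

variable {d c s : ℕ}

lemma bishear_fst (d : ℕ) (k a b : ℤ) (W : ℤ × ℤ) : (bishear d k a b W).1 = W.1 := by
  unfold bishear; split_ifs <;> rfl

lemma bishear_center (d : ℕ) (k a b : ℤ) : bishear d k a b (0, 1) = (0, 1) := by
  simp [bishear, shear]

lemma ev_bishear {k a b Q Q' : ℤ} {z W : ℤ × ℤ} (ha : 1 ≤ a) (hb : 1 ≤ b)
    (hα : W.1 = a ∨ W.1 = -b) (hQ' : Q' = Q + k * a * b * d * z.2) :
    ev (bishear d k a b W) z = ev W z + (Q' - Q) := by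
  rcases hα with h | h
  · rw [bishear, if_pos (by omega), ev_shear', h, hQ']; ring
  · rw [bishear, if_neg (by omega), ev_shear', h, hQ']; ring

/-- Offsets from the corner of the tuples around the vector `(0, 1)`, with bounded first
coordinates satisfying `T` and with the value of `(0, 1)` comparable to `ν o`. -/
def CuspOff (d c : ℕ) {s : ℕ} (A C : ℤ) (T : (Fin (s + 1) → ℤ) → Prop) (ν : (Fin (s + 1) → ℤ) → ℤ)
    (o : Fin (s + 1) → ℤ) (Q : ℤ) : Prop :=
  ∃ (z : ℤ × ℤ) (V : Fin (s + 1) → ℤ × ℤ) (a b : ℤ), IsCoprime z.1 z.2 ∧ 0 < z.2 ∧ z.2 ∣ ν o ∧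
    ν o ≠ 0 ∧ |ν o| ≤ C * z.2 ∧ Cons d c Q z V ∧ 1 ≤ a ∧ a ≤ A ∧ 1 ≤ b ∧ b ≤ A ∧
    (∀ i, (V i).1 = a ∨ (V i).1 = -b ∨ V i = (0, 1)) ∧ T (fun i => (V i).1) ∧
    ∀ i, ev (V i) z = (if (V i).1 = 0 then 0 else Q) - o i

lemma CuspOff.shift {A C : ℤ} {T : (Fin (s + 1) → ℤ) → Prop} {ν : (Fin (s + 1) → ℤ) → ℤ}
    {o : Fin (s + 1) → ℤ} {Q Q' : ℤ} {Y : ℝ} (h : CuspOff d c A C T ν o Q) (hd : 0 < d)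
    (ho : ∀ i, |(o i : ℝ)| < Y) (hν : |(ν o : ℝ)| ≤ 2 * Y) {k : ℤ}
    (hQ' : Q' = Q + k * (d * (A.toNat.factorial : ℤ) ^ 2 * ν o))
    (hQY : (2 * (A + 1) + 2 * A ^ 2 * d + 3) * Y ≤ Q)
    (hQY' : (2 * (A + 1) + 2 * A ^ 2 * d + 3) * Y ≤ Q') : CuspOff d c A C T ν o Q' := by
  obtain ⟨z, V, a, b, hz, hn, hnν, hν0, hνC, hV, ha, haA, hb, hbA, hα, hT, hval⟩ := h
  obtain ⟨g, hg⟩ := hnν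
  have hfac : ∀ x, 1 ≤ x → x ≤ A → x ∣ (A.toNat.factorial : ℤ) := by
    intro x h1 h2
    have : x = (x.toNat : ℤ) := by omega
    rw [this]
    exact Int.natCast_dvd_natCast.2 (Nat.dvd_factorial (by omega) (by omega))
  obtain ⟨a', ha'⟩ := hfac a ha haA
  obtain ⟨b', hb'⟩ := hfac b hb hbA
  have hY0 : 0 < Y := (abs_nonneg _).trans_lt (ho 0)
  have hQ2 : Q' = Q + (k * g * a' * b') * a * b * d * z.2 := by
    rw [hQ', hg, sq]
    nth_rewrite 1 [ha']
    rw [hb']; ring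
  have hA1 : 1 ≤ A := ha.trans haA
  have hA1' : (1 : ℝ) ≤ A := by exact_mod_cast hA1
  have hd1 : (1 : ℝ) ≤ d := by exact_mod_cast hd
  have hnY : (z.2 : ℝ) ≤ 2 * Y := by
    have : z.2 ≤ |ν o| := Int.le_of_dvd (abs_pos.2 hν0) ((dvd_abs _ _).2 ⟨g, hg⟩)
    calc (z.2 : ℝ) ≤ ((|ν o| : ℤ) : ℝ) := by exact_mod_cast this
      _ = |(ν o : ℝ)| := by push_cast; rfl
      _ ≤ _ := hν
  have hA2 : (0 : ℝ) ≤ 2 * A ^ 2 * d * Y := by positivity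
  have hA3 : (0 : ℝ) ≤ A * Y := by positivity
  have hoff : ∀ i, (V i).1 ≠ 0 → o i = Q - ev (V i) z := fun i hi => by
    have := hval i
    rw [if_neg hi] at this
    linarith
  have small : ∀ x, 1 ≤ x → x ≤ A → x ^ 2 * d * z.2 < Q := by
    intro x h1 h2
    have h3 : x ^ 2 * d * z.2 ≤ A ^ 2 * d * z.2 := by gcongr
    have h4 : (A : ℝ) ^ 2 * d * z.2 ≤ A ^ 2 * d * (2 * Y) := by gcongr
    refine h3.trans_lt ?_
    rw [← Int.cast_lt (R := ℝ)]; push_cast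
    linarith
  refine ⟨z, fun i => bishear d (k * g * a' * b') a b (V i), a, b, hz, hn, ⟨g, hg⟩, hν0, hνC,
    cons_bishear hV hd hn ha hb hα hQ2 ?_ (small a ha haA) (small b hb hbA) ?_,
    ha, haA, hb, hbA, ?_, ?_, ?_⟩
  · intro i hi
    rw [← hoff i hi]
    have h0 : 0 ≤ o i := by
      rw [hoff i hi]; have := (hV.1 i).2.2.1; linarith
    have h1 : (a + b + 1) * o i ≤ (A + A + 1) * o i := by gcongr
    refine h1.trans_lt ?_
    have h2 : (o i : ℝ) ≤ Y := (le_abs_self _).trans (ho i).le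
    have h3 : ((A : ℝ) + A + 1) * o i ≤ (A + A + 1) * Y := by gcongr
    rw [← Int.cast_lt (R := ℝ)]; push_cast
    linarith
  · rw [← Int.cast_le (R := ℝ)]
    linarith
  · intro i
    beta_reduce
    rw [bishear_fst]
    rcases hα i with h | h | h
    · exact Or.inl h
    · exact Or.inr (Or.inl h)
    · exact Or.inr (Or.inr (by rw [h, bishear_center]))
  · simpa only [bishear_fst] using hT
  · intro i
    beta_reduce
    rw [bishear_fst]
    have := hval i
    rcases hα i with h | h | h
    · rw [ev_bishear ha hb (Or.inl h) hQ2, this, if_neg (by omega), if_neg (by omega)]; ring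
    · rw [ev_bishear ha hb (Or.inr h) hQ2, this, if_neg (by omega), if_neg (by omega)]; ring
    · rw [h, bishear_center, ← h, this, h]; simp

lemma windowUniform_cuspOff {A C : ℤ} (hd : 0 < d) (T : (Fin (s + 1) → ℤ) → Prop)
    {ν : (Fin (s + 1) → ℤ) → ℤ}
    (hν : ∀ (o : Fin (s + 1) → ℤ) (Y : ℝ), (∀ i, |(o i : ℝ)| < Y) → |(ν o : ℝ)| ≤ 2 * Y) :
    WindowUniform (offsetCount fun o (Q : ℕ) => CuspOff d c A C T ν o Q) := by
  have hF : (0 : ℝ) < d * (A.toNat.factorial : ℝ) ^ 2 := by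
    have : (0 : ℝ) < A.toNat.factorial := by exact_mod_cast Nat.factorial_pos _
    have : (0 : ℝ) < d := by exact_mod_cast hd
    positivity
  refine windowUniform_offsetCount (C := d * (A.toNat.factorial : ℝ) ^ 2 * 2 + 1)
    (R₀ := 2 * (A + 1) + 2 * A ^ 2 * d + 3) (by positivity) ?_
  intro o Y hY ho
  by_cases h0 : ν o = 0
  · refine ⟨1, one_pos, ?_, fun Q _ => ⟨?_, ?_⟩⟩
    · push_cast
      nlinarith
    · rintro ⟨z, V, a, b, -, -, -, h, -⟩; exact absurd h0 h
    · rintro ⟨z, V, a, b, -, -, -, h, -⟩; exact absurd h0 h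
  have hcast : ((ν o).natAbs : ℝ) = |(ν o : ℝ)| := by
    rw [Nat.cast_natAbs]; push_cast; rfl
  obtain ⟨e, he⟩ : ∃ e : ℤ, ((ν o).natAbs : ℤ) = e * ν o ∧ e * e = 1 := by
    rcases Int.natAbs_eq (ν o) with h | h
    · exact ⟨1, by omega, by norm_num⟩
    · exact ⟨-1, by omega, by norm_num⟩
  refine ⟨d * A.toNat.factorial ^ 2 * (ν o).natAbs, ?_, ?_, fun Q hQ => ⟨fun h => ?_, fun h => ?_⟩⟩
  · have := Nat.factorial_pos A.toNat
    have := Int.natAbs_pos.2 h0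
    positivity
  · push_cast [hcast]
    calc _ ≤ (d * (A.toNat.factorial : ℝ) ^ 2) * (2 * Y) := by gcongr; exact hν o Y ho
      _ ≤ _ := by nlinarith
  · refine h.shift (k := e) hd ho (hν o Y ho) ?_ hQ ?_
    · push_cast [he.1]; ring
    · refine hQ.trans ?_
      push_cast
      have : (0 : ℝ) ≤ d * A.toNat.factorial ^ 2 * |(ν o : ℝ)| := by positivity
      linarith
  · refine h.shift (k := -e) hd ho (hν o Y ho) ?_ ?_ hQ
    · push_cast [he.1]; ring
    · refine hQ.trans ?_
      push_cast
      have : (0 : ℝ) ≤ d * A.toNat.factorial ^ 2 * |(ν o : ℝ)| := by positivity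
      linarith

/-- Offsets of a tuple from a corner. -/
def offs {s : ℕ} (p : Option (Fin (s + 1))) (Q : ℤ) (q : Fin (s + 1) → ℤ) (i : Fin (s + 1)) : ℤ :=
  (if p = some i then 0 else Q) - q i

lemma offs_offs {s : ℕ} (p : Option (Fin (s + 1))) (Q : ℤ) (q : Fin (s + 1) → ℤ) :
    offs p Q (offs p Q q) = q := by
  ext i; simp [offs]

lemma mem_cube_cornerPt {s : ℕ} (p : Option (Fin (s + 1))) {Q : ℕ} (hQ : 0 < Q)
    (q : Fin (s + 1) → ℤ) (η : ℝ) : (fun i => (q i : ℝ) / Q) ∈ cube (cornerPt p) η ↔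
      ∀ i, |(offs p Q q i : ℝ)| < η * Q := by
  have hQ0 : (0 : ℝ) < Q := by exact_mod_cast hQ
  refine forall_congr' fun i => ?_
  rw [← div_lt_iff₀ hQ0]
  have e : |(offs p Q q i : ℝ)| / Q = |(q i : ℝ) / Q - cornerPt p i| := by
    rw [← abs_of_pos hQ0, ← abs_div, abs_of_pos hQ0, ← abs_neg]
    congr 1
    rw [offs, cornerPt]
    split_ifs <;> push_cast <;> field_simp <;> ring
  rw [e]

lemma offsetCount_eq {s : ℕ} (p : Option (Fin (s + 1))) (X : (Fin (s + 1) → ℤ) → ℕ → Prop) {Q : ℕ}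
    (hQ : 0 < Q) (η : ℝ) : offsetCount X (η * Q) Q =
      ({q : Fin (s + 1) → ℤ | (fun i => (q i : ℝ) / Q) ∈ cube (cornerPt p) η ∧
        X (offs p Q q) Q}.ncard : ℝ) := by
  rw [offsetCount]
  congr 1
  have hinj : Function.Injective (offs (s := s) p Q) :=
    Function.LeftInverse.injective fun q => offs_offs p (Q : ℤ) q
  rw [← Set.ncard_image_of_injective _ hinj]
  congr 1
  ext q
  simp only [Set.mem_image, Set.mem_ofPred_eq, mem_cube_cornerPt p hQ]
  constructor
  · rintro ⟨o, ⟨h1, h2⟩, rfl⟩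
    rw [offs_offs]; exact ⟨h1, h2⟩
  · intro h
    exact ⟨_, h, offs_offs p Q q⟩

end

lemma limit_of_inner_corner {d : ℕ} (hd : 2 ≤ d) (c : ℕ) {s : ℕ} {i : Fin (s + 1)} (hi0 : 0 < i)
    (hi1 : i < Fin.last s) {ℓ : ℝ → ℝ} (hℓ : ∀ η, 0 < η →
      Tendsto (fun Q : ℕ => ({q ∈ Dt d c s Q | (fun j => (q j : ℝ) / Q) ∈
        cube (cornerPt (some i)) η}.ncard : ℝ) / (Q : ℝ) ^ 2) atTop (nhds (ℓ η))) :
    ∃ l, Tendsto (fun η => ℓ η / η ^ 2) (nhdsWithin 0 (Set.Ioi 0)) (nhds l) := by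
  obtain ⟨A, M, hA, hM, H⟩ := exists_cusp_structure hd c s
  have hM0 : (0 : ℝ) < M := by exact_mod_cast hM
  refine tendsto_of_window (F := offsetCount fun o (Q : ℕ) => CuspOff d c A 1
    (fun α => ∀ j, α j = 0 ↔ j = i) (fun o => o i) o Q) (η₁ := 1 / M) (offsetCount_mono _)
    (offsetCount_nonneg _) (by positivity) (fun η hη hη1 => ?_)
    (windowUniform_cuspOff (by omega) _ fun o Y ho => ?_)
  · refine (hℓ η hη).congr' ?_
    filter_upwards [eventually_gt_atTop 0] with Q hQ
    rw [offsetCount_eq (some i) _ hQ]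
    have hQ0 : (0 : ℝ) < Q := by exact_mod_cast hQ
    congr 3
    ext q
    simp only [Set.mem_ofPred_eq]
    rw [and_comm]
    refine and_congr_right fun hq => ?_
    have hqi := hq i
    simp only [cornerPt, if_true, sub_zero] at hqi
    constructor
    · rintro ⟨z, V, hz, hV, hqV⟩
      have hpos := hV.pos i
      have hst : Straddle M Q z V (V i) := by
        refine ⟨(hV.1 i).1, hpos, ?_, hV.dt_pos hi0, hV.dt_pos hi1⟩
        rw [← hqV i]
        have h1 := (le_abs_self _).trans (hqi.le.trans hη1.le)
        rw [div_le_div_iff₀ hQ0 hM0] at h1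
        rw [← Int.cast_le (R := ℝ)]; push_cast; linarith
      obtain ⟨z', g, hg, hgw, hn, hnw, a, b, ha, haA, hb, hbA, hi⟩ := H Q z V _ hz hV M le_rfl hst
      have hzero : ∀ j, (g (V j)).1 = 0 ↔ j = i := by
        intro j
        constructor
        · intro h0
          rcases hi j with h | h | h
          · have := h.1; omega
          · have := h.1; omega
          · exact hV.injective h.2
        · rintro rfl
          rw [hgw]
      refine ⟨z', fun j => g (V j), a, b, hg.cop_pt.2 hz, hn, ?_, ?_, ?_, hg.cons hV, ha, haA, hb,
        hbA, ?_, hzero, ?_⟩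
      · simp [offs, hqV i, hnw]
      · simp only [offs, if_true, zero_sub, hqV i]; omega
      · simp only [offs, if_true, zero_sub, hqV i, hnw, abs_neg, one_mul, abs_of_pos hpos]; exact le_rfl
      · intro j
        rcases hi j with h | h | h
        · exact Or.inl h.1
        · exact Or.inr (Or.inl h.1)
        · exact Or.inr (Or.inr h.1)
      · intro j
        beta_reduce
        rw [hg.ev_eq, ← hqV, offs]
        simp only [hzero, Option.some.injEq, eq_comm (a := i)]
        ring
    · rintro ⟨z, V, a, b, hz, -, -, -, -, hV, -, -, -, -, -, hT, hval⟩
      refine ⟨z, V, hz, hV, fun j => ?_⟩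
      rw [hval j, offs]
      have := hT j
      beta_reduce at this
      simp only [this, Option.some.injEq, eq_comm (a := i)]
      ring
  · have h1 := ho i
    have h2 := abs_nonneg (o i : ℝ)
    linarith

section

variable {d c s : ℕ} {Q : ℤ} {z w : ℤ × ℤ} {V : Fin (s + 1) → ℤ × ℤ} {i₀ i₁ i₂ : Fin (s + 1)}

lemma exists_linear_bound {s : ℕ} {S : ℕ → Set (Fin (s + 1) → ℤ)} (i₁ : Fin (s + 1)) (B : ℤ)
    {R : (Fin (s + 1) → ℤ) → (Fin (s + 1) → Fin (s + 1) → ℤ) → (Fin (s + 1) → Fin (s + 1) → ℤ) → Prop}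
    (hS : ∀ Q, ∀ q ∈ S Q, 0 ≤ q i₁ ∧ q i₁ ≤ Q ∧
      ∃ D D', (∀ i j, |D i j| ≤ B) ∧ (∀ i j, |D' i j| ≤ B) ∧ R q D D')
    (hR : ∀ q q' D D', R q D D' → R q' D D' → q i₁ = q' i₁ → q = q') :
    ∃ C : ℝ, ∀ Q, ((S Q).ncard : ℝ) ≤ C * ((Q : ℝ) + 1) := by
  set 𝓓 : Set (Fin (s + 1) → Fin (s + 1) → ℤ) := {D | ∀ i j, |D i j| ≤ B} with h𝓓
  have hfin : 𝓓.Finite := by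
    refine (Set.Finite.pi' fun _ => Set.Finite.pi' fun _ => Set.finite_Icc (-B) B).subset ?_
    exact fun D hD i j => abs_le.1 (hD i j)
  refine ⟨((𝓓 ×ˢ 𝓓).ncard : ℝ), fun Q => ?_⟩
  have : ∀ q, ∃ p : (Fin (s + 1) → Fin (s + 1) → ℤ) × (Fin (s + 1) → Fin (s + 1) → ℤ),
      q ∈ S Q → p ∈ 𝓓 ×ˢ 𝓓 ∧ R q p.1 p.2 := by
    intro q
    by_cases hq : q ∈ S Q
    · obtain ⟨-, -, D, D', h1, h2, h3⟩ := hS Q q hq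
      exact ⟨(D, D'), fun _ => ⟨⟨h1, h2⟩, h3⟩⟩
    · exact ⟨(0, 0), fun h => absurd h hq⟩
  choose f hf using this
  have h1 : (S Q).ncard ≤ ((𝓓 ×ˢ 𝓓) ×ˢ Set.Icc (0 : ℤ) Q).ncard := by
    refine Set.ncard_le_ncard_of_injOn (fun q => (f q, q i₁)) (fun q hq => ?_) ?_
      ((hfin.prod hfin).prod (Set.finite_Icc _ _))
    · exact ⟨(hf q hq).1, (hS Q q hq).1, (hS Q q hq).2.1⟩
    · intro q hq q' hq' h
      simp only [Prod.mk.injEq] at h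
      have h2 := (hf q' hq').2
      rw [← h.1] at h2
      exact hR _ _ _ _ (hf q hq).2 h2 h.2
  rw [Set.ncard_prod, ← Finset.coe_Icc, Set.ncard_coe_finset, Int.card_Icc] at h1
  have h2 : ((Q : ℤ) + 1 - 0).toNat = Q + 1 := by omega
  rw [h2] at h1
  exact_mod_cast h1

lemma exists_primitive {D z : ℤ × ℤ} (h : ev D z ≠ 0) : ∃ (w : ℤ × ℤ) (g : ℤ),
    IsCoprime w.1 w.2 ∧ 0 < ev w z ∧ D = (g * w.1, g * w.2) := by
  have hg : 0 < Int.gcd D.1 D.2 := by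
    rw [Nat.pos_iff_ne_zero]
    intro h0
    rw [Int.gcd_eq_zero_iff] at h0
    exact h (by simp [ev, h0.1, h0.2])
  obtain ⟨x, y, hxy, hx, hy⟩ := Int.exists_gcd_one hg
  rw [← Int.isCoprime_iff_gcd_eq_one] at hxy
  have e : ev D z = ev (x, y) z * Int.gcd D.1 D.2 := by
    rw [ev, ev]; nth_rewrite 1 [hx]; nth_rewrite 2 [hy]; ring
  have h0 : ev (x, y) z ≠ 0 := fun h0 => h (by rw [e, h0, zero_mul])
  rcases lt_or_gt_of_ne h0 with h1 | h1
  · refine ⟨(-x, -y), -Int.gcd D.1 D.2, hxy.neg_neg, ?_, ?_⟩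
    · simp only [ev] at h1 ⊢; linarith
    · ext
      · simp only; linarith
      · simp only; linarith
  · refine ⟨(x, y), Int.gcd D.1 D.2, hxy, h1, ?_⟩
    ext
    · simp only; linarith
    · simp only; linarith

/-- The first two first coordinates agree. -/
def HeadEq (i₀ i₁ : Fin (s + 1)) (α : Fin (s + 1) → ℤ) : Prop := (∀ j, α j ≠ 0) ∧ α i₀ = α i₁

/-- The sign of the first coordinates changes at the beginning. -/
def HeadNe (i₀ i₁ i₂ : Fin (s + 1)) (α : Fin (s + 1) → ℤ) : Prop :=
  (∀ j, α j ≠ 0) ∧ 0 < α i₀ ∧ α i₁ < 0 ∧ α i₁ = α i₂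

lemma cuspOff_of_bdd {B A C : ℤ} (hz : IsCoprime z.1 z.2) (hV : Cons d c Q z V)
    (hB : ∀ i j, |dt (V i) (V j)| ≤ B) (hclose : ∀ j, (2 * B + 2) * (Q - ev (V j) z) < Q)
    (h01 : i₀ < i₁) (hne : ev (V i₀) z ≠ ev (V i₁) z) (hA : B ≤ A) (hC : B ≤ C) :
    CuspOff d c A C (HeadEq i₀ i₁) (fun o => o i₀ - o i₁) (offs none Q fun j => ev (V j) z) Q := by
  have h01p := hV.dt_pos h01
  have hB0 : 0 < B := h01p.trans_le ((le_abs_self _).trans (hB _ _))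
  have hle : ∀ j, ev (V j) z ≤ Q := fun j => (hV.1 j).2.2.1
  have hlin : ∀ j, dt (V i₀) (V j) = dt (V i₁) (V j) + dt (V i₀) (V i₁) := by
    intro j
    have e := ev_mul_dt z (V i₀) (V i₁) (V j)
    by_contra hn
    set X := dt (V i₀) (V j) - dt (V i₁) (V j) - dt (V i₀) (V i₁) with hX
    have hX0 : X ≠ 0 := fun h => hn (by linarith)
    have e2 : ev (V i₁) z * X = (ev (V i₀) z - ev (V i₁) z) * dt (V i₁) (V j) +
        (ev (V j) z - ev (V i₁) z) * dt (V i₀) (V i₁) := by rw [hX]; linear_combination e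
    have h1 : ev (V i₁) z ≤ |ev (V i₁) z * X| := by
      rw [abs_mul, abs_of_pos (hV.pos i₁)]
      have := Int.one_le_abs hX0
      nlinarith [hV.pos i₁]
    have hdiff : ∀ k, (2 * B + 2) * |ev (V k) z - ev (V i₁) z| < Q := by
      intro k
      rcases abs_cases (ev (V k) z - ev (V i₁) z) with ⟨h, -⟩ | ⟨h, -⟩ <;> rw [h]
      · nlinarith [hclose i₁, hle k]
      · nlinarith [hclose k, hle i₁]
    have h2 : |ev (V i₁) z * X| ≤ |ev (V i₀) z - ev (V i₁) z| * B + |ev (V j) z - ev (V i₁) z| * B := by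
      rw [e2]
      refine (abs_add_le _ _).trans ?_
      rw [abs_mul, abs_mul]
      gcongr
      · exact hB _ _
      · exact hB _ _
    have h3 : (2 * B + 2) * ev (V i₁) z ≤ 2 * B * Q := by
      calc (2 * B + 2) * ev (V i₁) z ≤ (2 * B + 2) * (|ev (V i₀) z - ev (V i₁) z| * B +
            |ev (V j) z - ev (V i₁) z| * B) := by
            have := h1.trans h2
            gcongr
        _ = B * ((2 * B + 2) * |ev (V i₀) z - ev (V i₁) z|) +
            B * ((2 * B + 2) * |ev (V j) z - ev (V i₁) z|) := by ring
        _ ≤ B * Q + B * Q := by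
            have := (hdiff i₀).le
            have := (hdiff j).le
            gcongr
        _ = _ := by ring
    linarith [hclose i₁, hle i₁, hV.pos i₁]
  set D : ℤ × ℤ := ((V i₁).1 - (V i₀).1, (V i₁).2 - (V i₀).2) with hD
  have hevD : ev D z = ev (V i₁) z - ev (V i₀) z := by simp only [hD, ev]; ring
  obtain ⟨w, m, hw, hwz, hDw⟩ := exists_primitive (D := D) (z := z) (by rw [hevD]; omega)
  have hdtD : ∀ j, m * dt (V j) w = dt (V i₀) (V i₁) := by
    intro j
    have e1 : dt (V j) D = m * dt (V j) w := by rw [hDw]; simp only [dt]; ring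
    have e2 : dt (V j) D = dt (V i₀) (V j) - dt (V i₁) (V j) := by simp only [hD, dt]; ring
    rw [← e1, e2, hlin j]; ring
  have hm0 : m ≠ 0 := by rintro rfl; have := hdtD i₀; omega
  set α := dt (V i₀) w with hα
  have hall : ∀ j, dt (V j) w = α := fun j =>
    mul_left_cancel₀ hm0 ((hdtD j).trans (hdtD i₀).symm)
  have hα0 : α ≠ 0 := by
    intro h
    have := hdtD i₀
    rw [← hα, h] at this; omega
  have hprod : |m| * |α| ≤ B := by
    rw [← abs_mul, hα, hdtD i₀]; exact hB _ _
  have hm1 := Int.one_le_abs hm0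
  have hα1 := Int.one_le_abs hα0
  have hmB : |m| ≤ B := by nlinarith
  have hαB : |α| ≤ B := by nlinarith
  obtain ⟨g, z', hg, hgw, -, -, hnw⟩ := exists_gauge_center hw hwz
  have hfst : ∀ j, (g (V j)).1 = α := by
    intro j
    have := hg.dt_eq (V j) w
    rw [hgw, hall j] at this
    simpa [dt] using this
  have hν : offs none Q (fun j => ev (V j) z) i₀ - offs none Q (fun j => ev (V j) z) i₁ = m * z'.2 := by
    have : ev D z = m * ev w z := by rw [hDw]; simp only [ev]; ring
    simp only [offs, reduceCtorEq, if_false]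
    rw [hnw, ← this, hevD]; ring
  refine ⟨z', fun j => g (V j), |α|, |α|, hg.cop_pt.2 hz, by rw [hnw]; exact hwz, ?_, ?_, ?_,
    hg.cons hV, hα1, hαB.trans hA, hα1, hαB.trans hA, fun j => ?_, ⟨fun j => ?_, ?_⟩, fun j => ?_⟩
  · beta_reduce; rw [hν]; exact dvd_mul_left _ _
  · beta_reduce; rw [hν, hnw]; exact mul_ne_zero hm0 hwz.ne'
  · beta_reduce
    rw [hν, hnw, abs_mul, abs_of_pos hwz]
    have := hmB.trans hC
    gcongr
  · beta_reduce
    rw [hfst]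
    rcases abs_cases α with ⟨h, -⟩ | ⟨h, -⟩ <;> rw [h]
    · exact Or.inl rfl
    · exact Or.inr (Or.inl (by ring))
  · beta_reduce; rw [hfst]; exact hα0
  · beta_reduce; rw [hfst, hfst]
  · beta_reduce
    rw [hfst, if_neg hα0, hg.ev_eq]
    simp [offs]

lemma exists_cuspOff_of_straddle (hd : 2 ≤ d) (c s : ℕ) : ∃ A C K : ℤ, 0 < A ∧ 0 < C ∧ 0 < K ∧
    ∀ (Q : ℤ) (z : ℤ × ℤ) (V : Fin (s + 1) → ℤ × ℤ) (w : ℤ × ℤ) (i₀ i₁ i₂ : Fin (s + 1)),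
      IsCoprime z.1 z.2 → Cons d c Q z V → Straddle K Q z V w → i₀ < i₁ → i₁ < i₂ →
      (∀ j, Q < 2 * ev (V j) z) → ∀ A' C', A ≤ A' → C ≤ C' →
      CuspOff d c A' C' (HeadEq i₀ i₁) (fun o => o i₀ - o i₁)
        (offs none Q fun j => ev (V j) z) Q ∨
      CuspOff d c A' C' (HeadNe i₀ i₁ i₂) (fun o => o i₁ - o i₂)
        (offs none Q fun j => ev (V j) z) Q := by
  obtain ⟨A, M, hA, hM, H⟩ := exists_cusp_structure hd c s
  refine ⟨A, M, M + 1, hA, hM, by omega, ?_⟩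
  intro Q z V w i₀ i₁ i₂ hz hV hst h01 h12 hclose A' C' hAA' hCC'
  obtain ⟨z', g, hg, hgw, hn, hnw, a, b, ha, haA, hb, hbA, hi⟩ := H Q z V w hz hV _ (by omega) hst
  have hV' := hg.cons hV
  have hi' : ∀ j, ((g (V j)).1 = a ∨ (g (V j)).1 = -b) ∧ Q - M * z'.2 ≤ ev (V j) z := by
    intro j
    rcases hi j with h | h | h
    · exact ⟨Or.inl h.1, h.2.1⟩
    · exact ⟨Or.inr h.1, h.2.1⟩
    · exfalso
      have h1 := hst.2.2.1
      have h2 := hclose j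
      rw [h.2] at h2
      nlinarith [hst.2.1]
  have hfst0 : ∀ j, (g (V j)).1 ≠ 0 := fun j => by rcases (hi' j).1 with h | h <;> omega
  -- vectors on the same side
  have pair : ∀ j k : Fin (s + 1), j < k → (g (V j)).1 = (g (V k)).1 →
      z'.2 ∣ offs none Q (fun j => ev (V j) z) j - offs none Q (fun j => ev (V j) z) k ∧
      offs none Q (fun j => ev (V j) z) j - offs none Q (fun j => ev (V j) z) k ≠ 0 ∧
      |offs none Q (fun j => ev (V j) z) j - offs none Q (fun j => ev (V j) z) k| ≤ C' * z'.2 := by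
    intro j k hjk hf
    have e : offs none Q (fun j => ev (V j) z) j - offs none Q (fun j => ev (V j) z) k =
        ((g (V k)).2 - (g (V j)).2) * z'.2 := by
      simp only [offs, reduceCtorEq, if_false]
      have e1 := hg.ev_eq (V j)
      have e2 := hg.ev_eq (V k)
      simp only [ev] at e1 e2 ⊢
      rw [← hf] at e2
      linear_combination e1 - e2
    refine ⟨by rw [e]; exact dvd_mul_left _ _, ?_, ?_⟩
    · rw [e]
      refine mul_ne_zero (fun h0 => ?_) hn.ne'
      have := hV'.dt_pos hjk
      simp only [dt, hf] at this
      rw [show (g (V k)).2 = (g (V j)).2 by omega] at this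
      linarith
    · have h1 := (hi' j).2
      have h2 := (hi' k).2
      have h3 := (hV.1 j).2.2.1
      have h4 := (hV.1 k).2.2.1
      have h5 : M * z'.2 ≤ C' * z'.2 := by gcongr
      simp only [offs, reduceCtorEq, if_false]
      rw [abs_le]
      constructor <;> linarith
  have hval : ∀ j, ev (g (V j)) z' = (if (g (V j)).1 = 0 then 0 else Q) -
      offs none Q (fun j => ev (V j) z) j := by
    intro j
    rw [if_neg (hfst0 j), hg.ev_eq]
    simp [offs]
  -- a negative first coordinate cannot be followed by a positive one
  have order : ∀ j k : Fin (s + 1), j < k → (g (V j)).1 = -b → (g (V k)).1 = a → False := by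
    intro j k hjk h1 h2
    have e := ev_eq_dt z' (g (V k)) (g (V j))
    rw [h1, h2] at e
    have p1 := hV'.pos j
    have p2 := hV'.pos k
    have p3 := hV'.dt_pos hjk
    beta_reduce at p1 p2 p3
    nlinarith [mul_pos (by omega : 0 < a) p1, mul_pos (by omega : 0 < b) p2, mul_pos p3 hn]
  by_cases heq : (g (V i₀)).1 = (g (V i₁)).1
  · obtain ⟨p1, p2, p3⟩ := pair i₀ i₁ h01 heq
    exact Or.inl ⟨z', fun j => g (V j), a, b, hg.cop_pt.2 hz, hn, p1, p2, p3, hV', ha, by omega, hb,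
      by omega, fun j => (hi' j).1.elim Or.inl fun h => Or.inr (Or.inl h), ⟨hfst0, heq⟩, hval⟩
  · have h0 : (g (V i₀)).1 = a ∧ (g (V i₁)).1 = -b := by
      rcases (hi' i₀).1 with h | h <;> rcases (hi' i₁).1 with h' | h'
      · omega
      · exact ⟨h, h'⟩
      · exact (order _ _ h01 h h').elim
      · omega
    have h2 : (g (V i₂)).1 = -b := by
      rcases (hi' i₂).1 with h | h
      · exact (order _ _ h12 h0.2 h).elim
      · exact h
    obtain ⟨p1, p2, p3⟩ := pair i₁ i₂ h12 (h0.2.trans h2.symm)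
    refine Or.inr ⟨z', fun j => g (V j), a, b, hg.cop_pt.2 hz, hn, p1, p2, p3, hV', ha, by omega, hb,
      by omega, fun j => (hi' j).1.elim Or.inl fun h => Or.inr (Or.inl h), ⟨hfst0, ?_, ?_, ?_⟩, hval⟩
    · beta_reduce; omega
    · beta_reduce; omega
    · beta_reduce; omega

end

section

variable {d c s : ℕ} {i₀ i₁ i₂ : Fin (s + 1)}

lemma exists_diag_bound (d c : ℕ) {s : ℕ} (B : ℤ) {i₀ i₁ : Fin (s + 1)} (h01 : i₀ < i₁) :
    ∃ C : ℝ, ∀ Q : ℕ, ({q ∈ DtBdd d c s B Q | q i₀ = q i₁}.ncard : ℝ) ≤ C * ((Q : ℝ) + 1) := by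
  refine exists_linear_bound i₁ B (R := fun q D _ => q i₀ = q i₁ ∧ D i₀ i₁ ≠ 0 ∧
    ∀ j, q i₁ * D i₀ j = q i₀ * D i₁ j + q j * D i₀ i₁) ?_ ?_
  · rintro Q q ⟨⟨z, V, -, hV, hq, hB⟩, heq⟩
    refine ⟨by rw [hq]; exact (hV.pos _).le, by rw [hq]; exact (hV.1 _).2.2.1,
      fun i j => dt (V i) (V j), fun i j => dt (V i) (V j), hB, hB, heq, (hV.dt_pos h01).ne', ?_⟩
    intro j
    rw [hq, hq, hq, ev_mul_dt]
  · rintro q q' D - ⟨h1, h2, h3⟩ ⟨h1', -, h3'⟩ h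
    ext j
    refine mul_right_cancel₀ h2 ?_
    have e1 := h3 j
    have e2 := h3' j
    rw [h1] at e1
    rw [h1', ← h] at e2
    linarith

lemma CuspOff.mem_dt {A C Q : ℤ} {T : (Fin (s + 1) → ℤ) → Prop} {ν : (Fin (s + 1) → ℤ) → ℤ}
    {q : Fin (s + 1) → ℤ} (h : CuspOff d c A C T ν (offs none Q q) Q)
    (hT : ∀ α, T α → ∀ j, α j ≠ 0) : q ∈ Dt d c s Q := by
  obtain ⟨z, V, a, b, hz, -, -, -, -, hV, -, -, -, -, -, hTV, hval⟩ := h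
  refine ⟨z, V, hz, hV, fun j => ?_⟩
  have := hT _ hTV j
  rw [hval, if_neg this]
  simp [offs]

lemma dt_le_of_fst_eq {A C : ℤ} {z V W : ℤ × ℤ} (hn : 0 < z.2) (hf : V.1 = W.1)
    (hA : |V.1| ≤ A) (hC : |ev W z - ev V z| ≤ C * z.2) : dt V W ≤ A * C := by
  have e := ev_eq_dt z W V
  rw [← hf] at e
  have h1 : dt V W * z.2 = V.1 * (ev W z - ev V z) := by linear_combination -e
  have h2 : dt V W * z.2 ≤ A * (C * z.2) := by
    rw [h1]
    refine (le_abs_self _).trans ?_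
    rw [abs_mul]
    have := (abs_nonneg V.1).trans hA
    gcongr
  refine le_of_mul_le_mul_right (a := z.2) ?_ hn
  linarith

lemma lt_of_close {N n Q a b x y w m : ℤ} (hN : 2 ≤ N) (hn : 0 < n) (ha : 0 < a) (hb : b < 0)
    (hx : x ≤ Q) (hy : y ≤ Q) (hw : w ≤ Q) (hx' : N * (Q - x) < Q) (hy' : N * (Q - y) < Q)
    (hw' : N * (Q - w) < Q) (hnw : n ≤ |w - y|) (h : m * n = a * y - b * x) : N < m := by
  have half : ∀ t, t ≤ Q → N * (Q - t) < Q → Q < 2 * t := fun t h1 h2 => by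
    have : 2 * (Q - t) ≤ N * (Q - t) := mul_le_mul_of_nonneg_right hN (by omega)
    omega
  have h1 := half x hx hx'
  have h2 := half y hy hy'
  have hNn : N * n < Q := by
    have : N * |w - y| < Q := by
      rcases abs_cases (w - y) with ⟨h, -⟩ | ⟨h, -⟩ <;> rw [h]
      · exact (mul_le_mul_of_nonneg_left (by omega) (by omega)).trans_lt hy'
      · exact (mul_le_mul_of_nonneg_left (by omega) (by omega)).trans_lt hw'
    exact (mul_le_mul_of_nonneg_left hnw (by omega)).trans_lt this
  have h3 : y ≤ a * y := le_mul_of_one_le_left (by omega) ha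
  have h4 : x ≤ (-b) * x := le_mul_of_one_le_left (by omega) (by omega)
  refine lt_of_mul_lt_mul_right (a := n) ?_ hn.le
  linarith

set_option maxHeartbeats 1000000 in
lemma exists_overlap_bound {d : ℕ} (hd : 2 ≤ d) (c : ℕ) {s : ℕ} (A C : ℤ) {i₀ i₁ i₂ : Fin (s + 1)}
    (h01 : i₀ < i₁) (h12 : i₁ < i₂) {K : ℕ} (hK : 0 < K) :
    ∃ C₀ : ℝ, ∀ Q : ℕ, K ≤ Q → ({q : Fin (s + 1) → ℤ | (∀ j, ((A * C) ^ 2 + 2) * (Q - q j) < Q) ∧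
      CuspOff d c A C (HeadEq i₀ i₁) (fun o => o i₀ - o i₁) (offs none Q q) Q ∧
      CuspOff d c A C (HeadNe i₀ i₁ i₂) (fun o => o i₁ - o i₂) (offs none Q q) Q}.ncard : ℝ) ≤
      (DtCusp d c s K Q).ncard + C₀ * ((Q : ℝ) + 1) := by
  obtain ⟨B, hB⟩ := dt_bounded_of_not_straddle hd c s (K := K) (by exact_mod_cast hK)
  set S : ℕ → Set (Fin (s + 1) → ℤ) := fun Q => {q | ∃ (z z' : ℤ × ℤ) (V V' : Fin (s + 1) → ℤ × ℤ),
    IsCoprime z.1 z.2 ∧ Cons d c Q z V ∧ Cons d c Q z' V' ∧ (∀ i, q i = ev (V i) z) ∧ (∀ i, q i = ev (V' i) z') ∧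
    (∀ i j, |dt (V i) (V j)| ≤ B) ∧ (∀ i j, |dt (V' i) (V' j)| ≤ B) ∧
    dt (V i₁) (V i₂) * dt (V' i₀) (V' i₁) - dt (V i₀) (V i₁) * dt (V' i₁) (V' i₂) ≠ 0} with hS
  obtain ⟨C₀, hC₀⟩ := exists_linear_bound (S := S) i₁ B (R := fun q D D' => D i₀ i₁ ≠ 0 ∧
    D i₁ i₂ * D' i₀ i₁ - D i₀ i₁ * D' i₁ i₂ ≠ 0 ∧
    (∀ j, q i₁ * D i₀ j = q i₀ * D i₁ j + q j * D i₀ i₁) ∧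
    ∀ j, q i₁ * D' i₀ j = q i₀ * D' i₁ j + q j * D' i₀ i₁) (by
      rintro Q q ⟨z, z', V, V', -, hV, hV', hq, hq', hB, hB', hne⟩
      refine ⟨by rw [hq]; exact (hV.pos _).le, by rw [hq]; exact (hV.1 _).2.2.1,
        fun i j => dt (V i) (V j), fun i j => dt (V' i) (V' j), hB, hB', (hV.dt_pos h01).ne', hne,
        fun j => ?_, fun j => ?_⟩
      · rw [hq, hq, hq, ev_mul_dt]
      · rw [hq', hq', hq', ev_mul_dt]) (by
      rintro q q' D D' ⟨h1, h2, h3, h4⟩ ⟨-, -, h3', h4'⟩ h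
      have e0 : q i₀ = q' i₀ := by
        refine mul_right_cancel₀ h2 ?_
        have e1 := h3 i₂
        have e2 := h4 i₂
        have e3 := h3' i₂
        have e4 := h4' i₂
        rw [← h] at e3 e4
        linear_combination D i₀ i₁ * (e2 - e4) - D' i₀ i₁ * (e1 - e3)
      ext j
      refine mul_right_cancel₀ h1 ?_
      have e1 := h3 j
      have e2 := h3' j
      rw [← e0, ← h] at e2
      linarith)
  refine ⟨C₀, fun Q hKQ => ?_⟩
  refine le_trans ?_ (add_le_add_right (hC₀ Q) _)
  have hfin : (DtCusp d c s K Q ∪ S Q).Finite := by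
    refine (finite_Dt d c s Q).subset (Set.union_subset (dtCusp_subset _ _ _ _ _) ?_)
    rintro q ⟨z, -, V, -, hz, hV, -, hq, -⟩
    exact ⟨z, V, hz, hV, hq⟩
  have : {q : Fin (s + 1) → ℤ | (∀ j, ((A * C) ^ 2 + 2) * (Q - q j) < Q) ∧
      CuspOff d c A C (HeadEq i₀ i₁) (fun o => o i₀ - o i₁) (offs none Q q) Q ∧
      CuspOff d c A C (HeadNe i₀ i₁ i₂) (fun o => o i₁ - o i₂) (offs none Q q) Q} ⊆
      DtCusp d c s K Q ∪ S Q := by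
    rintro q ⟨hclose, h1, h2⟩
    obtain ⟨z, V, a, b, hz, hn, -, -, hνC, hV, ha, haA, hb, hbA, hα, hT, hval⟩ := h1
    obtain ⟨z', V', a', b', hz', hn', hν', hν0', hνC', hV', ha', haA', hb', hbA', hα', hT', hval'⟩ := h2
    have hq : ∀ i, q i = ev (V i) z := fun i => by rw [hval i, if_neg (hT.1 i)]; simp [offs]
    have hq' : ∀ i, q i = ev (V' i) z' := fun i => by rw [hval' i, if_neg (hT'.1 i)]; simp [offs]
    by_cases hs1 : ∃ w, Straddle K Q z V w
    · exact Or.inl ⟨z, V, hz, hV, hq, hs1⟩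
    by_cases hs2 : ∃ w, Straddle K Q z' V' w
    · exact Or.inl ⟨z', V', hz', hV', hq', hs2⟩
    have hKQ' : (K : ℤ) ≤ Q := by exact_mod_cast hKQ
    refine Or.inr ⟨z, z', V, V', hz, hV, hV', hq, hq', hB Q z V hKQ' hz hV (not_exists.1 hs1),
      hB Q z' V' hKQ' hz' hV' (not_exists.1 hs2), ?_⟩
    obtain ⟨hne, hfe⟩ := hT
    obtain ⟨hne', hfp, hfn, hfe'⟩ := hT'
    beta_reduce at hfe hfp hfn hfe' hνC hνC' hν0' hν'
    have hoff : ∀ j k, offs none (Q : ℤ) q j - offs none (Q : ℤ) q k = q k - q j := fun j k => by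
      simp only [offs, reduceCtorEq, if_false]; ring
    rw [hoff] at hνC hνC' hν0' hν'
    have d01 := dt_le_of_fst_eq (A := A) (C := C) hn hfe
      (by rcases hα i₀ with h | h | h
          · rw [h, abs_of_pos (by omega)]; exact haA
          · rw [h, abs_neg, abs_of_pos (by omega)]; exact hbA
          · exact absurd (show (V i₀).1 = 0 by rw [h]) (hne i₀)) (by rw [← hq, ← hq]; exact hνC)
    have d12' := dt_le_of_fst_eq (A := A) (C := C) hn' hfe'
      (by rcases hα' i₁ with h | h | h
          · rw [h, abs_of_pos (by omega)]; exact haA'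
          · rw [h, abs_neg, abs_of_pos (by omega)]; exact hbA'
          · exact absurd (show (V' i₁).1 = 0 by rw [h]) (hne' i₁)) (by rw [← hq', ← hq']; exact hνC')
    have p01 := hV.dt_pos h01
    have p12 := hV.dt_pos h12
    have p01' := hV'.dt_pos h01
    have p12' := hV'.dt_pos h12
    have e := ev_eq_dt z' (V' i₁) (V' i₀)
    rw [← hq', ← hq'] at e
    have hnle : z'.2 ≤ |q i₂ - q i₁| := Int.le_of_dvd (abs_pos.2 hν0') ((dvd_abs _ _).2 hν')
    set N := (A * C) ^ 2 + 2 with hN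
    have hN2 : 2 ≤ N := by rw [hN]; linarith [sq_nonneg (A * C)]
    have hle : ∀ j, q j ≤ Q := fun j => by rw [hq]; exact (hV.1 j).2.2.1
    have hpos : ∀ j, 0 < q j := fun j => by rw [hq]; exact hV.pos j
    have hbig : N < dt (V' i₀) (V' i₁) :=
      lt_of_close hN2 hn' hfp hfn (hle i₀) (hle i₁) (hle i₂) (hclose i₀) (hclose i₁) (hclose i₂) hnle
        (by linarith)
    have h5 : dt (V i₀) (V i₁) * dt (V' i₁) (V' i₂) ≤ (A * C) * (A * C) := by
      gcongr
      exact p01.le.trans d01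
    have h6 : dt (V' i₀) (V' i₁) ≤ dt (V i₁) (V i₂) * dt (V' i₀) (V' i₁) :=
      le_mul_of_one_le_left p01'.le p12
    have h7 : (A * C) * (A * C) = (A * C) ^ 2 := by ring
    exact (sub_pos.2 (by linarith)).ne'
  have h1 := (Set.ncard_le_ncard this hfin).trans (Set.ncard_union_le _ _)
  exact_mod_cast h1

end

lemma tendsto_div_sq_of_approx {f g : ℕ → ℝ} {l : ℝ}
    (hg : Tendsto (fun Q : ℕ => g Q / (Q : ℝ) ^ 2) atTop (nhds l))
    (h : ∀ ε, 0 < ε → ∀ᶠ Q : ℕ in atTop, |f Q - g Q| ≤ ε * (Q : ℝ) ^ 2) :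
    Tendsto (fun Q : ℕ => f Q / (Q : ℝ) ^ 2) atTop (nhds l) := by
  have h0 : Tendsto (fun Q : ℕ => f Q / (Q : ℝ) ^ 2 - g Q / (Q : ℝ) ^ 2) atTop (nhds 0) := by
    rw [Metric.tendsto_nhds]
    intro ε hε
    filter_upwards [h (ε / 2) (by positivity), eventually_gt_atTop 0] with Q hQ hQ0
    have hQ0 : (0 : ℝ) < (Q : ℝ) ^ 2 := by have : (0 : ℝ) < Q := by exact_mod_cast hQ0
                                           positivity
    rw [Real.dist_eq, sub_zero, ← sub_div, abs_div, abs_of_pos hQ0, div_lt_iff₀ hQ0]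
    nlinarith
  have := h0.add hg
  simpa using this

lemma abs_ncard_add_sub_le {α : Type*} {S T G Z : Set α} (hG : G.Finite) (hZ : Z.Finite)
    (h1 : S ⊆ G) (h2 : T ⊆ G) (h3 : G ⊆ S ∪ T ∪ Z) :
    |(S.ncard : ℝ) + T.ncard - G.ncard| ≤ (S ∩ T).ncard + Z.ncard := by
  have hS := hG.subset h1
  have hT := hG.subset h2
  have e1 : ((S ∪ T).ncard : ℝ) + (S ∩ T).ncard = S.ncard + T.ncard := by
    exact_mod_cast Set.ncard_union_add_ncard_inter S T hS hT
  have e2 : ((S ∪ T).ncard : ℝ) ≤ G.ncard := by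
    exact_mod_cast Set.ncard_le_ncard (Set.union_subset h1 h2) hG
  have e3 : (G.ncard : ℝ) ≤ (S ∪ T).ncard + Z.ncard := by
    exact_mod_cast (Set.ncard_le_ncard h3 ((hS.union hT).union hZ)).trans (Set.ncard_union_le _ _)
  have e4 : (0 : ℝ) ≤ (S ∩ T).ncard := Nat.cast_nonneg _
  have e5 : (0 : ℝ) ≤ Z.ncard := Nat.cast_nonneg _
  rw [abs_le]
  constructor <;> linarith

lemma le_of_mem_dt {d c s : ℕ} {Q : ℤ} {q : Fin (s + 1) → ℤ} (hq : q ∈ Dt d c s Q)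
    (j : Fin (s + 1)) : q j ≤ Q := by
  obtain ⟨z, V, -, hV, h⟩ := hq
  rw [h]
  exact (hV.1 j).2.2.1

lemma mul_sub_lt_of_mem_cube {s Q : ℕ} {q : Fin (s + 1) → ℤ} {η : ℝ} {M N : ℤ} (hQ : 0 < Q)
    (h : (fun i => (q i : ℝ) / Q) ∈ cube (cornerPt none) η) (hN : 0 < N) (hη : η < 1 / N) (hM : M ≤ N)
    {j : Fin (s + 1)} (hq : q j ≤ Q) : M * (Q - q j) < Q := by
  rw [mem_cube_cornerPt none hQ] at h
  have hQ0 : (0 : ℝ) < Q := by exact_mod_cast hQ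
  have hN0 : (0 : ℝ) < N := by exact_mod_cast hN
  have h1 := (le_abs_self _).trans_lt (h j)
  simp only [offs, reduceCtorEq, if_false] at h1
  have h2 : (N : ℝ) * (((Q : ℤ) - q j : ℤ) : ℝ) < Q := by
    have h3 : η * N < 1 := (lt_div_iff₀ hN0).1 hη
    have h4 := mul_lt_mul_of_pos_left h1 hN0
    refine h4.trans ?_
    have := mul_lt_mul_of_pos_right h3 hQ0
    linarith
  have h5 : N * ((Q : ℤ) - q j) < Q := by exact_mod_cast h2
  exact (mul_le_mul_of_nonneg_right hM (by omega)).trans_lt h5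

lemma abs_sub_le_two_mul {s : ℕ} (i j : Fin (s + 1)) (o : Fin (s + 1) → ℤ) (Y : ℝ)
    (h : ∀ i, |(o i : ℝ)| < Y) : |((o i - o j : ℤ) : ℝ)| ≤ 2 * Y := by
  push_cast
  have := abs_sub (o i : ℝ) (o j : ℝ)
  linarith [h i, h j]

lemma limit_of_top_corner {d : ℕ} (hd : 2 ≤ d) (c : ℕ) {s : ℕ} {i₀ i₁ i₂ : Fin (s + 1)}
    (h01 : i₀ < i₁) (h12 : i₁ < i₂) {ℓ : ℝ → ℝ} (hℓ : ∀ η, 0 < η →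
      Tendsto (fun Q : ℕ => ({q ∈ Dt d c s Q | (fun j => (q j : ℝ) / Q) ∈
        cube (cornerPt none) η}.ncard : ℝ) / (Q : ℝ) ^ 2) atTop (nhds (ℓ η))) :
    ∃ l, Tendsto (fun η => ℓ η / η ^ 2) (nhdsWithin 0 (Set.Ioi 0)) (nhds l) := by
  have hs : 1 ≤ s := by have := i₁.2; have : (i₀ : ℕ) < i₁ := h01; omega
  obtain ⟨A₀, C₀, K, hA₀, hC₀, hK, hst⟩ := exists_cuspOff_of_straddle hd c s
  obtain ⟨B, hB⟩ := exists_dt_subset hd c s hK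
  obtain ⟨D, hD⟩ := exists_diag_bound d c (s := s) B h01
  set A := max A₀ B
  set C := max C₀ B
  set N := max (max (2 * B + 2) ((A * C) ^ 2 + 2)) 2 with hN
  have hN1 : 2 * B + 2 ≤ N := (le_max_left _ _).trans (le_max_left _ _)
  have hN2 : (A * C) ^ 2 + 2 ≤ N := (le_max_right _ _).trans (le_max_left _ _)
  have hN3 : 2 ≤ N := le_max_right _ _
  clear_value N
  have hN0 : (0 : ℝ) < N := by exact_mod_cast (by omega : 0 < N)
  set X₁ : (Fin (s + 1) → ℤ) → ℕ → Prop := fun o Q =>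
    CuspOff d c A C (HeadEq i₀ i₁) (fun o => o i₀ - o i₁) o Q with hX₁
  set X₂ : (Fin (s + 1) → ℤ) → ℕ → Prop := fun o Q =>
    CuspOff d c A C (HeadNe i₀ i₁ i₂) (fun o => o i₁ - o i₂) o Q with hX₂
  refine tendsto_of_window (F := fun Y Q => offsetCount X₁ Y Q + offsetCount X₂ Y Q) (η₁ := 1 / N)
    (fun Q => (offsetCount_mono X₁ Q).add (offsetCount_mono X₂ Q))
    (fun Y Q => add_nonneg (offsetCount_nonneg _ _ _) (offsetCount_nonneg _ _ _)) (by positivity)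
    (fun η hη hη1 => ?_)
    (WindowUniform.add (windowUniform_cuspOff (by omega) _ (abs_sub_le_two_mul i₀ i₁))
      (windowUniform_cuspOff (by omega) _ (abs_sub_le_two_mul i₁ i₂)))
  refine tendsto_div_sq_of_approx (hℓ η hη) fun ε hε => ?_
  obtain ⟨L, hL⟩ := exists_nat_gt (2 * s / ε + 1)
  have hL1 : (1 : ℝ) < L := lt_of_le_of_lt (by simp; positivity) hL
  have hL0 : 0 < L := by exact_mod_cast (zero_lt_one.trans hL1)
  obtain ⟨E, hE⟩ := exists_overlap_bound hd c A C h01 h12 hL0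
  filter_upwards [eventually_linear_le_sq (half_pos hε) (E + D), eventually_ge_atTop L,
    eventually_ge_atTop K.toNat] with Q hQ hLQ hKQ
  have hQ0 : 0 < Q := by omega
  rw [offsetCount_eq none X₁ hQ0, offsetCount_eq none X₂ hQ0]
  have hfin := finite_Dt d c s Q
  have m₁ : ∀ q, X₁ (offs none Q q) Q → q ∈ Dt d c s Q := fun q h => h.mem_dt fun α h => h.1
  have m₂ : ∀ q, X₂ (offs none Q q) Q → q ∈ Dt d c s Q := fun q h => h.mem_dt fun α h => h.1
  have hZ : {q ∈ DtBdd d c s B Q | q i₀ = q i₁}.Finite :=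
    hfin.subset fun q h => dtBdd_subset _ _ _ _ _ h.1
  have sub₁ : {q : Fin (s + 1) → ℤ | (fun i => (q i : ℝ) / Q) ∈ cube (cornerPt none) η ∧
      X₁ (offs none Q q) Q} ⊆
      {q ∈ Dt d c s Q | (fun i => (q i : ℝ) / Q) ∈ cube (cornerPt none) η} :=
    fun q h => ⟨m₁ q h.2, h.1⟩
  have sub₂ : {q : Fin (s + 1) → ℤ | (fun i => (q i : ℝ) / Q) ∈ cube (cornerPt none) η ∧
      X₂ (offs none Q q) Q} ⊆
      {q ∈ Dt d c s Q | (fun i => (q i : ℝ) / Q) ∈ cube (cornerPt none) η} :=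
    fun q h => ⟨m₂ q h.2, h.1⟩
  refine (abs_ncard_add_sub_le (hfin.subset fun q h => h.1) hZ sub₁ sub₂ ?_).trans ?_
  · rintro q ⟨hq, hcube⟩
    have hclose : ∀ M ≤ N, ∀ j, M * (Q - q j) < Q := fun M hM j =>
      mul_sub_lt_of_mem_cube hQ0 hcube (by omega) hη1 hM (le_of_mem_dt hq j)
    rcases hB Q (by omega) hq with h | h
    · by_cases hne : q i₀ = q i₁
      · exact Or.inr ⟨h, hne⟩
      obtain ⟨z, V, hz, hV, hqV, hb⟩ := h
      obtain rfl : q = fun j => ev (V j) z := funext hqV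
      exact Or.inl (Or.inl ⟨hcube, cuspOff_of_bdd hz hV hb (hclose _ hN1) h01 hne
        (le_max_right _ _) (le_max_right _ _)⟩)
    · obtain ⟨z, V, hz, hV, hqV, w, hw⟩ := h
      obtain rfl : q = fun j => ev (V j) z := funext hqV
      refine Or.inl ?_
      rcases hst Q z V w i₀ i₁ i₂ hz hV hw h01 h12 (fun j => by have := hclose 2 hN3 j; beta_reduce at this; omega) A C
        (le_max_left _ _) (le_max_left _ _) with h | h
      · exact Or.inl ⟨hcube, h⟩
      · exact Or.inr ⟨hcube, h⟩
  · have h1 : ({q : Fin (s + 1) → ℤ | (fun i => (q i : ℝ) / Q) ∈ cube (cornerPt none) η ∧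
        X₁ (offs none Q q) Q} ∩ {q | (fun i => (q i : ℝ) / Q) ∈ cube (cornerPt none) η ∧
        X₂ (offs none Q q) Q}).ncard ≤ {q : Fin (s + 1) → ℤ |
          (∀ j, ((A * C) ^ 2 + 2) * (Q - q j) < Q) ∧ X₁ (offs none Q q) Q ∧
          X₂ (offs none Q q) Q}.ncard := by
      refine Set.ncard_le_ncard ?_ (hfin.subset fun q h => m₁ q h.2.1)
      rintro q ⟨⟨hc, h1⟩, -, h2⟩
      exact ⟨fun j => mul_sub_lt_of_mem_cube hQ0 hc (by omega) hη1 hN2 (le_of_mem_dt (m₁ q h1) j),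
        h1, h2⟩
    have h2 := (Nat.cast_le (α := ℝ)).2 h1
    have h3 := hE Q hLQ
    have h4 := hD Q
    have h5 : ((DtCusp d c s L Q).ncard : ℝ) ≤ s * ((Q : ℝ) / L) ^ 2 := ncard_dtCusp_le d c hs L hL0 Q
    have hL2 : (0 : ℝ) < L := by linarith
    have h6 : (s : ℝ) * ((Q : ℝ) / L) ^ 2 ≤ ε / 2 * (Q : ℝ) ^ 2 := by
      have e1 : 2 * (s : ℝ) / ε < L := by linarith
      rw [div_lt_iff₀ hε] at e1
      have e2 : (s : ℝ) ≤ ε / 2 * (L : ℝ) ^ 2 := by nlinarith [mul_pos hε hL2]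
      calc (s : ℝ) * ((Q : ℝ) / L) ^ 2 ≤ ε / 2 * (L : ℝ) ^ 2 * ((Q : ℝ) / L) ^ 2 := by gcongr
        _ = ε / 2 * (Q : ℝ) ^ 2 := by field_simp
    linarith

lemma exists_corner_limit {d : ℕ} (hd : 2 ≤ d) (c : ℕ) {s : ℕ} (hs : 1 ≤ s) (u : Fin (s + 1) → ℝ)
    {ℓ : ℝ → ℝ} (hℓ : ∀ η, 0 < η →
      Tendsto (fun Q : ℕ => ({q ∈ Dt d c s Q | (fun i => (q i : ℝ) / Q) ∈ cube u η}.ncard : ℝ) /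
        (Q : ℝ) ^ 2) atTop (nhds (ℓ η))) (C : ℝ) (hC : 0 ≤ C) :
    ∃ g : ENNReal, Tendsto (fun η => ENNReal.ofReal (C * (ℓ η / η ^ 2)))
      (nhdsWithin 0 (Set.Ioi 0)) (nhds g) := by
  have real : (∃ l, Tendsto (fun η => ℓ η / η ^ 2) (nhdsWithin 0 (Set.Ioi 0)) (nhds l)) →
      ∃ g : ENNReal, Tendsto (fun η => ENNReal.ofReal (C * (ℓ η / η ^ 2)))
        (nhdsWithin 0 (Set.Ioi 0)) (nhds g) := fun ⟨l, hl⟩ =>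
    ⟨_, ENNReal.tendsto_ofReal (hl.const_mul C)⟩
  by_cases hu : ∀ o, IsCuspCorner o → cornerPt o ≠ u
  · exact real (limit_of_bdd hd c hs hu hℓ)
  push Not at hu
  obtain ⟨o, ho, rfl⟩ := hu
  cases o with
  | some i =>
    obtain ⟨h0, h1⟩ := ho i rfl
    exact real (limit_of_inner_corner hd c h0 h1 hℓ)
  | none =>
    rcases hs.eq_or_lt with rfl | hs
    · have e : (cornerPt none : Fin 2 → ℝ) = fun _ => 1 := funext fun _ => by simp [cornerPt]
      rw [e] at hℓ
      exact limit_of_pair hd c hℓ C hC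
    · exact real (limit_of_top_corner hd c (i₀ := ⟨0, by omega⟩) (i₁ := ⟨1, by omega⟩)
        (i₂ := ⟨2, by omega⟩) (Fin.mk_lt_mk.2 (by omega))
        (Fin.mk_lt_mk.2 (by omega)) hℓ)

/-- Existence of the local density `g_s(u)`: (i) for each `η > 0` the proportion
`L(u, η)` of tuples of `D_s^Q(c,d)/Q` lying in the cube of edge `2η` centered at `u`
has a limit as `Q → ∞`, and (ii) `L(u, η)/(4η²)` has a limit in `[0, ∞]` as `η → 0⁺`. -/
theorem local_density_exists (d : ℕ) (hd : 2 ≤ d) (c : ℕ) (hc : c ≤ d - 1)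
    (s : ℕ) (hs : 1 ≤ s) (u : Fin (s + 1) → ℝ) (hu : ∀ i, u i ∈ Set.Icc (0 : ℝ) 1) :
    ∃ L : ℝ → ℝ,
      (∀ η : ℝ, 0 < η →
        Tendsto (fun Q : ℕ =>
            (Nat.card {q ∈ DsQ Q c d s | ∀ i, |(q i : ℝ) / (Q : ℝ) - u i| < η} : ℝ)
              / (Nat.card (DsQ Q c d s) : ℝ))
          atTop (nhds (L η))) ∧
      ∃ g : ENNReal,
        Tendsto (fun η : ℝ => ENNReal.ofReal (L η / (4 * η ^ 2)))
          (nhdsWithin 0 (Set.Ioi 0)) (nhds g) := by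
  choose ℓ hℓ using fun η : ℝ => exists_dt_limit hd c hs (convex_cube u η)
  obtain ⟨τ, hτ, H⟩ := exists_dsQ_limit hd (show c < d by omega) hs
  refine ⟨fun η => ℓ η / τ, fun η _ => ?_, ?_⟩
  · exact H (cube u η) (ℓ η) (hℓ η)
  obtain ⟨g, hg⟩ := exists_corner_limit hd c hs u (fun η _ => hℓ η) (1 / (4 * τ)) (by positivity)
  refine ⟨g, hg.congr fun η => ?_⟩
  congr 1
  rw [div_mul_div_comm, div_div, one_mul]
  congr 1
  ring
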